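/- arXiv:1506.03759 — 4 statements merged into one kernel-verified Lean document; each statement's English description precedes it below -/
import Mathlib

section
/- For all n ≥ 8, the maximum number of edges in a 3-uniform hypergraph on n vertices containing no linear path P³₃ of length 3 is C(n-1,2). -/
/-- `H` contains a copy of the 3-uniform linear path `P³₃`:
three edges with consecutive intersections of size 1 and disjoint end edges. -/
def HasP33 {V : Type*} [DecidableEq V] (H : Finset (Finset V)) : Prop :=
  ∃ e₁ e₂ e₃, e₁ ∈ H ∧ e₂ ∈ H ∧ e₃ ∈ H ∧
    (e₁ ∩ e₂).card = 1 ∧ (e₂ ∩ e₃).card = 1 ∧ e₁ ∩ e₃ = ∅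

/-- Triples of 3-sets, used as certificates (copies of the path). -/
abbrev Tri (k : ℕ) := Finset (Fin k) × Finset (Fin k) × Finset (Fin k)

/-- the triples of a certificate path that are not known to be edges -/
def blk {k : ℕ} (K : Finset (Finset (Fin k))) (p : Tri k) : Finset (Finset (Fin k)) :=
  ({p.1, p.2.1, p.2.2} : Finset (Finset (Fin k))) \ K

/-- check that the certificate consists of paths with disjoint blocks in `U` -/
def chk {k : ℕ} (K : Finset (Finset (Fin k))) :
    Finset (Finset (Fin k)) → List (Tri k) → Bool
  | _, [] => true
  | U, p :: ps =>
    decide ((p.1 ∩ p.2.1).card = 1) && decide ((p.2.1 ∩ p.2.2).card = 1) &&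
    decide (p.1 ∩ p.2.2 = ∅) && decide (blk K p ⊆ U) && chk K (U \ blk K p) ps

def paths7 : List (Tri 7) :=
  [({0, 1, 2}, {2, 4, 6}, {3, 5, 6}),
   ({1, 2, 3}, {0, 3, 5}, {0, 4, 6}),
   ({2, 3, 4}, {1, 4, 6}, {0, 1, 5}),
   ({3, 4, 5}, {0, 2, 5}, {1, 2, 6}),
   ({4, 5, 6}, {1, 3, 6}, {0, 2, 3}),
   ({0, 5, 6}, {0, 2, 4}, {1, 3, 4}),
   ({0, 1, 6}, {1, 3, 5}, {2, 4, 5})]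
def pathsCore : List (Tri 7) :=
  [({0, 5, 6}, {0, 4, 3}, {1, 2, 3}),
   ({0, 5, 6}, {0, 3, 4}, {1, 2, 4}),
   ({0, 3, 4}, {0, 6, 5}, {1, 2, 5}),
   ({0, 3, 4}, {0, 5, 6}, {1, 2, 6}),
   ({0, 5, 6}, {0, 2, 1}, {3, 4, 1}),
   ({0, 5, 6}, {0, 1, 2}, {3, 4, 2}),
   ({0, 1, 2}, {0, 6, 5}, {3, 4, 5}),
   ({0, 1, 2}, {0, 5, 6}, {3, 4, 6}),
   ({0, 3, 4}, {0, 2, 1}, {5, 6, 1}),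
   ({0, 3, 4}, {0, 1, 2}, {5, 6, 2}),
   ({0, 1, 2}, {0, 4, 3}, {5, 6, 3}),
   ({0, 1, 2}, {0, 3, 4}, {5, 6, 4}),
   ({0, 2, 4}, {0, 6, 5}, {1, 3, 5}),
   ({0, 2, 6}, {0, 3, 4}, {1, 4, 5}),
   ({0, 2, 3}, {0, 5, 6}, {1, 4, 6}),
   ({0, 2, 5}, {0, 4, 3}, {1, 3, 6}),
   ({0, 1, 4}, {0, 6, 5}, {2, 3, 5}),
   ({0, 1, 6}, {0, 3, 4}, {2, 4, 5}),
   ({0, 1, 3}, {0, 5, 6}, {2, 4, 6}),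
   ({0, 1, 5}, {0, 4, 3}, {2, 3, 6})]
def pathsZ : List (Tri 8) :=
  [({0, 5, 6}, {0, 4, 3}, {1, 3, 7}),
   ({0, 5, 6}, {0, 3, 4}, {1, 4, 7}),
   ({0, 5, 6}, {0, 4, 3}, {2, 3, 7}),
   ({0, 5, 6}, {0, 3, 4}, {2, 4, 7}),
   ({0, 3, 4}, {0, 6, 5}, {1, 5, 7}),
   ({0, 3, 4}, {0, 5, 6}, {1, 6, 7}),
   ({0, 3, 4}, {0, 6, 5}, {2, 5, 7}),
   ({0, 3, 4}, {0, 5, 6}, {2, 6, 7}),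
   ({0, 1, 2}, {0, 6, 5}, {3, 5, 7}),
   ({0, 1, 2}, {0, 5, 6}, {3, 6, 7}),
   ({0, 1, 2}, {0, 6, 5}, {4, 5, 7}),
   ({0, 1, 2}, {0, 5, 6}, {4, 6, 7}),
   ({0, 5, 6}, {0, 3, 7}, {1, 2, 7}),
   ({0, 1, 2}, {0, 5, 7}, {3, 4, 7}),
   ({0, 3, 4}, {0, 1, 7}, {5, 6, 7})]
def pathsT : List (Tri 10) :=
  [({0, 5, 6}, {0, 4, 3}, {1, 3, 7}),
   ({0, 5, 6}, {0, 3, 4}, {1, 4, 7}),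
   ({0, 5, 6}, {0, 4, 3}, {2, 3, 7}),
   ({0, 5, 6}, {0, 3, 4}, {2, 4, 7}),
   ({0, 3, 4}, {0, 6, 5}, {1, 5, 7}),
   ({0, 3, 4}, {0, 5, 6}, {1, 6, 7}),
   ({0, 3, 4}, {0, 6, 5}, {2, 5, 7}),
   ({0, 3, 4}, {0, 5, 6}, {2, 6, 7}),
   ({0, 1, 2}, {0, 6, 5}, {3, 5, 7}),
   ({0, 1, 2}, {0, 5, 6}, {3, 6, 7}),
   ({0, 1, 2}, {0, 6, 5}, {4, 5, 7}),
   ({0, 1, 2}, {0, 5, 6}, {4, 6, 7}),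
   ({0, 3, 4}, {0, 1, 7}, {7, 8, 9}),
   ({0, 3, 4}, {0, 2, 7}, {7, 8, 9}),
   ({0, 1, 2}, {0, 3, 7}, {7, 8, 9}),
   ({0, 1, 2}, {0, 4, 7}, {7, 8, 9}),
   ({0, 1, 2}, {0, 5, 7}, {7, 8, 9}),
   ({0, 1, 2}, {0, 6, 7}, {7, 8, 9}),
   ({0, 5, 6}, {0, 4, 3}, {1, 3, 8}),
   ({0, 5, 6}, {0, 3, 4}, {1, 4, 8}),
   ({0, 5, 6}, {0, 4, 3}, {2, 3, 8}),
   ({0, 5, 6}, {0, 3, 4}, {2, 4, 8}),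
   ({0, 3, 4}, {0, 6, 5}, {1, 5, 8}),
   ({0, 3, 4}, {0, 5, 6}, {1, 6, 8}),
   ({0, 3, 4}, {0, 6, 5}, {2, 5, 8}),
   ({0, 3, 4}, {0, 5, 6}, {2, 6, 8}),
   ({0, 1, 2}, {0, 6, 5}, {3, 5, 8}),
   ({0, 1, 2}, {0, 5, 6}, {3, 6, 8}),
   ({0, 1, 2}, {0, 6, 5}, {4, 5, 8}),
   ({0, 1, 2}, {0, 5, 6}, {4, 6, 8}),
   ({0, 3, 4}, {0, 1, 8}, {7, 8, 9}),
   ({0, 3, 4}, {0, 2, 8}, {7, 8, 9}),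
   ({0, 1, 2}, {0, 3, 8}, {7, 8, 9}),
   ({0, 1, 2}, {0, 4, 8}, {7, 8, 9}),
   ({0, 1, 2}, {0, 5, 8}, {7, 8, 9}),
   ({0, 1, 2}, {0, 6, 8}, {7, 8, 9}),
   ({0, 5, 6}, {0, 4, 3}, {1, 3, 9}),
   ({0, 5, 6}, {0, 3, 4}, {1, 4, 9}),
   ({0, 5, 6}, {0, 4, 3}, {2, 3, 9}),
   ({0, 5, 6}, {0, 3, 4}, {2, 4, 9}),
   ({0, 3, 4}, {0, 6, 5}, {1, 5, 9}),
   ({0, 3, 4}, {0, 5, 6}, {1, 6, 9}),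
   ({0, 3, 4}, {0, 6, 5}, {2, 5, 9}),
   ({0, 3, 4}, {0, 5, 6}, {2, 6, 9}),
   ({0, 1, 2}, {0, 6, 5}, {3, 5, 9}),
   ({0, 1, 2}, {0, 5, 6}, {3, 6, 9}),
   ({0, 1, 2}, {0, 6, 5}, {4, 5, 9}),
   ({0, 1, 2}, {0, 5, 6}, {4, 6, 9}),
   ({0, 3, 4}, {0, 1, 9}, {7, 8, 9}),
   ({0, 3, 4}, {0, 2, 9}, {7, 8, 9}),
   ({0, 1, 2}, {0, 3, 9}, {7, 8, 9}),
   ({0, 1, 2}, {0, 4, 9}, {7, 8, 9}),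
   ({0, 1, 2}, {0, 5, 9}, {7, 8, 9}),
   ({0, 1, 2}, {0, 6, 9}, {7, 8, 9}),
   ({1, 2, 7}, {7, 8, 9}, {3, 4, 8}),
   ({1, 2, 8}, {7, 8, 9}, {3, 4, 7}),
   ({1, 2, 9}, {7, 8, 9}, {5, 6, 7}),
   ({3, 4, 9}, {7, 8, 9}, {5, 6, 8})]

section
variable {V : Type*} [DecidableEq V] {H : Finset (Finset V)}

lemma engine {k : ℕ} (φ : Fin k ↪ V) (hP : ¬ HasP33 H) (K : Finset (Finset (Fin k)))
    (hK : ∀ s ∈ K, s.map φ ∈ H) (ps : List (Tri k)) :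
    ∀ U : Finset (Finset (Fin k)), chk K U ps = true →
      (U.filter (fun s => s.map φ ∈ H)).card + ps.length ≤ U.card := by
  induction ps with
  | nil => intro U _; simpa using Finset.card_filter_le _ _
  | cons p ps ih =>
    intro U hc
    simp only [chk, Bool.and_eq_true, decide_eq_true_eq] at hc
    obtain ⟨⟨⟨⟨h1, h2⟩, h3⟩, h4⟩, h5⟩ := hc
    have hi := ih _ h5
    have hmiss : ∃ s ∈ blk K p, s.map φ ∉ H := by
      by_contra hcon
      push Not at hcon
      have hall : ∀ s ∈ ({p.1, p.2.1, p.2.2} : Finset (Finset (Fin k))), s.map φ ∈ H := by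
        intro s hs
        by_cases hsK : s ∈ K
        · exact hK s hsK
        · exact hcon s (by simp only [blk, Finset.mem_sdiff]; exact ⟨hs, hsK⟩)
      apply hP
      refine ⟨p.1.map φ, p.2.1.map φ, p.2.2.map φ, hall _ (by simp), hall _ (by simp),
        hall _ (by simp), ?_, ?_, ?_⟩
      · rw [← Finset.map_inter, Finset.card_map, h1]
      · rw [← Finset.map_inter, Finset.card_map, h2]
      · rw [← Finset.map_inter, h3, Finset.map_empty]
    obtain ⟨s, hs, hsH⟩ := hmiss
    have hsub : U.filter (fun s => s.map φ ∈ H) ⊆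
        (U \ blk K p).filter (fun s => s.map φ ∈ H) ∪ (blk K p).erase s := by
      intro t ht
      simp only [Finset.mem_filter, Finset.mem_union, Finset.mem_sdiff, Finset.mem_erase] at ht ⊢
      by_cases htb : t ∈ blk K p
      · right
        refine ⟨?_, htb⟩
        rintro rfl
        exact hsH ht.2
      · left; exact ⟨⟨ht.1, htb⟩, ht.2⟩
    have hle := (Finset.card_le_card hsub).trans (Finset.card_union_le _ _)
    rw [Finset.card_erase_of_mem hs] at hle
    have hpos : 0 < (blk K p).card := Finset.card_pos.mpr ⟨s, hs⟩
    have hsd := Finset.card_sdiff_add_card_eq_card h4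
    simp only [List.length_cons]
    omega

/-- transported version -/
lemma engine' {k : ℕ} (φ : Fin k ↪ V) (hP : ¬ HasP33 H) (K : Finset (Finset (Fin k)))
    (hK : ∀ s ∈ K, s.map φ ∈ H) (ps : List (Tri k)) (U : Finset (Finset (Fin k)))
    (hc : chk K U ps = true) (F : Finset (Finset V)) (hFH : F ⊆ H)
    (hF : ∀ s : Finset (Fin k), s.map φ ∈ F → s ∈ U)
    (hr : ∀ e ∈ F, e ⊆ Finset.univ.map φ) :
    F.card + ps.length ≤ U.card := by
  have h := engine φ hP K hK ps U hc
  have hsub : F ⊆ (U.filter (fun s => s.map φ ∈ H)).image (fun s => s.map φ) := by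
    intro e he
    obtain ⟨s, -, rfl⟩ := Finset.subset_map_iff.mp (hr e he)
    exact Finset.mem_image.mpr ⟨s, Finset.mem_filter.mpr ⟨hF s he, hFH he⟩, rfl⟩
  have := (Finset.card_le_card hsub).trans Finset.card_image_le
  omega

lemma chk7 : chk ∅ (Finset.powersetCard 3 Finset.univ) paths7 = true := by decide +kernel
lemma chkCore : chk {{0,1,2},{0,3,4},{0,5,6}} (Finset.powersetCard 3 Finset.univ) pathsCore = true := by
  decide +kernel
lemma chkZ : chk {{0,1,2},{0,3,4},{0,5,6}}
    ((Finset.powersetCard 3 Finset.univ).filter (fun s => 7 ∈ s)) pathsZ = true := by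
  decide +kernel
/-- triples with exactly one vertex among the last three -/
def UT : Finset (Finset (Fin 10)) :=
  (Finset.powersetCard 3 Finset.univ).filter (fun s => (s ∩ {7,8,9}).card = 1)
lemma chkT : chk {{0,1,2},{0,3,4},{0,5,6},{7,8,9}} UT pathsT = true := by
  decide +kernel
lemma cardZ : ((Finset.powersetCard 3 (Finset.univ : Finset (Fin 8))).filter (fun s => 7 ∈ s)).card = 21 := by
  decide +kernel
lemma cardT : UT.card = 63 := by decide +kernel
end

section
variable {V : Type*} [DecidableEq V] {H : Finset (Finset V)}

/-- the numerical bound used in the induction -/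
def Bd (n : ℕ) : ℕ := if n ≤ 6 then n.choose 3 else if n = 7 then 28 else (n - 1).choose 2

lemma tri1 (a b c : V) : ({a, b, c} : Finset V) = {a, c, b} := by ext; simp; tauto
lemma tri2 (a b c : V) : ({a, b, c} : Finset V) = {b, a, c} := by ext; simp; tauto
lemma tri3 (a b c : V) : ({a, b, c} : Finset V) = {b, c, a} := by ext; simp; tauto
lemma tri4 (a b c : V) : ({a, b, c} : Finset V) = {c, a, b} := by ext; simp; tauto
lemma tri5 (a b c : V) : ({a, b, c} : Finset V) = {c, b, a} := by ext; simp; tauto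

lemma noP (hP : ¬ HasP33 H) {s₁ s₂ s₃ : Finset V} (h1 : s₁ ∈ H) (h2 : s₂ ∈ H) (h3 : s₃ ∈ H)
    (a b c d e f g : V) (hn : [a, b, c, d, e, f, g].Nodup)
    (e1 : s₁ = {a, b, c} := by
      with_reducible
        first
        | rfl
        | exact tri1 _ _ _
        | exact tri2 _ _ _
        | exact tri3 _ _ _
        | exact tri4 _ _ _
        | exact tri5 _ _ _)
    (e2 : s₂ = {c, d, e} := by
      with_reducible
        first
        | rfl
        | exact tri1 _ _ _
        | exact tri2 _ _ _
        | exact tri3 _ _ _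
        | exact tri4 _ _ _
        | exact tri5 _ _ _)
    (e3 : s₃ = {e, f, g} := by
      with_reducible
        first
        | rfl
        | exact tri1 _ _ _
        | exact tri2 _ _ _
        | exact tri3 _ _ _
        | exact tri4 _ _ _
        | exact tri5 _ _ _) : False := by
  subst e1 e2 e3
  apply hP
  simp only [List.nodup_cons, List.mem_cons, List.not_mem_nil, or_false, not_or] at hn
  refine ⟨_, _, _, h1, h2, h3, ?_, ?_, ?_⟩
  · rw [Finset.card_eq_one]; refine ⟨c, ?_⟩; ext v; simp; grind
  · rw [Finset.card_eq_one]; refine ⟨e, ?_⟩; ext v; simp; grind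
  · ext v; simp; grind

lemma split3 {e : Finset V} (he : e.card = 3) (W : Finset V) :
    e ⊆ W ∨ (∃ p q r, e = {p, q, r} ∧ p ∉ W ∧ q ∈ W ∧ r ∈ W ∧ p ≠ q ∧ p ≠ r ∧ q ≠ r) ∨
    (∃ p q r, e = {p, q, r} ∧ p ∉ W ∧ q ∉ W ∧ r ∈ W ∧ p ≠ q ∧ p ≠ r ∧ q ≠ r) ∨
    (∀ v ∈ e, v ∉ W) := by
  obtain ⟨p, q, r, hpq, hpr, hqr, rfl⟩ := Finset.card_eq_three.mp he
  have e1 : ({p, q, r} : Finset V) = {q, p, r} := by ext; simp; tauto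
  have e2 : ({p, q, r} : Finset V) = {r, p, q} := by ext; simp; tauto
  have e3 : ({p, q, r} : Finset V) = {p, r, q} := by ext; simp; tauto
  have e4 : ({p, q, r} : Finset V) = {q, r, p} := by ext; simp; tauto
  by_cases hp : p ∈ W <;> by_cases hq : q ∈ W <;> by_cases hr : r ∈ W
  · left; intro v; simp; grind
  · right; left; exact ⟨r, p, q, e2, hr, hp, hq, hpr.symm, hqr.symm, hpq⟩
  · right; left; exact ⟨q, p, r, e1, hq, hp, hr, hpq.symm, hqr, hpr⟩
  · right; right; left; exact ⟨q, r, p, e4, hq, hr, hp, hqr, hpq.symm, hpr.symm⟩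
  · right; left; exact ⟨p, q, r, rfl, hp, hq, hr, hpq, hpr, hqr⟩
  · right; right; left; exact ⟨p, r, q, e3, hp, hr, hq, hpr, hpq, hqr.symm⟩
  · right; right; left; exact ⟨p, q, r, rfl, hp, hq, hr, hpq, hpr, hqr⟩
  · right; right; right; intro v; simp; grind

/-- the embedding given by a list without repetition -/
def emb (l : List V) (h : l.Nodup) : Fin l.length ↪ V := ⟨l.get, List.nodup_iff_injective_get.mp h⟩

lemma emb_range (l : List V) (h : l.Nodup) : Finset.univ.map (emb l h) = l.toFinset := by
  ext v
  simp [emb, List.mem_iff_get]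

lemma seven_le (hP : ¬ HasP33 H) (h3 : ∀ e ∈ H, e.card = 3) (S : Finset V) (hS : S.card = 7)
    (hHS : ∀ e ∈ H, e ⊆ S) : H.card ≤ 28 := by
  let φ : Fin 7 ↪ V := (S.equivFinOfCardEq hS).symm.toEmbedding.trans (Function.Embedding.subtype _)
  have hr : Finset.univ.map φ = S := by
    ext v
    simp only [Finset.mem_map, Finset.mem_univ, true_and, φ]
    constructor
    · rintro ⟨i, rfl⟩; simp
    · intro hv; exact ⟨S.equivFinOfCardEq hS ⟨v, hv⟩, by simp⟩
  have := engine' φ hP ∅ (by simp) paths7 _ chk7 H (fun _ h => h)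
    (by intro s hs; have := h3 _ hs; simpa [Finset.mem_powersetCard] using this)
    (by intro e he; rw [hr]; exact hHS e he)
  have hl : paths7.length = 7 := rfl
  have hc : (Finset.powersetCard 3 (Finset.univ : Finset (Fin 7))).card = 35 := by
    rw [Finset.card_powersetCard]; rfl
  omega

/-- edges inside a 7-set that contains three edges meeting in one vertex -/
lemma core_le (hP : ¬ HasP33 H) (h3 : ∀ e ∈ H, e.card = 3) (x a b c d e f : V)
    (hn : [x, a, b, c, d, e, f].Nodup) (h1 : {x, a, b} ∈ H) (h2 : {x, c, d} ∈ H)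
    (h4 : {x, e, f} ∈ H) :
    (H.filter (fun s => s ⊆ [x, a, b, c, d, e, f].toFinset)).card ≤ 15 := by
  have := engine' (emb _ hn) hP {{0,1,2},{0,3,4},{0,5,6}} (by
      intro s hs
      simp only [Finset.mem_insert, Finset.mem_singleton] at hs
      rcases hs with rfl | rfl | rfl <;> simpa [emb]) pathsCore _ chkCore
    (H.filter (fun s => s ⊆ [x, a, b, c, d, e, f].toFinset)) (Finset.filter_subset _ _)
    (by
      intro s hs
      have := h3 _ (Finset.mem_filter.mp hs).1
      rw [Finset.card_map] at this
      exact Finset.mem_powersetCard.mpr ⟨Finset.subset_univ _, this⟩)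
    (by intro e he; rw [emb_range]; exact (Finset.mem_filter.mp he).2)
  have hl : pathsCore.length = 20 := rfl
  have hc : (Finset.powersetCard 3 (Finset.univ : Finset (Fin 7))).card = 35 := by
    rw [Finset.card_powersetCard]; rfl
  have hc' : (Finset.powersetCard 3 (Finset.univ : Finset (Fin [x, a, b, c, d, e, f].length))).card = 35 := hc
  omega

lemma z_le (hP : ¬ HasP33 H) (h3 : ∀ e ∈ H, e.card = 3) (x a b c d e f z : V)
    (hn : [x, a, b, c, d, e, f, z].Nodup) (h1 : {x, a, b} ∈ H) (h2 : {x, c, d} ∈ H)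
    (h4 : {x, e, f} ∈ H) :
    (H.filter (fun s => z ∈ s ∧ s ⊆ insert z [x, a, b, c, d, e, f].toFinset)).card ≤ 6 := by
  have := engine' (emb _ hn) hP {{0,1,2},{0,3,4},{0,5,6}} (by
      intro s hs
      simp only [Finset.mem_insert, Finset.mem_singleton] at hs
      rcases hs with rfl | rfl | rfl <;> simpa [emb]) pathsZ _ chkZ
    (H.filter (fun s => z ∈ s ∧ s ⊆ insert z [x, a, b, c, d, e, f].toFinset))
    (Finset.filter_subset _ _)
    (by
      intro s hs
      have h := Finset.mem_filter.mp hs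
      have := h3 _ h.1
      rw [Finset.card_map] at this
      refine Finset.mem_filter.mpr ⟨Finset.mem_powersetCard.mpr ⟨Finset.subset_univ _, this⟩, ?_⟩
      exact (Finset.mem_map' (emb _ hn) (a := (7 : Fin 8))).mp h.2.1)
    (by
      intro e he; rw [emb_range]
      refine (Finset.mem_filter.mp he).2.2.trans ?_
      intro v; simp; tauto)
  have hl : pathsZ.length = 15 := rfl
  have hc := cardZ
  have hc' : ((Finset.powersetCard 3 (Finset.univ : Finset (Fin [x, a, b, c, d, e, f, z].length))).filter
    (fun s => (7 : Fin 8) ∈ s)).card = 21 := hc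
  omega

lemma t_le (hP : ¬ HasP33 H) (h3 : ∀ e ∈ H, e.card = 3) (x a b c d e f z₁ z₂ z₃ : V)
    (hn : [x, a, b, c, d, e, f, z₁, z₂, z₃].Nodup) (h1 : {x, a, b} ∈ H) (h2 : {x, c, d} ∈ H)
    (h4 : {x, e, f} ∈ H) (h5 : {z₁, z₂, z₃} ∈ H) :
    (H.filter (fun s => (s ∩ {z₁, z₂, z₃}).card = 1 ∧
      s ⊆ [x, a, b, c, d, e, f, z₁, z₂, z₃].toFinset)).card ≤ 5 := by
  have := engine' (emb _ hn) hP {{0,1,2},{0,3,4},{0,5,6},{7,8,9}} (by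
      intro s hs
      simp only [Finset.mem_insert, Finset.mem_singleton] at hs
      rcases hs with rfl | rfl | rfl | rfl <;> simpa [emb]) pathsT UT chkT
    (H.filter (fun s => (s ∩ {z₁, z₂, z₃}).card = 1 ∧
      s ⊆ [x, a, b, c, d, e, f, z₁, z₂, z₃].toFinset))
    (Finset.filter_subset _ _)
    (by
      intro s hs
      have h := Finset.mem_filter.mp hs
      have := h3 _ h.1
      rw [Finset.card_map] at this
      refine Finset.mem_filter.mpr ⟨Finset.mem_powersetCard.mpr ⟨Finset.subset_univ _, this⟩, ?_⟩
      have hz : ({7, 8, 9} : Finset (Fin 10)).map (emb _ hn) = {z₁, z₂, z₃} := by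
        simp [emb]
      have := h.2.1
      rw [← hz, ← Finset.map_inter, Finset.card_map] at this
      exact this)
    (by
      intro e he; rw [emb_range]
      exact (Finset.mem_filter.mp he).2.2)
  have hl : pathsT.length = 58 := rfl
  have hc := cardT
  omega
end

section
variable {V : Type*} [DecidableEq V] {H : Finset (Finset V)}

lemma choose_two_succ (m : ℕ) : (m + 1).choose 2 = m.choose 2 + m := by
  rw [Nat.choose_succ_succ' m 1, Nat.choose_one_right, add_comm]

lemma caseI_cover (hP : ¬ HasP33 H) (h3 : ∀ e ∈ H, e.card = 3) (S : Finset V)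
    (hHS : ∀ e ∈ H, e ⊆ S) (x a b c d e f : V)
    (hn : [x, a, b, c, d, e, f].Nodup) (h1 : {x, a, b} ∈ H) (h2 : {x, c, d} ∈ H)
    (h4 : {x, e, f} ∈ H) (s : Finset V) (hs : s ∈ H) :
    s ⊆ [x, a, b, c, d, e, f].toFinset ∨
    s ⊆ insert x (S \ [x, a, b, c, d, e, f].toFinset) ∨
    ∃ z ∈ S \ [x, a, b, c, d, e, f].toFinset,
      z ∈ s ∧ s ⊆ insert z [x, a, b, c, d, e, f].toFinset := by
  have hsS := hHS s hs
  simp only [List.nodup_cons, List.mem_cons, List.not_mem_nil, or_false, not_or] at hn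
  rcases split3 (h3 s hs) (S \ [x, a, b, c, d, e, f].toFinset) with h | h | h | h
  · right; left; exact h.trans (Finset.subset_insert _ _)
  · obtain ⟨p, q, r, rfl, hp, hq, hr, hpq, hpr, hqr⟩ := h
    have hpS : p ∈ S := hsS (by simp)
    simp only [Finset.mem_sdiff, List.mem_toFinset, List.mem_cons, List.not_mem_nil, or_false,
      not_or, not_and, not_not] at hp hq hr
    have hp' : p = x ∨ p = a ∨ p = b ∨ p = c ∨ p = d ∨ p = e ∨ p = f := by
      have := hp hpS; tauto
    clear hp
    rcases hp' with rfl | rfl | rfl | rfl | rfl | rfl | rfl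
    · right; left
      intro v hv
      simp only [Finset.mem_insert, Finset.mem_singleton] at hv
      rcases hv with rfl | rfl | rfl
      · simp
      · simp; tauto
      · simp; tauto
    · exact (noP hP h2 h1 hs c d x b p q r (by simp; grind)).elim
    · exact (noP hP h2 h1 hs c d x a p q r (by simp; grind)).elim
    · exact (noP hP h1 h2 hs a b x d p q r (by simp; grind)).elim
    · exact (noP hP h1 h2 hs a b x c p q r (by simp; grind)).elim
    · exact (noP hP h1 h4 hs a b x f p q r (by simp; grind)).elim
    · exact (noP hP h1 h4 hs a b x e p q r (by simp; grind)).elim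
  · obtain ⟨p, q, r, rfl, hp, hq, hr, hpq, hpr, hqr⟩ := h
    right; right
    refine ⟨r, hr, by simp, ?_⟩
    have hpS : p ∈ S := hsS (by simp)
    have hqS : q ∈ S := hsS (by simp)
    rw [Finset.mem_sdiff] at hp hq
    intro v hv
    simp only [Finset.mem_insert, Finset.mem_singleton] at hv ⊢
    rcases hv with rfl | rfl | rfl
    · right; by_contra hc; exact hp ⟨hpS, hc⟩
    · right; by_contra hc; exact hq ⟨hqS, hc⟩
    · left; rfl
  · left
    intro v hv
    by_contra hc
    exact h v hv (Finset.mem_sdiff.mpr ⟨hsS hv, hc⟩)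

lemma toF (x a b c d e f z₁ z₂ z₃ : V) : [x, a, b, c, d, e, f, z₁, z₂, z₃].toFinset =
      [x, a, b, c, d, e, f].toFinset ∪ {z₁, z₂, z₃} := by
  ext v
  simp only [List.mem_toFinset, List.mem_cons, List.not_mem_nil, or_false, Finset.mem_union,
    Finset.mem_insert, Finset.mem_singleton, or_assoc]

lemma caseI (hP : ¬ HasP33 H) (h3 : ∀ e ∈ H, e.card = 3) (S : Finset V)
    (hHS : ∀ e ∈ H, e ⊆ S) (hS : 8 ≤ S.card)
    (IH : ∀ S' : Finset V, S'.card < S.card → (H.filter (fun e => e ⊆ S')).card ≤ Bd S'.card)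
    (x a b c d e f : V)
    (hn : [x, a, b, c, d, e, f].Nodup) (h1 : {x, a, b} ∈ H) (h2 : {x, c, d} ∈ H)
    (h4 : {x, e, f} ∈ H) : H.card ≤ (S.card - 1).choose 2 := by
  have hcov := caseI_cover hP h3 S hHS x a b c d e f hn h1 h2 h4
  have hcore := core_le hP h3 x a b c d e f hn h1 h2 h4
  have hzle : ∀ z ∈ S \ [x, a, b, c, d, e, f].toFinset,
      (H.filter (fun s => z ∈ s ∧ s ⊆ insert z [x, a, b, c, d, e, f].toFinset)).card ≤ 6 := by
    intro z hz
    refine z_le hP h3 x a b c d e f z ?_ h1 h2 h4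
    simp only [List.nodup_cons, List.mem_cons, List.not_mem_nil, or_false, not_or,
      Finset.mem_sdiff, List.mem_toFinset] at hn hz ⊢
    grind
  have htle : ∀ z₁ z₂ z₃, z₁ ∈ S \ [x, a, b, c, d, e, f].toFinset →
      z₂ ∈ S \ [x, a, b, c, d, e, f].toFinset → z₃ ∈ S \ [x, a, b, c, d, e, f].toFinset →
      z₁ ≠ z₂ → z₁ ≠ z₃ → z₂ ≠ z₃ → {z₁, z₂, z₃} ∈ H →
      (H.filter (fun s => (s ∩ {z₁, z₂, z₃}).card = 1 ∧
      s ⊆ [x, a, b, c, d, e, f, z₁, z₂, z₃].toFinset)).card ≤ 5 := by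
    intro z₁ z₂ z₃ hz1 hz2 hz3 h12 h13 h23 hz
    refine t_le hP h3 x a b c d e f z₁ z₂ z₃ ?_ h1 h2 h4 hz
    simp only [List.nodup_cons, List.mem_cons, List.not_mem_nil, or_false, not_or,
      Finset.mem_sdiff, List.mem_toFinset] at hn hz1 hz2 hz3 ⊢
    grind
  have hCc : [x, a, b, c, d, e, f].toFinset.card = 7 := by
    rw [List.toFinset_card_of_nodup hn]; rfl
  have hxC : x ∈ [x, a, b, c, d, e, f].toFinset := by simp
  have hCS : [x, a, b, c, d, e, f].toFinset ⊆ S := by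
    have e1 := hHS _ h1
    have e2 := hHS _ h2
    have e3 := hHS _ h4
    intro v hv
    simp only [List.mem_toFinset, List.mem_cons, List.not_mem_nil, or_false] at hv
    rcases hv with rfl | rfl | rfl | rfl | rfl | rfl | rfl
    · exact e1 (by simp)
    · exact e1 (by simp)
    · exact e1 (by simp)
    · exact e2 (by simp)
    · exact e2 (by simp)
    · exact e3 (by simp)
    · exact e3 (by simp)
  have htf : ∀ z₁ z₂ z₃, [x, a, b, c, d, e, f, z₁, z₂, z₃].toFinset =
      [x, a, b, c, d, e, f].toFinset ∪ {z₁, z₂, z₃} := by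
    exact fun _ _ _ => toF _ _ _ _ _ _ _ _ _ _
  simp only [htf] at htle
  generalize [x, a, b, c, d, e, f].toFinset = C at *
  set Z := S \ C with hZ
  have hm : Z.card + 7 = S.card := by
    have := Finset.card_sdiff_add_card_eq_card hCS
    rw [← hZ] at this
    omega
  have hxZ : x ∉ Z := by simp [hZ, hxC]
  have hins : (insert x Z).card = Z.card + 1 := Finset.card_insert_of_notMem hxZ
  have hI := IH (insert x Z) (by omega)
  rw [hins] at hI
  have hgoal : (S.card - 1).choose 2 = Z.card.choose 2 + 6 * Z.card + 15 := by
    have : S.card - 1 = Z.card + 6 := by omega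
    rw [this]
    simp only [choose_two_succ, show Z.card + 6 = Z.card + 1 + 1 + 1 + 1 + 1 + 1 from rfl]
    ring
  have hgen : H.card ≤ 15 + Z.card * 6 + (H.filter (fun e => e ⊆ insert x Z)).card := by
    have hsub : H ⊆ H.filter (fun s => s ⊆ C) ∪
        Z.biUnion (fun z => H.filter (fun s => z ∈ s ∧ s ⊆ insert z C)) ∪
        H.filter (fun e => e ⊆ insert x Z) := by
      intro s hs
      simp only [Finset.mem_union, Finset.mem_filter, Finset.mem_biUnion]
      rcases hcov s hs with h | h | ⟨z, hz, h⟩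
      · exact Or.inl (Or.inl ⟨hs, h⟩)
      · exact Or.inr ⟨hs, h⟩
      · exact Or.inl (Or.inr ⟨z, hz, hs, h⟩)
    have hb := Finset.card_biUnion_le_card_mul Z
      (fun z => H.filter (fun s => z ∈ s ∧ s ⊆ insert z C)) 6 hzle
    have hle := Finset.card_le_card hsub
    have hu1 := Finset.card_union_le (H.filter (fun s => s ⊆ C) ∪
        Z.biUnion (fun z => H.filter (fun s => z ∈ s ∧ s ⊆ insert z C)))
        (H.filter (fun e => e ⊆ insert x Z))
    have hu2 := Finset.card_union_le (H.filter (fun s => s ⊆ C))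
        (Z.biUnion (fun z => H.filter (fun s => z ∈ s ∧ s ⊆ insert z C)))
    omega
  rw [hgoal]
  by_cases hm7 : 7 ≤ Z.card
  · have : Bd (Z.card + 1) = Z.card.choose 2 := by
      unfold Bd
      rw [if_neg (by omega), if_neg (by omega)]
      rfl
    omega
  by_cases hex : ∃ s ∈ H, s ⊆ Z
  · obtain ⟨s, hs, hsZ⟩ := hex
    obtain ⟨z₁, z₂, z₃, h12, h13, h23, rfl⟩ := Finset.card_eq_three.mp (h3 s hs)
    have hz1 : z₁ ∈ Z := hsZ (by simp)
    have hz2 : z₂ ∈ Z := hsZ (by simp)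
    have hz3 : z₃ ∈ Z := hsZ (by simp)
    have ht := htle z₁ z₂ z₃ hz1 hz2 hz3 h12 h13 h23 hs
    have hZ3 : 3 ≤ Z.card := by
      rw [← h3 _ hs]; exact Finset.card_le_card hsZ
    have hsub : H ⊆ H.filter (fun s => s ⊆ C) ∪
        (Z \ {z₁, z₂, z₃}).biUnion (fun z => H.filter (fun s => z ∈ s ∧ s ⊆ insert z C)) ∪
        H.filter (fun e => e ⊆ insert x Z) ∪
        H.filter (fun s => (s ∩ {z₁, z₂, z₃}).card = 1 ∧ s ⊆ C ∪ {z₁, z₂, z₃}) := by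
      intro s hs
      simp only [Finset.mem_union, Finset.mem_filter, Finset.mem_biUnion]
      rcases hcov s hs with h | h | ⟨z, hz, hzs, hzC⟩
      · exact Or.inl (Or.inl (Or.inl ⟨hs, h⟩))
      · exact Or.inl (Or.inr ⟨hs, h⟩)
      · by_cases hzt : z ∈ ({z₁, z₂, z₃} : Finset V)
        · right
          refine ⟨hs, ?_, ?_⟩
          · rw [Finset.card_eq_one]
            refine ⟨z, ?_⟩
            ext v
            simp only [Finset.mem_inter, Finset.mem_singleton]
            constructor
            · rintro ⟨hv1, hv2⟩
              rcases Finset.mem_insert.mp (hzC hv1) with h | h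
              · exact h
              · exact absurd h (Finset.mem_sdiff.mp (hsZ hv2)).2
            · rintro rfl; exact ⟨hzs, hzt⟩
          · intro v hv
            rcases Finset.mem_insert.mp (hzC hv) with h | h
            · subst h; exact Finset.mem_union_right _ hzt
            · exact Finset.mem_union_left _ h
        · exact Or.inl (Or.inl (Or.inr ⟨z, Finset.mem_sdiff.mpr ⟨hz, hzt⟩, hs, hzs, hzC⟩))
    have hb := Finset.card_biUnion_le_card_mul (Z \ {z₁, z₂, z₃})
      (fun z => H.filter (fun s => z ∈ s ∧ s ⊆ insert z C)) 6
      (fun z hz => hzle z (Finset.mem_sdiff.mp hz).1)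
    have hd := Finset.card_sdiff_add_card_eq_card hsZ
    rw [h3 _ hs] at hd
    have hle := Finset.card_le_card hsub
    have hu0 := Finset.card_union_le (H.filter (fun s => s ⊆ C) ∪
        (Z \ {z₁, z₂, z₃}).biUnion (fun z => H.filter (fun s => z ∈ s ∧ s ⊆ insert z C)) ∪
        H.filter (fun e => e ⊆ insert x Z))
        (H.filter (fun s => (s ∩ {z₁, z₂, z₃}).card = 1 ∧ s ⊆ C ∪ {z₁, z₂, z₃}))
    have hu1 := Finset.card_union_le (H.filter (fun s => s ⊆ C) ∪
        (Z \ {z₁, z₂, z₃}).biUnion (fun z => H.filter (fun s => z ∈ s ∧ s ⊆ insert z C)))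
        (H.filter (fun e => e ⊆ insert x Z))
    have hu2 := Finset.card_union_le (H.filter (fun s => s ⊆ C))
        ((Z \ {z₁, z₂, z₃}).biUnion (fun z => H.filter (fun s => z ∈ s ∧ s ⊆ insert z C)))
    have hnum : ∀ m, 3 ≤ m → m < 7 → 6 * m + 2 + Bd (m + 1) ≤ m.choose 2 + 6 * m + 15 := by
      decide +revert
    have := hnum _ hZ3 (by omega)
    omega
  · push Not at hex
    have hsub : H.filter (fun e => e ⊆ insert x Z) ⊆
        (Finset.powersetCard 2 Z).image (fun t => insert x t) := by
      intro s hs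
      obtain ⟨hsH, hsx⟩ := Finset.mem_filter.mp hs
      have hxs : x ∈ s := by
        by_contra hc
        exact hex s hsH ((Finset.subset_insert_iff_of_notMem hc).mp hsx)
      refine Finset.mem_image.mpr ⟨s.erase x, ?_, Finset.insert_erase hxs⟩
      rw [Finset.mem_powersetCard, Finset.card_erase_of_mem hxs, h3 s hsH]
      exact ⟨Finset.subset_insert_iff.mp hsx, rfl⟩
    have := (Finset.card_le_card hsub).trans Finset.card_image_le
    rw [Finset.card_powersetCard] at this
    omega

/-- two sets of vertices any two members of which coincide -/
lemma conflict {N M : Finset V} (h : ∀ w ∈ N, ∀ w' ∈ M, w = w') :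
    N.card = 0 ∨ M.card = 0 ∨ (N.card = 1 ∧ M.card = 1) := by
  rcases N.eq_empty_or_nonempty with rfl | ⟨u, hu⟩
  · simp
  rcases M.eq_empty_or_nonempty with rfl | ⟨v, hv⟩
  · simp
  right; right
  constructor
  · rw [Finset.card_eq_one]; refine ⟨v, ?_⟩
    ext w; simp only [Finset.mem_singleton]
    exact ⟨fun hw => h w hw v hv, fun hw => by rw [hw, ← h u hu v hv]; exact hu⟩
  · rw [Finset.card_eq_one]; refine ⟨u, ?_⟩
    ext w; simp only [Finset.mem_singleton]
    exact ⟨fun hw => (h u hu w hw).symm, fun hw => by rw [hw, h u hu v hv]; exact hv⟩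

/-- vertices of `W` forming an edge with `p` and `q` -/
def Nb (H : Finset (Finset V)) (W : Finset V) (p q : V) : Finset V :=
  W.filter (fun w => ({p, q, w} : Finset V) ∈ H)

lemma mem_Nb {W : Finset V} {p q w : V} : w ∈ Nb H W p q ↔ w ∈ W ∧ {p, q, w} ∈ H := by
  simp [Nb]

lemma Nb_comm (W : Finset V) (p q : V) : Nb H W p q = Nb H W q p := by
  ext w; rw [mem_Nb, mem_Nb, Finset.insert_comm]

lemma Nb_le (W : Finset V) (p q : V) : (Nb H W p q).card ≤ W.card := Finset.card_filter_le _ _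

lemma caseIII (h3 : ∀ e ∈ H, e.card = 3) (S : Finset V)
    (hHS : ∀ e ∈ H, e ⊆ S) (hS : 8 ≤ S.card)
    (IH : ∀ S' : Finset V, S'.card < S.card → (H.filter (fun e => e ⊆ S')).card ≤ Bd S'.card)
    (hno : ∀ x a b c d, [x, a, b, c, d].Nodup → {x, a, b} ∈ H → {x, c, d} ∈ H → False) :
    H.card ≤ (S.card - 1).choose 2 := by
  rcases H.eq_empty_or_nonempty with rfl | ⟨s, hs⟩
  · simp
  obtain ⟨a, b, c, hab, hac, hbc, rfl⟩ := Finset.card_eq_three.mp (h3 s hs)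
  have hW := Finset.card_sdiff_add_card_eq_card (hHS _ hs)
  rw [h3 _ hs] at hW
  set W := S \ {a, b, c} with hWd
  have hmW : ∀ w ∈ W, w ≠ a ∧ w ≠ b ∧ w ≠ c := by
    intro w hw
    simp only [hWd, Finset.mem_sdiff, Finset.mem_insert, Finset.mem_singleton, not_or] at hw
    exact hw.2
  have key : ∀ p q r, p ≠ q → p ≠ r → q ≠ r → (∀ w ∈ W, w ≠ p ∧ w ≠ q ∧ w ≠ r) →
      ∀ w ∈ Nb H W p q, ∀ w' ∈ Nb H W p r, w = w' := by
    intro p q r hpq hpr hqr hw w hw1 w' hw2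
    rw [mem_Nb] at hw1 hw2
    by_contra hne
    have := hw w hw1.1
    have := hw w' hw2.1
    exact hno p q w r w' (by simp; grind) hw1.2 hw2.2
  have hsub : H ⊆ {{a, b, c}} ∪ (Nb H W a b).image (fun w => {a, b, w}) ∪
      (Nb H W a c).image (fun w => {a, c, w}) ∪ (Nb H W b c).image (fun w => {b, c, w}) ∪
      H.filter (fun e => e ⊆ W) := by
    intro e he
    have heS := hHS e he
    have hcore : ∀ v ∈ e, v ∉ W → v = a ∨ v = b ∨ v = c := by
      intro v hv hvW
      have := heS hv
      simp only [hWd, Finset.mem_sdiff, Finset.mem_insert, Finset.mem_singleton] at hvW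
      tauto
    simp only [Finset.mem_union, Finset.mem_filter, Finset.mem_image, Finset.mem_singleton]
    rcases split3 (h3 e he) W with h | h | h | h
    · exact Or.inr ⟨he, h⟩
    · exfalso
      obtain ⟨p, q, r, rfl, hp, hq, hr, hpq, hpr, hqr⟩ := h
      have hq' := hmW q hq
      have hr' := hmW r hr
      rcases hcore p (by simp) hp with rfl | rfl | rfl
      · exact hno p b c q r (by simp; grind) hs he
      · exact hno p a c q r (by simp; grind) (by rwa [Finset.insert_comm]) he
      · refine hno p a b q r (by simp; grind) ?_ he
        rwa [← tri4]
    · left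
      obtain ⟨p, q, r, rfl, hp, hq, hr, hpq, hpr, hqr⟩ := h
      have he' : {q, p, r} ∈ H := by rwa [Finset.insert_comm]
      have hsw : ({p, q, r} : Finset V) = {q, p, r} := by rw [Finset.insert_comm]
      rcases hcore p (by simp) hp with rfl | rfl | rfl <;>
        rcases hcore q (by simp) hq with rfl | rfl | rfl
      · exact absurd rfl hpq
      · exact Or.inl (Or.inl (Or.inr ⟨r, mem_Nb.mpr ⟨hr, he⟩, rfl⟩))
      · exact Or.inl (Or.inr ⟨r, mem_Nb.mpr ⟨hr, he⟩, rfl⟩)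
      · exact Or.inl (Or.inl (Or.inr ⟨r, mem_Nb.mpr ⟨hr, he'⟩, hsw.symm⟩))
      · exact absurd rfl hpq
      · exact Or.inr ⟨r, mem_Nb.mpr ⟨hr, he⟩, rfl⟩
      · exact Or.inl (Or.inr ⟨r, mem_Nb.mpr ⟨hr, he'⟩, hsw.symm⟩)
      · exact Or.inr ⟨r, mem_Nb.mpr ⟨hr, he'⟩, hsw.symm⟩
      · exact absurd rfl hpq
    · left; left; left; left
      apply Finset.eq_of_subset_of_card_le
      · intro v hv
        have := hcore v hv (h v hv)
        simpa using this
      · rw [h3 e he, h3 _ hs]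
  have k1 := conflict (key a b c hab hac hbc hmW)
  have k2 := conflict (key b a c hab.symm hbc hac (fun w hw => by have := hmW w hw; tauto))
  have k3 := conflict (key c a b hac.symm hbc.symm hab (fun w hw => by have := hmW w hw; tauto))
  rw [Nb_comm W b a] at k2
  rw [Nb_comm W c a, Nb_comm W c b] at k3
  have l1 := Nb_le (H := H) W a b
  have l2 := Nb_le (H := H) W a c
  have l3 := Nb_le (H := H) W b c
  have hsum : (Nb H W a b).card + (Nb H W a c).card + (Nb H W b c).card ≤ W.card := by omega
  have hI := IH W (by omega)
  have hle := Finset.card_le_card hsub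
  have u1 := Finset.card_union_le (({{a, b, c}} : Finset (Finset V)) ∪ (Nb H W a b).image (fun w => {a, b, w}) ∪
      (Nb H W a c).image (fun w => {a, c, w}) ∪ (Nb H W b c).image (fun w => {b, c, w}))
      (H.filter (fun e => e ⊆ W))
  have u2 := Finset.card_union_le (({{a, b, c}} : Finset (Finset V)) ∪ (Nb H W a b).image (fun w => {a, b, w}) ∪
      (Nb H W a c).image (fun w => {a, c, w})) ((Nb H W b c).image (fun w => {b, c, w}))
  have u3 := Finset.card_union_le (({{a, b, c}} : Finset (Finset V)) ∪ (Nb H W a b).image (fun w => {a, b, w}))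
      ((Nb H W a c).image (fun w => {a, c, w}))
  have u4 := Finset.card_union_le ({{a, b, c}} : Finset (Finset V)) ((Nb H W a b).image (fun w => {a, b, w}))
  have i1 := Finset.card_image_le (s := Nb H W a b) (f := fun w => ({a, b, w} : Finset V))
  have i2 := Finset.card_image_le (s := Nb H W a c) (f := fun w => ({a, c, w} : Finset V))
  have i3 := Finset.card_image_le (s := Nb H W b c) (f := fun w => ({b, c, w} : Finset V))
  rw [Finset.card_singleton] at u4
  have hnum : 1 + W.card + Bd W.card ≤ (S.card - 1).choose 2 := by
    have : S.card - 1 = W.card + 2 := by omega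
    rw [this]
    by_cases hm : W.card < 8
    · have : ∀ m, 5 ≤ m → m < 8 → 1 + m + Bd m ≤ (m + 2).choose 2 := by decide +revert
      exact this _ (by omega) hm
    · have hB : Bd W.card = (W.card - 1).choose 2 := by
        unfold Bd
        rw [if_neg (by omega), if_neg (by omega)]
      obtain ⟨k, hk⟩ : ∃ k, W.card = k + 1 := ⟨W.card - 1, by omega⟩
      rw [hB, hk]
      simp only [Nat.add_sub_cancel, choose_two_succ, show k + 1 + 2 = k + 1 + 1 + 1 from rfl]
      omega
  omega
end

section
variable {V : Type*} [DecidableEq V] {H : Finset (Finset V)}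

lemma card_union4 {α : Type*} [DecidableEq α] (A B C D : Finset α) :
    (A ∪ B ∪ C ∪ D).card ≤ A.card + B.card + C.card + D.card := by
  have h1 := Finset.card_union_le (A ∪ B ∪ C) D
  have h2 := Finset.card_union_le (A ∪ B) C
  have h3 := Finset.card_union_le A B
  omega

/-- edges formed by `p`, `q` and a vertex of `W` -/
def Im (H : Finset (Finset V)) (W : Finset V) (p q : V) : Finset (Finset V) :=
  (Nb H W p q).image (fun w => {p, q, w})

lemma Im_card (W : Finset V) (p q : V) : (Im H W p q).card ≤ (Nb H W p q).card :=
  Finset.card_image_le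

lemma mem_Im {W : Finset V} {p q w : V} (hw : w ∈ W) (h : {p, q, w} ∈ H) :
    {p, q, w} ∈ Im H W p q :=
  Finset.mem_image.mpr ⟨w, mem_Nb.mpr ⟨hw, h⟩, rfl⟩

lemma mem_Im' {W : Finset V} {p q w : V} (hw : w ∈ W) (h : {p, q, w} ∈ H) :
    {p, q, w} ∈ Im H W q p := by
  rw [tri2] at h ⊢; exact mem_Im hw h

/-- the setting: two edges meeting in `x`, rest `W`, no three edges through a vertex -/
structure Cfg (H : Finset (Finset V)) (W : Finset V) (x a b c d : V) : Prop where
  nd : x ≠ a ∧ x ≠ b ∧ x ≠ c ∧ x ≠ d ∧ a ≠ b ∧ a ≠ c ∧ a ≠ d ∧ b ≠ c ∧ b ≠ d ∧ c ≠ d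
  hW : ∀ w ∈ W, w ≠ x ∧ w ≠ a ∧ w ≠ b ∧ w ≠ c ∧ w ≠ d
  h1 : {x, a, b} ∈ H
  h2 : {x, c, d} ∈ H
  hP : ¬ HasP33 H
  hno : ∀ x a b c d e f, [x, a, b, c, d, e, f].Nodup → {x, a, b} ∈ H → {x, c, d} ∈ H →
    {x, e, f} ∈ H → False

namespace Cfg
variable {W : Finset V} {x a b c d : V}

lemma swap1 (h : Cfg H W x a b c d) : Cfg H W x b a c d :=
  ⟨by have := h.nd; grind, fun w hw => by have := h.hW w hw; tauto, by rw [tri1]; exact h.h1, h.h2,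
    h.hP, h.hno⟩

lemma swap2 (h : Cfg H W x a b c d) : Cfg H W x c d a b :=
  ⟨by have := h.nd; grind, fun w hw => by have := h.hW w hw; tauto, h.h2, h.h1, h.hP, h.hno⟩

lemma swap3 (h : Cfg H W x a b c d) : Cfg H W x a b d c := h.swap2.swap1.swap2

lemma YY (h : Cfg H W x a b c d) : ∀ w ∈ Nb H W x a, ∀ w' ∈ Nb H W x b, w = w' := by
  intro w hw w' hw'
  rw [mem_Nb] at hw hw'
  by_contra hne
  have h1 := h.nd
  have h2 := h.hW w hw.1
  have h3 := h.hW w' hw'.1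
  exact h.hno x a w b w' c d (by simp; grind) hw.2 hw'.2 h.h2

lemma YI (h : Cfg H W x a b c d) : ∀ w ∈ Nb H W x a, ∀ w' ∈ Nb H W a b, w = w' := by
  intro w hw w' hw'
  rw [mem_Nb] at hw hw'
  by_contra hne
  have h1 := h.nd
  have h2 := h.hW w hw.1
  have h3 := h.hW w' hw'.1
  exact noP h.hP h.h2 hw.2 hw'.2 d c x w a b w' (by simp; grind)

lemma XI (h : Cfg H W x a b c d) : ∀ w ∈ Nb H W a c, ∀ w' ∈ Nb H W a b, w = w' := by
  intro w hw w' hw'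
  rw [mem_Nb] at hw hw'
  by_contra hne
  have h1 := h.nd
  have h2 := h.hW w hw.1
  have h3 := h.hW w' hw'.1
  exact noP h.hP hw'.2 hw.2 h.h2 w' b a w c d x (by simp; grind)

lemma XX (h : Cfg H W x a b c d) : ∀ w ∈ Nb H W a c, ∀ w' ∈ Nb H W b d, w = w' := by
  intro w hw w' hw'
  rw [mem_Nb] at hw hw'
  by_contra hne
  have h1 := h.nd
  have h2 := h.hW w hw.1
  have h3 := h.hW w' hw'.1
  exact noP h.hP hw.2 h.h1 hw'.2 w c a x b d w' (by simp; grind)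

lemma YX (h : Cfg H W x a b c d) : ∀ w ∈ Nb H W x a, ∀ w' ∈ Nb H W b c, w = w' := by
  intro w hw w' hw'
  rw [mem_Nb] at hw hw'
  by_contra hne
  have h1 := h.nd
  have h2 := h.hW w hw.1
  have h3 := h.hW w' hw'.1
  exact noP h.hP hw.2 h.h2 hw'.2 a w x d c b w' (by simp; grind)

lemma side (h : Cfg H W x a b c d) (hm : 3 ≤ W.card) :
    (Nb H W x a).card + (Nb H W x b).card + (Nb H W a b).card ≤ W.card := by
  have k1 := conflict h.YY
  have k2 := conflict h.YI
  have k3 := conflict h.swap1.YI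
  rw [Nb_comm W b a] at k3
  have l1 := Nb_le (H := H) W x a
  have l2 := Nb_le (H := H) W x b
  have l3 := Nb_le (H := H) W a b
  omega

/-- the number of edges with exactly one vertex in `W` (upper bound) -/
def tot (H : Finset (Finset V)) (W : Finset V) (x a b c d : V) : ℕ :=
  ((Nb H W x a).card + (Nb H W x b).card + (Nb H W a b).card) +
  ((Nb H W x c).card + (Nb H W x d).card + (Nb H W c d).card) +
  ((Nb H W a c).card + (Nb H W a d).card + (Nb H W b c).card + (Nb H W b d).card)

lemma tot_swap1 : tot H W x b a c d = tot H W x a b c d := by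
  unfold tot; rw [Nb_comm W b a]; omega

lemma tot_swap3 : tot H W x a b d c = tot H W x a b c d := by
  unfold tot; rw [Nb_comm W d c]; omega

lemma cross_ac (h : Cfg H W x a b c d) (hm : 3 ≤ W.card) (h2 : 2 ≤ (Nb H W a c).card) :
    tot H W x a b c d ≤ 3 * W.card := by
  have k1 := conflict h.XI
  have k2 := conflict h.swap2.XI
  have k3 := conflict h.XX
  have k4 := conflict h.YX
  have k5 := conflict h.swap2.YX
  have k6 := conflict h.swap1.YX
  have k7 := conflict h.swap2.swap1.YX
  rw [Nb_comm W c a] at k2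
  rw [Nb_comm W d a] at k5
  rw [Nb_comm W c a] at k7
  have l1 := Nb_le (H := H) W x a
  have l2 := Nb_le (H := H) W x c
  have l3 := Nb_le (H := H) W a c
  have l4 := Nb_le (H := H) W a d
  have l5 := Nb_le (H := H) W b c
  unfold tot
  have z1 : (Nb H W a b).card = 0 := by omega
  have z2 : (Nb H W c d).card = 0 := by omega
  have z3 : (Nb H W b d).card = 0 := by omega
  have z4 : (Nb H W x b).card = 0 := by omega
  have z5 : (Nb H W x d).card = 0 := by omega
  have s1 : (Nb H W x a).card + (Nb H W b c).card ≤ W.card := by omega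
  have s2 : (Nb H W x c).card + (Nb H W a d).card ≤ W.card := by omega
  omega

lemma tot_le (h : Cfg H W x a b c d) (hm : 3 ≤ W.card) :
    tot H W x a b c d ≤ 3 * W.card ∨ tot H W x a b c d ≤ 2 * W.card + 4 := by
  by_cases c1 : 2 ≤ (Nb H W a c).card
  · left; exact h.cross_ac hm c1
  by_cases c2 : 2 ≤ (Nb H W a d).card
  · left; rw [← tot_swap3]; exact h.swap3.cross_ac hm c2
  by_cases c3 : 2 ≤ (Nb H W b c).card
  · left; rw [← tot_swap1]; exact h.swap1.cross_ac hm c3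
  by_cases c4 : 2 ≤ (Nb H W b d).card
  · left; rw [← tot_swap1, ← tot_swap3]; exact h.swap1.swap3.cross_ac hm c4
  right
  have s1 := h.side hm
  have s2 := h.swap2.side hm
  unfold tot
  omega

/-- a crossing vertex lies in no edge inside `W` -/
lemma cross_inner (h : Cfg H W x a b c d) (h3 : ∀ e ∈ H, e.card = 3) {w : V}
    (hw : w ∈ Nb H W a c) : ∀ e ∈ H, e ⊆ W → e ⊆ W.erase w := by
  intro e he heW v hv
  refine Finset.mem_erase.mpr ⟨?_, heW hv⟩
  rintro rfl
  rw [mem_Nb] at hw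
  obtain ⟨p, q, hpq, hpqe⟩ := Finset.card_eq_two.mp
    (show (e.erase v).card = 2 by rw [Finset.card_erase_of_mem hv, h3 e he])
  have hee : e = {v, p, q} := by rw [← hpqe, Finset.insert_erase hv]
  have hp : p ∈ e.erase v := by rw [hpqe]; simp
  have hq : q ∈ e.erase v := by rw [hpqe]; simp
  rw [Finset.mem_erase] at hp hq
  have e1 := h.hW p (heW hp.2)
  have e2 := h.hW q (heW hq.2)
  have e3 := h.hW v hw.1
  have e4 := h.nd
  rw [hee] at he
  have n1 := hp.1
  have n2 := hq.1
  clear hp hq hpqe hee heW h3 hv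
  exact noP h.hP he hw.2 h.h1 p q v c a b x (by simp; grind)

lemma tri_core (h : Cfg H W x a b c d) {p q r : V} (he : {p, q, r} ∈ H) (hq : q ∈ W) (hr : r ∈ W)
    (hqr : q ≠ r) (hp : p = x ∨ p = a ∨ p = b ∨ p = c ∨ p = d) : False := by
  have e1 := h.hW q hq
  have e2 := h.hW r hr
  have e4 := h.nd
  have h1 := h.h1
  have h2 := h.h2
  have hP := h.hP
  have hno := h.hno
  clear h
  rcases hp with rfl | rfl | rfl | rfl | rfl
  · refine hno p a b c d q r (by clear hno; simp; grind) h1 h2 he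
  · exact noP hP h2 h1 he c d x b p q r (by clear hno; simp; grind)
  · exact noP hP h2 h1 he c d x a p q r (by clear hno; simp; grind)
  · exact noP hP h1 h2 he a b x d p q r (by clear hno; simp; grind)
  · exact noP hP h1 h2 he a b x c p q r (by clear hno; simp; grind)

end Cfg

lemma Bd_big (n : ℕ) (h : 8 ≤ n) : Bd n = (n - 1).choose 2 := by
  unfold Bd
  rw [if_neg (by omega), if_neg (by omega)]

lemma caseII (hP : ¬ HasP33 H) (h3 : ∀ e ∈ H, e.card = 3) (S : Finset V)
    (hHS : ∀ e ∈ H, e ⊆ S) (hS : 8 ≤ S.card)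
    (IH : ∀ S' : Finset V, S'.card < S.card → (H.filter (fun e => e ⊆ S')).card ≤ Bd S'.card)
    (hno : ∀ x a b c d e f, [x, a, b, c, d, e, f].Nodup → {x, a, b} ∈ H → {x, c, d} ∈ H →
      {x, e, f} ∈ H → False)
    (x a b c d : V) (hn : [x, a, b, c, d].Nodup) (h1 : {x, a, b} ∈ H) (h2 : {x, c, d} ∈ H) :
    H.card ≤ (S.card - 1).choose 2 := by
  have hcc : ({x, a, b, c, d} : Finset V).card = 5 := by
    have := List.toFinset_card_of_nodup hn
    simpa using this
  have hcS : ({x, a, b, c, d} : Finset V) ⊆ S := by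
    have e1 := hHS _ h1
    have e2 := hHS _ h2
    intro v hv
    simp only [Finset.mem_insert, Finset.mem_singleton] at hv
    rcases hv with rfl | rfl | rfl | rfl | rfl
    · exact e1 (by simp)
    · exact e1 (by simp)
    · exact e1 (by simp)
    · exact e2 (by simp)
    · exact e2 (by simp)
  have hWc := Finset.card_sdiff_add_card_eq_card hcS
  rw [hcc] at hWc
  have hcore : ∀ v ∈ S, v ∉ S \ {x, a, b, c, d} → v = x ∨ v = a ∨ v = b ∨ v = c ∨ v = d := by
    intro v hv hvW
    simp only [Finset.mem_sdiff, Finset.mem_insert, Finset.mem_singleton, not_and, not_not] at hvW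
    exact hvW hv
  have hcfg : Cfg H (S \ {x, a, b, c, d}) x a b c d := by
    refine ⟨?_, ?_, h1, h2, hP, hno⟩
    · simp only [List.nodup_cons, List.mem_cons, List.not_mem_nil, or_false, not_or] at hn
      tauto
    · intro w hw
      simp only [Finset.mem_sdiff, Finset.mem_insert, Finset.mem_singleton, not_or] at hw
      exact hw.2
  generalize S \ {x, a, b, c, d} = W at *
  have hsub : H ⊆ (Finset.powersetCard 3 {x, a, b, c, d} ∪ H.filter (fun e => e ⊆ W) ∪
      (Im H W x a ∪ Im H W x b ∪ Im H W a b ∪ ∅) ∪ (Im H W x c ∪ Im H W x d ∪ Im H W c d ∪ ∅)) ∪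
      (Im H W a c ∪ Im H W a d ∪ Im H W b c ∪ Im H W b d) := by
    intro e he
    have heS := hHS e he
    rcases split3 (h3 e he) W with h | h | h | h
    · simp only [Finset.mem_union, Finset.mem_filter]; tauto
    · exfalso
      obtain ⟨p, q, r, rfl, hp, hq, hr, hpq, hpr, hqr⟩ := h
      exact hcfg.tri_core he hq hr hqr (hcore p (heS (by simp)) hp)
    · obtain ⟨p, q, r, rfl, hp, hq, hr, hpq, hpr, hqr⟩ := h
      have m1 := mem_Im hr he
      have m2 := mem_Im' hr he
      have hp' := hcore p (heS (by simp)) hp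
      have hq' := hcore q (heS (by simp)) hq
      clear hcore hcfg hno IH hn
      simp only [Finset.mem_union]
      rcases hp' with rfl | rfl | rfl | rfl | rfl <;>
        rcases hq' with rfl | rfl | rfl | rfl | rfl <;>
        first
        | exact absurd rfl hpq
        | simp only [m1, m2, true_or, or_true]
    · have : e ∈ Finset.powersetCard 3 {x, a, b, c, d} := by
        rw [Finset.mem_powersetCard]
        refine ⟨?_, h3 e he⟩
        intro v hv
        have := hcore v (heS hv) (h v hv)
        simpa using this
      simp only [Finset.mem_union, this, true_or]
  have hle : H.card ≤ 10 + (H.filter (fun e => e ⊆ W)).card + Cfg.tot H W x a b c d := by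
    have u0 := Finset.card_le_card hsub
    have u1 := Finset.card_union_le (Finset.powersetCard 3 {x, a, b, c, d} ∪
      H.filter (fun e => e ⊆ W) ∪
      (Im H W x a ∪ Im H W x b ∪ Im H W a b ∪ ∅) ∪ (Im H W x c ∪ Im H W x d ∪ Im H W c d ∪ ∅))
      (Im H W a c ∪ Im H W a d ∪ Im H W b c ∪ Im H W b d)
    have u2 := card_union4 (Finset.powersetCard 3 {x, a, b, c, d}) (H.filter (fun e => e ⊆ W))
      (Im H W x a ∪ Im H W x b ∪ Im H W a b ∪ ∅) (Im H W x c ∪ Im H W x d ∪ Im H W c d ∪ ∅)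
    have u3 := card_union4 (Im H W x a) (Im H W x b) (Im H W a b) ∅
    have u4 := card_union4 (Im H W x c) (Im H W x d) (Im H W c d) ∅
    have u5 := card_union4 (Im H W a c) (Im H W a d) (Im H W b c) (Im H W b d)
    have u6 : (Finset.powersetCard 3 {x, a, b, c, d}).card = 10 := by
      rw [Finset.card_powersetCard, hcc]; rfl
    rw [Finset.card_empty] at u3 u4
    have i := Im_card (H := H) W
    have i1 := i x a
    have i2 := i x b
    have i3 := i a b
    have i4 := i x c
    have i5 := i x d
    have i6 := i c d
    have i7 := i a c
    have i8 := i a d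
    have i9 := i b c
    have i10 := i b d
    unfold Cfg.tot
    omega
  have hm3 : 3 ≤ W.card := by omega
  have hS1 : S.card - 1 = W.card + 4 := by omega
  rw [hS1]
  -- crossing or not
  have hcr : (∃ w ∈ W, ∀ e ∈ H, e ⊆ W → e ⊆ W.erase w) ∨
      Cfg.tot H W x a b c d ≤ 2 * W.card := by
    by_cases c1 : (Nb H W a c).Nonempty
    · obtain ⟨w, hw⟩ := c1
      exact Or.inl ⟨w, (mem_Nb.mp hw).1, hcfg.cross_inner h3 hw⟩
    by_cases c2 : (Nb H W a d).Nonempty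
    · obtain ⟨w, hw⟩ := c2
      exact Or.inl ⟨w, (mem_Nb.mp hw).1, hcfg.swap3.cross_inner h3 hw⟩
    by_cases c3 : (Nb H W b c).Nonempty
    · obtain ⟨w, hw⟩ := c3
      exact Or.inl ⟨w, (mem_Nb.mp hw).1, hcfg.swap1.cross_inner h3 hw⟩
    by_cases c4 : (Nb H W b d).Nonempty
    · obtain ⟨w, hw⟩ := c4
      exact Or.inl ⟨w, (mem_Nb.mp hw).1, hcfg.swap1.swap3.cross_inner h3 hw⟩
    right
    rw [Finset.not_nonempty_iff_eq_empty] at c1 c2 c3 c4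
    have s1 := hcfg.side hm3
    have s2 := hcfg.swap2.side hm3
    unfold Cfg.tot
    rw [c1, c2, c3, c4, Finset.card_empty]
    omega
  rcases hcr with ⟨w, hw, hin⟩ | hcr
  · have hsub' : H.filter (fun e => e ⊆ W) ⊆ H.filter (fun e => e ⊆ W.erase w) := by
      intro e he
      obtain ⟨he1, he2⟩ := Finset.mem_filter.mp he
      exact Finset.mem_filter.mpr ⟨he1, hin e he1 he2⟩
    have hcl := Finset.card_le_card hsub'
    have hec := Finset.card_erase_of_mem hw
    have hI := IH (W.erase w) (by omega)
    rw [hec] at hI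
    have ht := hcfg.tot_le hm3
    have hnum : 10 + Bd (W.card - 1) + 3 * W.card ≤ (W.card + 4).choose 2 ∧
        10 + Bd (W.card - 1) + (2 * W.card + 4) ≤ (W.card + 4).choose 2 := by
      by_cases hm : W.card < 9
      · have : ∀ m, 3 ≤ m → m < 9 → 10 + Bd (m - 1) + 3 * m ≤ (m + 4).choose 2 ∧
          10 + Bd (m - 1) + (2 * m + 4) ≤ (m + 4).choose 2 := by decide +revert
        exact this _ hm3 hm
      · rw [Bd_big _ (by omega)]
        obtain ⟨k, hk⟩ : ∃ k, W.card = k + 2 := ⟨W.card - 2, by omega⟩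
        rw [hk]
        have : k + 2 - 1 - 1 = k := by omega
        rw [this]
        simp only [choose_two_succ, show k + 2 + 4 = k + 1 + 1 + 1 + 1 + 1 + 1 from rfl]
        omega
    omega
  · have hI := IH W (by omega)
    have hnum : 10 + Bd W.card + 2 * W.card ≤ (W.card + 4).choose 2 := by
      by_cases hm : W.card < 8
      · have : ∀ m, 3 ≤ m → m < 8 → 10 + Bd m + 2 * m ≤ (m + 4).choose 2 := by decide +revert
        exact this _ hm3 hm
      · rw [Bd_big _ (by omega)]
        obtain ⟨k, hk⟩ : ∃ k, W.card = k + 1 := ⟨W.card - 1, by omega⟩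
        rw [hk]
        simp only [Nat.add_sub_cancel, choose_two_succ,
          show k + 1 + 4 = k + 1 + 1 + 1 + 1 + 1 from rfl]
        omega
    omega

lemma main_bound (n : ℕ) : ∀ (S : Finset V) (H : Finset (Finset V)), S.card = n →
    (∀ e ∈ H, e.card = 3) → (∀ e ∈ H, e ⊆ S) → ¬ HasP33 H → H.card ≤ Bd n := by
  induction n using Nat.strong_induction_on with
  | _ n ih =>
    intro S H hS h3 hHS hP
    by_cases h6 : n ≤ 6
    · have hsub : H ⊆ Finset.powersetCard 3 S := fun e he =>
        Finset.mem_powersetCard.mpr ⟨hHS e he, h3 e he⟩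
      have := Finset.card_le_card hsub
      rw [Finset.card_powersetCard, hS] at this
      unfold Bd
      rwa [if_pos h6]
    by_cases h7 : n = 7
    · subst h7
      have := seven_le hP h3 S hS hHS
      unfold Bd
      simpa using this
    have hS8 : 8 ≤ S.card := by omega
    rw [Bd_big n (by omega), ← hS]
    have IH : ∀ S' : Finset V, S'.card < S.card →
        (H.filter (fun e => e ⊆ S')).card ≤ Bd S'.card := by
      intro S' hS'
      refine ih S'.card (by omega) S' _ rfl (fun e he => h3 e (Finset.mem_filter.mp he).1)
        (fun e he => (Finset.mem_filter.mp he).2) ?_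
      rintro ⟨e₁, e₂, e₃, m1, m2, m3, r⟩
      exact hP ⟨e₁, e₂, e₃, (Finset.mem_filter.mp m1).1, (Finset.mem_filter.mp m2).1,
        (Finset.mem_filter.mp m3).1, r⟩
    by_cases hI : ∀ x a b c d e f, [x, a, b, c, d, e, f].Nodup → {x, a, b} ∈ H → {x, c, d} ∈ H →
      {x, e, f} ∈ H → False
    · by_cases hII : ∀ x a b c d, [x, a, b, c, d].Nodup → {x, a, b} ∈ H → {x, c, d} ∈ H → False
      · exact caseIII h3 S hHS hS8 IH hII
      · push Not at hII
        obtain ⟨x, a, b, c, d, hn, h1, h2, -⟩ := hII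
        exact caseII hP h3 S hHS hS8 IH hI x a b c d hn h1 h2
    · push Not at hI
      obtain ⟨x, a, b, c, d, e, f, hn, h1, h2, h4, -⟩ := hI
      exact caseI hP h3 S hHS hS8 IH x a b c d e f hn h1 h2 h4
end

theorem turan_P33_ge8 (n : ℕ) (hn : 8 ≤ n) :
    IsGreatest {m : ℕ | ∃ H : Finset (Finset (Fin n)),
      (∀ e ∈ H, e.card = 3) ∧ ¬ HasP33 H ∧ H.card = m} ((n - 1).choose 2) := by
  constructor
  · let v : Fin n := ⟨0, by omega⟩
    have hnot : ∀ t ∈ Finset.powersetCard 2 (Finset.univ.erase v), v ∉ t := by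
      intro t ht hv
      have := (Finset.mem_powersetCard.mp ht).1 hv
      simp at this
    refine ⟨(Finset.powersetCard 2 (Finset.univ.erase v)).image (fun t => insert v t), ?_, ?_, ?_⟩
    · intro e he
      obtain ⟨t, ht, rfl⟩ := Finset.mem_image.mp he
      rw [Finset.card_insert_of_notMem (hnot t ht), (Finset.mem_powersetCard.mp ht).2]
    · rintro ⟨e₁, e₂, e₃, m1, m2, m3, -, -, h⟩
      obtain ⟨t, ht, rfl⟩ := Finset.mem_image.mp m1
      obtain ⟨u, hu, rfl⟩ := Finset.mem_image.mp m3
      have : v ∈ insert v t ∩ insert v u := by simp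
      rw [h] at this
      simp at this
    · rw [Finset.card_image_of_injOn, Finset.card_powersetCard,
        Finset.card_erase_of_mem (Finset.mem_univ _), Finset.card_univ, Fintype.card_fin]
      intro t ht u hu h
      have h1 := hnot t ht
      have h2 := hnot u hu
      have : (insert v t).erase v = (insert v u).erase v := by
        simp only at h; rw [h]
      rwa [Finset.erase_insert h1, Finset.erase_insert h2] at this
  · rintro m ⟨H, h3, hP, rfl⟩
    have := main_bound n Finset.univ H (by simp) h3 (fun e _ => Finset.subset_univ e) hP
    rwa [Bd_big n hn] at this
end

section
/- For n ≥ 8, the unique (up to isomorphism) P³₃-free 3-uniform hypergraph on n vertices with exactly C(n-1,2) edges is the full star S³ₙ, consisting of all 3-element subsets containing a fixed vertex. -/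
namespace TuranP33
variable {V : Type*} [DecidableEq V]

/-- degree of a vertex -/
def dg (H : Finset (Finset V)) (a : V) : ℕ := (H.filter (fun e => a ∈ e)).card
/-- codegree of a pair -/
def cod (H : Finset (Finset V)) (a b : V) : ℕ := (H.filter (fun e => a ∈ e ∧ b ∈ e)).card
/-- edges meeting `{a,b,c}` exactly in `a` (when `a,b,c` are distinct) -/
def lk (H : Finset (Finset V)) (a b c : V) : Finset (Finset V) :=
  H.filter (fun e => a ∈ e ∧ b ∉ e ∧ c ∉ e)

/-- the consequence of having no linear path and no loose triangle -/
def PC (H : Finset (Finset V)) : Prop := ∀ a b c y z u w : V,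
  ({a, b, c} : Finset V) ∈ H → ({a, y, z} : Finset V) ∈ H → ({b, u, w} : Finset V) ∈ H →
  y ≠ b → y ≠ c → z ≠ b → z ≠ c → u ≠ a → u ≠ c → w ≠ a → w ≠ c →
  (u = y ∧ w = z) ∨ (u = z ∧ w = y)

/-- a loose triangle -/
def Tri (H : Finset (Finset V)) : Prop := ∃ x1 x2 x3 y1 y2 y3 : V,
  [x1, x2, x3, y1, y2, y3].Nodup ∧ ({x1, x2, y3} : Finset V) ∈ H ∧
  ({x2, x3, y1} : Finset V) ∈ H ∧ ({x3, x1, y2} : Finset V) ∈ H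

lemma card3_ne {a b c : V} (h : ({a, b, c} : Finset V).card = 3) : a ≠ b ∧ a ≠ c ∧ b ≠ c := by
  refine ⟨?_, ?_, ?_⟩ <;> rintro rfl
  · have := Finset.card_le_two (a := a) (b := c); simp at h; omega
  · have := Finset.card_le_two (a := a) (b := b)
    rw [show ({a, b, a} : Finset V) = {a, b} by ext; simp; tauto] at h; omega
  · have := Finset.card_le_two (a := a) (b := b); simp at h; omega

lemma two_mem {e : Finset V} (he : e.card = 3) {a : V} (ha : a ∈ e) :
    ∃ y z, e = {a, y, z} := by
  have h2 : (e.erase a).card = 2 := by rw [Finset.card_erase_of_mem ha, he]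
  obtain ⟨y, z, _, hyz⟩ := Finset.card_eq_two.1 h2
  exact ⟨y, z, by rw [← hyz, Finset.insert_erase ha]⟩

lemma one_mem {e : Finset V} (he : e.card = 3) {a b : V} (ha : a ∈ e) (hb : b ∈ e) (hab : a ≠ b) :
    ∃ y, e = {a, b, y} := by
  obtain ⟨y, z, rfl⟩ := two_mem he ha
  have : b = y ∨ b = z := by simp at hb; tauto
  rcases this with rfl | rfl
  · exact ⟨z, rfl⟩
  · exact ⟨y, by ext; simp; tauto⟩

lemma noP {H : Finset (Finset V)} (hP : ¬ HasP33 H) (u w a z b s t : V)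
    (h1 : ({u, w, a} : Finset V) ∈ H) (h2 : ({a, z, b} : Finset V) ∈ H)
    (h4 : ({b, s, t} : Finset V) ∈ H) (hd : [u, w, a, z, b, s, t].Nodup) : False := by
  apply hP
  refine ⟨_, _, _, h1, h2, h4, ?_, ?_, ?_⟩
  · rw [Finset.card_eq_one]; refine ⟨a, ?_⟩; ext i; simp at hd ⊢; grind
  · rw [Finset.card_eq_one]; refine ⟨b, ?_⟩; ext i; simp at hd ⊢; grind
  · ext i; simp at hd ⊢; grind

lemma perm1 {a b c : V} : ({a, b, c} : Finset V) = {b, a, c} := by ext; simp; tauto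
lemma perm2 {a b c : V} : ({a, b, c} : Finset V) = {a, c, b} := by ext; simp; tauto
lemma perm3 {a b c : V} : ({a, b, c} : Finset V) = {c, b, a} := by ext; simp; tauto
lemma perm4 {a b c : V} : ({a, b, c} : Finset V) = {b, c, a} := by ext; simp; tauto
lemma perm5 {a b c : V} : ({a, b, c} : Finset V) = {c, a, b} := by ext; simp; tauto

lemma m1 {H : Finset (Finset V)} {a b c : V} (h : ({a, b, c} : Finset V) ∈ H) :
    ({b, a, c} : Finset V) ∈ H := by rw [perm1] at h; exact h
lemma m2 {H : Finset (Finset V)} {a b c : V} (h : ({a, b, c} : Finset V) ∈ H) :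
    ({a, c, b} : Finset V) ∈ H := by rw [perm2] at h; exact h
lemma m3 {H : Finset (Finset V)} {a b c : V} (h : ({a, b, c} : Finset V) ∈ H) :
    ({c, b, a} : Finset V) ∈ H := by rw [perm3] at h; exact h
lemma m4 {H : Finset (Finset V)} {a b c : V} (h : ({a, b, c} : Finset V) ∈ H) :
    ({b, c, a} : Finset V) ∈ H := by rw [perm4] at h; exact h
lemma m5 {H : Finset (Finset V)} {a b c : V} (h : ({a, b, c} : Finset V) ∈ H) :
    ({c, a, b} : Finset V) ∈ H := by rw [perm5] at h; exact h

lemma pc_of {H : Finset (Finset V)} (h3 : ∀ e ∈ H, e.card = 3) (hP : ¬ HasP33 H)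
    (hT : ¬ Tri H) : PC H := by
  intro a b c y z u w h1 h2 h4 n1 n2 n3 n4 n5 n6 n7 n8
  have k1 := card3_ne (h3 _ h1)
  have k2 := card3_ne (h3 _ h2)
  have k4 := card3_ne (h3 _ h4)
  by_contra hcon
  have key : ∀ y z u w : V, ({a, y, z} : Finset V) ∈ H → ({b, u, w} : Finset V) ∈ H →
      y = u → z ≠ w → [a, b, y, z, w, c].Nodup → False := by
    intro y z u w h2 h4 e1 e2 hn
    subst e1
    apply hT
    refine ⟨a, b, y, w, z, c, ?_, h1, ?_, ?_⟩
    · simp at hn ⊢; grind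
    · exact h4
    · rw [perm1]; exact h2
  by_cases e1 : y = u
  · exact key y z u w h2 h4 e1 (by grind) (by simp; grind)
  by_cases e2 : y = w
  · exact key y z w u h2 (m2 h4) e2 (by grind) (by simp; grind)
  by_cases e3 : z = u
  · exact key z y u w (m2 h2) h4 e3 (by grind) (by simp; grind)
  by_cases e4 : z = w
  · exact key z y w u (m2 h2) (m2 h4) e4 (by grind) (by simp; grind)
  refine noP hP y z a c b u w (by rw [← perm4]; exact h2) (by rw [perm2]; exact h1) h4 ?_
  simp; grind

/-- large codegree gives a common neighbour outside a small set -/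
lemma cod_ex {H : Finset (Finset V)} (h3 : ∀ e ∈ H, e.card = 3) {a b : V} (hab : a ≠ b)
    (X : Finset V) (h : X.card < cod H a b) : ∃ t, t ∉ X ∧ ({a, b, t} : Finset V) ∈ H := by
  by_contra hcon
  push Not at hcon
  have : H.filter (fun e => a ∈ e ∧ b ∈ e) ⊆ X.image (fun t => ({a, b, t} : Finset V)) := by
    intro e he
    rw [Finset.mem_filter] at he
    obtain ⟨heH, ha, hb⟩ := he
    obtain ⟨y, rfl⟩ := one_mem (h3 _ heH) ha hb hab
    rw [Finset.mem_image]
    refine ⟨y, ?_, rfl⟩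
    by_contra hy
    exact hcon y hy heH
  have h1 := Finset.card_le_card this
  have h2 : (X.image (fun t => ({a, b, t} : Finset V))).card ≤ X.card := Finset.card_image_le
  unfold cod at h
  omega

lemma cod_comm (H : Finset (Finset V)) (a b : V) : cod H a b = cod H b a := by
  unfold cod; congr 1; ext e; simp; tauto

lemma lk_comm (H : Finset (Finset V)) (a b c : V) : lk H a b c = lk H a c b := by
  unfold lk; ext e; simp; tauto

lemma dg_le {H : Finset (Finset V)} {a b c : V} (he : ({a, b, c} : Finset V) ∈ H) :
    dg H a + 1 ≤ cod H a b + cod H a c + (lk H a b c).card := by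
  unfold dg cod lk
  set A := H.filter (fun e => a ∈ e ∧ b ∈ e)
  set B := H.filter (fun e => a ∈ e ∧ c ∈ e)
  set L := H.filter (fun e => a ∈ e ∧ b ∉ e ∧ c ∉ e)
  have h1 : H.filter (fun e => a ∈ e) ⊆ (A ∪ B) ∪ L := by
    intro e; simp [A, B, L]; tauto
  have h2 := Finset.card_le_card h1
  have h4 := Finset.card_union_le (A ∪ B) L
  have h5 := Finset.card_union_add_card_inter A B
  have h6 : 0 < (A ∩ B).card := Finset.card_pos.2 ⟨{a, b, c}, by simp [A, B, he]⟩
  omega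

lemma dgI {H : Finset (Finset V)} (h3 : ∀ e ∈ H, e.card = 3) (hPC : PC H)
    (hc : ∀ a b, a ≠ b → cod H a b ≤ 4) {a b c y z : V}
    (he : ({a, b, c} : Finset V) ∈ H) (ha : ({a, y, z} : Finset V) ∈ H)
    (hb : ({b, y, z} : Finset V) ∈ H) (yc : y ≠ c) (zc : z ≠ c)
    (hl : (lk H a b c).card ≤ 1) : dg H a ≤ 7 := by
  have k1 := card3_ne (h3 _ he)
  have k2 := card3_ne (h3 _ ha)
  have k4 := card3_ne (h3 _ hb)
  have h1 := dg_le he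
  have c1 := hc a b k1.1
  have c2 := hc a c k1.2.1
  by_contra hcon
  have c3 : cod H a b = 4 := by omega
  have c4 : cod H a c = 4 := by omega
  obtain ⟨t, ht, hte⟩ := cod_ex h3 k1.1 {c, y, z} (by
    have := Finset.card_le_three (a := c) (b := y) (c := z); omega)
  obtain ⟨s, hs, hse⟩ := cod_ex h3 k1.2.1 {b, t} (by
    have := Finset.card_le_two (a := b) (b := t); omega)
  have k5 := card3_ne (h3 _ hte)
  have k6 := card3_ne (h3 _ hse)
  simp at ht hs
  have := hPC a b t c s y z hte hse hb (by grind) (by grind) (by grind) (by grind) (by grind)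
    (by grind) (by grind) (by grind)
  grind

lemma lk_mem {H : Finset (Finset V)} (h3 : ∀ e ∈ H, e.card = 3) {a b c : V} {e : Finset V}
    (he : e ∈ lk H a b c) : ∃ y z, e = {a, y, z} ∧ ({a, y, z} : Finset V) ∈ H ∧
      y ≠ b ∧ y ≠ c ∧ z ≠ b ∧ z ≠ c := by
  unfold lk at he
  rw [Finset.mem_filter] at he
  obtain ⟨heH, h1, h2, h4⟩ := he
  obtain ⟨y, z, rfl⟩ := two_mem (h3 _ heH) h1
  refine ⟨y, z, rfl, heH, ?_⟩
  simp at h2 h4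
  grind

lemma lk_card_le_one {H : Finset (Finset V)} (h3 : ∀ e ∈ H, e.card = 3) (hPC : PC H) {a b c y z : V}
    (he : ({a, b, c} : Finset V) ∈ H)
    (hb : ({b, y, z} : Finset V) ∈ H) (ya : y ≠ a) (za : z ≠ a) (yc : y ≠ c) (zc : z ≠ c) :
    (lk H a b c).card ≤ 1 := by
  have : lk H a b c ⊆ {({a, y, z} : Finset V)} := by
    intro e hm
    obtain ⟨u, w, rfl, h1, h2, h4, h5, h6⟩ := lk_mem h3 hm
    have := hPC a b c u w y z he h1 hb h2 h4 h5 h6 ya yc za zc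
    rcases this with ⟨rfl, rfl⟩ | ⟨rfl, rfl⟩
    · simp
    · simp [perm2]
  simpa using Finset.card_le_card this

lemma caseI {H : Finset (Finset V)} (h3 : ∀ e ∈ H, e.card = 3) (hPC : PC H)
    (hc : ∀ a b, a ≠ b → cod H a b ≤ 4) {a b c : V}
    (he : ({a, b, c} : Finset V) ∈ H) (ha : (lk H a b c).Nonempty) (hb : (lk H b a c).Nonempty) :
    dg H a ≤ 7 ∧ dg H b ≤ 7 ∧ dg H c ≤ 8 := by
  have k1 := card3_ne (h3 _ he)
  obtain ⟨e, hm⟩ := ha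
  obtain ⟨y, z, -, h1, h2, h4, h5, h6⟩ := lk_mem h3 hm
  obtain ⟨e, hm⟩ := hb
  obtain ⟨u, w, -, g1, g2, g4, g5, g6⟩ := lk_mem h3 hm
  have k2 := card3_ne (h3 _ h1)
  have hb : ({b, y, z} : Finset V) ∈ H := by
    rcases hPC a b c y z u w he h1 g1 h2 h4 h5 h6 g2 g4 g5 g6 with ⟨rfl, rfl⟩ | ⟨rfl, rfl⟩
    · exact g1
    · rw [perm2]; exact g1
  have he' : ({b, a, c} : Finset V) ∈ H := m1 he
  have he'' : ({c, a, b} : Finset V) ∈ H := m5 he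
  have l1 : (lk H a b c).card ≤ 1 := lk_card_le_one h3 hPC he hb (by grind) (by grind) h4 h6
  have l2 : (lk H b a c).card ≤ 1 := lk_card_le_one h3 hPC he' h1 h2 h5 h4 h6
  have l3 : (lk H c a b).card ≤ 1 := lk_card_le_one h3 hPC he'' h1 h4 h6 h2 h5
  refine ⟨dgI h3 hPC hc he h1 hb h4 h6 l1, dgI h3 hPC hc he' hb h1 h4 h6 l2, ?_⟩
  have := dg_le he''
  have := hc c a (by grind)
  have := hc c b (by grind)
  omega

lemma caseIIa {H : Finset (Finset V)} (h3 : ∀ e ∈ H, e.card = 3) (hPC : PC H)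
    (hc : ∀ a b, a ≠ b → cod H a b ≤ 4) {a b c : V}
    (he : ({a, b, c} : Finset V) ∈ H) (hb : lk H b a c = ∅) :
    dg H b ≤ 6 ∨ (dg H b ≤ 7 ∧ dg H a ≤ 10) := by
  have k1 := card3_ne (h3 _ he)
  have he' : ({b, a, c} : Finset V) ∈ H := m1 he
  have d1 := dg_le he'
  rw [hb, Finset.card_empty] at d1
  have c1 := hc b a (by grind)
  have c2 := hc b c (by grind)
  by_cases h6 : dg H b ≤ 6
  · exact Or.inl h6
  right
  refine ⟨by omega, ?_⟩
  have c3 : cod H a b = 4 := by rw [cod_comm]; omega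
  have c4 : cod H b c = 4 := by omega
  set X : Finset V := ((H.filter (fun e => a ∈ e ∧ b ∈ e)).erase {a, b, c}).biUnion
    (fun e => e \ {a, b}) with hX
  have hXc : X.card ≤ 3 := by
    have : X.card ≤ ((H.filter (fun e => a ∈ e ∧ b ∈ e)).erase {a, b, c}).card * 1 := by
      apply Finset.card_biUnion_le_card_mul
      intro e hm
      simp only [Finset.mem_erase, Finset.mem_filter] at hm
      obtain ⟨y, rfl⟩ := one_mem (h3 _ hm.2.1) hm.2.2.1 hm.2.2.2 k1.1
      have : ({a, b, y} : Finset V) \ {a, b} ⊆ {y} := by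
        intro i; simp; tauto
      simpa using Finset.card_le_card this
    rw [Finset.card_erase_of_mem (by simp [he])] at this
    unfold cod at c3
    omega
  have key : ∀ y z, ({a, y, z} : Finset V) ∈ H → y ≠ b → y ≠ c → z ≠ b → z ≠ c → y ∈ X := by
    intro y z hyz n1 n2 n3 n4
    have k2 := card3_ne (h3 _ hyz)
    have : ({a, b, y} : Finset V) ∈ H := by
      by_contra hy
      obtain ⟨t, ht, hte⟩ := cod_ex h3 k1.2.2 {a, y, z} (by
        have := Finset.card_le_three (a := a) (b := y) (c := z); omega)
      obtain ⟨s, hs, hse⟩ := cod_ex h3 k1.1 {c, z, t} (by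
        have := Finset.card_le_three (a := c) (b := z) (c := t); omega)
      have k5 := card3_ne (h3 _ hte)
      have k6 := card3_ne (h3 _ hse)
      have sy : s ≠ y := by rintro rfl; exact hy hse
      simp at ht hs
      have := hPC a b s y z c t hse hyz hte (by grind) (by grind) (by grind) (by grind) (by grind)
        (by grind) (by grind) (by grind)
      grind
    rw [hX, Finset.mem_biUnion]
    refine ⟨{a, b, y}, ?_, ?_⟩
    · simp only [Finset.mem_erase, Finset.mem_filter]
      refine ⟨?_, this, by simp, by simp⟩
      intro h
      have : y ∈ ({a, b, c} : Finset V) := by rw [← h]; simp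
      simp at this
      grind
    · simp; grind
  have hl : (lk H a b c).card ≤ 3 := by
    have : lk H a b c ⊆ (X.powersetCard 2).image (fun s => insert a s) := by
      intro e hm
      obtain ⟨y, z, rfl, g1, g2, g4, g5, g6⟩ := lk_mem h3 hm
      have k2 := card3_ne (h3 _ g1)
      rw [Finset.mem_image]
      refine ⟨{y, z}, ?_, rfl⟩
      rw [Finset.mem_powersetCard]
      refine ⟨?_, Finset.card_pair k2.2.2⟩
      have i1 := key y z g1 g2 g4 g5 g6
      have i2 := key z y (m2 g1) g5 g6 g2 g4
      intro i hi
      simp at hi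
      rcases hi with rfl | rfl <;> assumption
    have h1 := Finset.card_le_card this
    have h2 : ((X.powersetCard 2).image (fun s => insert a s)).card ≤ _ := Finset.card_image_le
    rw [Finset.card_powersetCard] at h2
    have h4 : X.card.choose 2 ≤ Nat.choose 3 2 := Nat.choose_le_choose 2 hXc
    have : Nat.choose 3 2 = 3 := by decide
    omega
  have := dg_le he
  have := hc a b (by grind)
  have := hc a c (by grind)
  omega

lemma caseII {H : Finset (Finset V)} (h3 : ∀ e ∈ H, e.card = 3) (hPC : PC H)
    (hc : ∀ a b, a ≠ b → cod H a b ≤ 4) {a b c : V}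
    (he : ({a, b, c} : Finset V) ∈ H) (hb : lk H b a c = ∅) (hb' : lk H c a b = ∅) :
    (dg H b ≤ 6 ∧ dg H c ≤ 6) ∨ (dg H b ≤ 7 ∧ dg H c ≤ 7 ∧ dg H a ≤ 10) := by
  have h1 := caseIIa h3 hPC hc he hb
  have h2 := caseIIa h3 hPC hc (m2 he) hb'
  omega

lemma allCases {H : Finset (Finset V)} (h3 : ∀ e ∈ H, e.card = 3) (hPC : PC H)
    (hc : ∀ a b, a ≠ b → cod H a b ≤ 4) {e : Finset V} (he : e ∈ H) :
    ∃ a b c, e = {a, b, c} ∧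
      ((dg H b ≤ 7 ∧ dg H c ≤ 7 ∧ dg H a ≤ 10) ∨ (dg H b ≤ 6 ∧ dg H c ≤ 6)) := by
  obtain ⟨a, b, c, -, -, -, rfl⟩ := Finset.card_eq_three.1 (h3 e he)
  have q1 : lk H a b c = lk H a c b := lk_comm ..
  have q2 : lk H b a c = lk H b c a := lk_comm ..
  have q3 : lk H c a b = lk H c b a := lk_comm ..
  rcases (lk H a b c).eq_empty_or_nonempty with ha | ha <;>
  rcases (lk H b a c).eq_empty_or_nonempty with hb | hb <;>
  rcases (lk H c a b).eq_empty_or_nonempty with hcc | hcc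
  · have := caseII h3 hPC hc he hb hcc
    exact ⟨a, b, c, rfl, by omega⟩
  · have := caseII h3 hPC hc (m5 he) (q1 ▸ ha) (q2 ▸ hb)
    exact ⟨c, a, b, perm5, by omega⟩
  · have := caseII h3 hPC hc (m1 he) ha (q3 ▸ hcc)
    exact ⟨b, a, c, perm1, by omega⟩
  · have := caseI h3 hPC hc (m4 he) (q2 ▸ hb) (q3 ▸ hcc)
    exact ⟨a, b, c, rfl, by omega⟩
  · have := caseII h3 hPC hc he hb hcc
    exact ⟨a, b, c, rfl, by omega⟩
  · have := caseI h3 hPC hc (m2 he) (q1 ▸ ha) hcc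
    exact ⟨b, a, c, perm1, by omega⟩
  · have := caseI h3 hPC hc he ha hb
    exact ⟨c, a, b, perm5, by omega⟩
  · have := caseI h3 hPC hc he ha hb
    exact ⟨c, a, b, perm5, by omega⟩

lemma big_eq {H : Finset (Finset V)} (h3 : ∀ e ∈ H, e.card = 3) (hPC : PC H) {v x : V}
    (hvx : v ≠ x) (hc : 5 ≤ cod H v x) {q r q' r' : V}
    (h1 : ({v, q, r} : Finset V) ∈ H) (h2 : ({x, q', r'} : Finset V) ∈ H)
    (n1 : q ≠ x) (n2 : r ≠ x) (n3 : q' ≠ v) (n4 : r' ≠ v) :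
    (q' = q ∧ r' = r) ∨ (q' = r ∧ r' = q) := by
  obtain ⟨t, ht, hte⟩ := cod_ex h3 hvx {q, r, q', r'} (by
    have := Finset.card_le_four (a := q) (b := r) (c := q') (d := r'); omega)
  simp at ht
  exact hPC v x t q r q' r' hte h1 h2 n1 (by grind) n2 (by grind) n3 (by grind) n4 (by grind)

lemma cod_sub {H : Finset (Finset V)} {W : Finset V} (hW : ∀ e ∈ H, e ⊆ W)
    (h3 : ∀ e ∈ H, e.card = 3) {v x : V} (hvx : v ≠ x) (S : Finset V)
    (hS : ∀ t ∈ S, ({v, x, t} : Finset V) ∉ H) : cod H v x ≤ (W \ ({v, x} ∪ S)).card := by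
  by_contra hcon
  obtain ⟨t, ht, hte⟩ := cod_ex h3 hvx _ (not_le.1 hcon)
  have k := card3_ne (h3 _ hte)
  have : t ∈ W := hW _ hte (by simp)
  apply ht
  simp only [Finset.mem_sdiff, Finset.mem_union]
  refine ⟨this, ?_⟩
  rintro (h | h)
  · simp at h; grind
  · exact hS t h hte

lemma cod_le {H : Finset (Finset V)} {W : Finset V} (hW : ∀ e ∈ H, e ⊆ W)
    (h3 : ∀ e ∈ H, e.card = 3) {v x : V} (hvx : v ≠ x) (hv : v ∈ W) (hx : x ∈ W) :
    cod H v x + 2 ≤ W.card := by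
  have h1 := cod_sub hW h3 hvx ∅ (by simp)
  have h2 : ({v, x} ∪ ∅ : Finset V) ⊆ W := by intro i; simp; grind
  rw [Finset.card_sdiff_of_subset h2] at h1
  have h4 := Finset.card_le_card h2
  simp [Finset.card_pair hvx] at h1 h4
  omega

lemma cod_mem {H : Finset (Finset V)} {W : Finset V} (hW : ∀ e ∈ H, e ⊆ W)
    {v x : V} (h : 0 < cod H v x) : v ∈ W ∧ x ∈ W := by
  obtain ⟨e, he⟩ := Finset.card_pos.1 h
  rw [Finset.mem_filter] at he
  exact ⟨hW e he.1 he.2.1, hW e he.1 he.2.2⟩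

lemma cod_two {H : Finset (Finset V)} {W : Finset V} (hW : ∀ e ∈ H, e ⊆ W)
    (h3 : ∀ e ∈ H, e.card = 3) {v x : V} (hvx : v ≠ x) (h8 : W.card = 8) (hc : 5 ≤ cod H v x)
    {s s' : V} (hs : s ∈ W) (hs' : s' ∈ W) (hss : s ≠ s') (n1 : s ≠ v) (n2 : s ≠ x)
    (n3 : s' ≠ v) (n4 : s' ≠ x) : ∃ t, (t = s ∨ t = s') ∧ ({v, x, t} : Finset V) ∈ H := by
  by_contra hcon
  push Not at hcon
  obtain ⟨hv, hx⟩ := cod_mem hW (show 0 < cod H v x by omega)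
  have h1 := cod_sub hW h3 hvx {s, s'} (by
    intro t ht; simp at ht; exact hcon t ht)
  have h2 : ({v, x} ∪ {s, s'} : Finset V) ⊆ W := by intro i; simp; grind
  rw [Finset.card_sdiff_of_subset h2, Finset.card_union_of_disjoint, Finset.card_pair hvx,
    Finset.card_pair hss] at h1
  · omega
  · rw [Finset.disjoint_left]; intro i; simp; grind

/-- either all `x`-edges contain `v`, or the other way around, or both links are one pair -/
lemma big_tri {H : Finset (Finset V)} (h3 : ∀ e ∈ H, e.card = 3) (hPC : PC H) {v x : V}
    (hvx : v ≠ x) (hc : 5 ≤ cod H v x) :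
    (∀ e ∈ H, x ∈ e → v ∈ e) ∨ (∀ e ∈ H, v ∈ e → x ∈ e) ∨
    ∃ q r, ({v, q, r} : Finset V) ∈ H ∧ ({x, q, r} : Finset V) ∈ H ∧
      (∀ e ∈ H, v ∈ e → x ∈ e ∨ e = {v, q, r}) ∧ (∀ e ∈ H, x ∈ e → v ∈ e ∨ e = {x, q, r}) := by
  by_cases h1 : ∀ e ∈ H, x ∈ e → v ∈ e
  · exact Or.inl h1
  by_cases h2 : ∀ e ∈ H, v ∈ e → x ∈ e
  · exact Or.inr (Or.inl h2)
  right; right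
  push Not at h1 h2
  obtain ⟨e, he, he1, he2⟩ := h1
  obtain ⟨f, hf, hf1, hf2⟩ := h2
  obtain ⟨q', r', rfl⟩ := two_mem (h3 _ he) he1
  obtain ⟨q, r, rfl⟩ := two_mem (h3 _ hf) hf1
  simp at he2 hf2
  have hx : ({x, q, r} : Finset V) ∈ H := by
    rcases big_eq h3 hPC hvx hc hf he (by grind) (by grind) (by grind) (by grind) with
      ⟨rfl, rfl⟩ | ⟨rfl, rfl⟩
    · exact he
    · exact m2 he
  have k1 := card3_ne (h3 _ hf)
  have k2 := card3_ne (h3 _ hx)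
  refine ⟨q, r, hf, hx, ?_, ?_⟩
  · intro g hg hvg
    by_contra hcon
    push Not at hcon
    obtain ⟨i, j, rfl⟩ := two_mem (h3 _ hg) hvg
    obtain ⟨hc1, hc2⟩ := hcon
    simp at hc1
    apply hc2
    rcases big_eq h3 hPC hvx hc hg hx (by grind) (by grind) (by grind) (by grind) with
      ⟨rfl, rfl⟩ | ⟨rfl, rfl⟩
    · rfl
    · exact perm2
  · intro g hg hvg
    by_contra hcon
    push Not at hcon
    obtain ⟨i, j, rfl⟩ := two_mem (h3 _ hg) hvg
    obtain ⟨hc1, hc2⟩ := hcon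
    simp at hc1
    apply hc2
    rcases big_eq h3 hPC hvx hc hf hg (by grind) (by grind) (by grind) (by grind) with
      ⟨rfl, rfl⟩ | ⟨rfl, rfl⟩
    · rfl
    · exact perm2

lemma dg_le_cod {H : Finset (Finset V)} {v x : V} (h : ∀ e ∈ H, x ∈ e → v ∈ e) :
    dg H x ≤ cod H v x := by
  apply Finset.card_le_card
  intro e he
  rw [Finset.mem_filter] at he ⊢
  exact ⟨he.1, h e he.1 he.2, he.2⟩

lemma big9 {H : Finset (Finset V)} {W : Finset V} (hW : ∀ e ∈ H, e ⊆ W)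
    (h3 : ∀ e ∈ H, e.card = 3) (hPC : PC H) {v x : V}
    (hvx : v ≠ x) (hc : 5 ≤ cod H v x) (hd : ∀ a ∈ W, W.card ≤ dg H a + 1) : False := by
  obtain ⟨hv, hx⟩ := cod_mem hW (show 0 < cod H v x by omega)
  have hle := cod_le hW h3 hvx hv hx
  rcases big_tri h3 hPC hvx hc with h | h | ⟨q, r, h1, h2, h4, h5⟩
  · have := dg_le_cod h
    have := hd x hx
    omega
  · have := dg_le_cod h
    rw [cod_comm] at this
    have := hd v hv
    omega
  · obtain ⟨t, ht, hte⟩ := cod_ex h3 hvx {q, r} (by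
      have := Finset.card_le_two (a := q) (b := r); omega)
    simp at ht
    have k1 := card3_ne (h3 _ h1)
    have k2 := card3_ne (h3 _ h2)
    have k3 := card3_ne (h3 _ hte)
    have hsub : H.filter (fun e => t ∈ e) ⊆ {{t, v, x}, {t, q, r}} := by
      intro e he
      rw [Finset.mem_filter] at he
      obtain ⟨heH, het⟩ := he
      by_cases hve : v ∈ e
      · rcases h4 e heH hve with h | rfl
        · obtain ⟨i, rfl⟩ := one_mem (h3 _ heH) hve h hvx
          have : t = i := by simp at het; grind
          subst this
          simp [perm5 (a := v)]
        · simp at het; grind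
      by_cases hxe : x ∈ e
      · rcases h5 e heH hxe with h | rfl
        · exact absurd h hve
        · simp at het; grind
      obtain ⟨i, j, rfl⟩ := two_mem (h3 _ heH) het
      simp at hve hxe
      rcases hPC v t x q r i j (m2 hte) h1 heH (by grind) (by grind) (by grind) (by grind)
        (by grind) (by grind) (by grind) (by grind) with ⟨rfl, rfl⟩ | ⟨rfl, rfl⟩
      · simp
      · simp [perm2 (a := t) (b := i)]
    have h6 := Finset.card_le_card hsub
    have h7 := Finset.card_le_two (a := ({t, v, x} : Finset V)) (b := {t, q, r})
    have h8 := hd t (hW _ hte (by simp))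
    unfold dg at h8
    omega

lemma big8b {H : Finset (Finset V)} {W : Finset V} (hW : ∀ e ∈ H, e ⊆ W) (h8 : W.card = 8)
    (h3 : ∀ e ∈ H, e.card = 3) (hPC : PC H) {v x : V}
    (hvx : v ≠ x) (hc : 5 ≤ cod H v x) (hH : 21 ≤ H.card) {q r : V}
    (h1 : ({v, q, r} : Finset V) ∈ H) (h2 : ({x, q, r} : Finset V) ∈ H)
    (h4 : ∀ e ∈ H, v ∈ e → x ∈ e ∨ e = {v, q, r})
    (h5 : ∀ e ∈ H, x ∈ e → v ∈ e ∨ e = {x, q, r}) : False := by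
  have k1 := card3_ne (h3 _ h1)
  have k2 := card3_ne (h3 _ h2)
  obtain ⟨hv, hx⟩ := cod_mem hW (show 0 < cod H v x by omega)
  have key : ∀ g ∈ H, v ∉ g → x ∉ g → q ∈ g ∧ r ∈ g := by
    intro g hg hvg hxg
    by_contra hcon
    have hc1 : (g ∩ {q, r}).card ≤ 1 := by
      rw [Finset.card_le_one]
      intro i hi j hj
      simp at hi hj
      grind
    have hc2 := Finset.card_sdiff_add_card_inter g {q, r}
    rw [h3 g hg] at hc2
    obtain ⟨s, hs, s', hs', hss⟩ := Finset.one_lt_card.1 (show 1 < (g \ {q, r}).card by omega)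
    simp at hs hs'
    have : ∀ i ∈ g, i ≠ v ∧ i ≠ x := by grind
    obtain ⟨t, ht, hte⟩ := cod_two hW h3 hvx h8 hc (hW g hg hs.1) (hW g hg hs'.1) hss
      (this s hs.1).1 (this s hs.1).2 (this s' hs'.1).1 (this s' hs'.1).2
    have htg : t ∈ g ∧ t ≠ q ∧ t ≠ r := by grind
    obtain ⟨i, j, rfl⟩ := two_mem (h3 _ hg) htg.1
    have k3 := card3_ne (h3 _ hte)
    simp at hvg hxg
    rcases hPC v t x q r i j (m2 hte) h1 hg (by grind) (by grind) (by grind) (by grind)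
        (by grind) (by grind) (by grind) (by grind) with ⟨rfl, rfl⟩ | ⟨rfl, rfl⟩ <;> simp at hcon
  have hsub : H ⊆ (H.filter (fun e => v ∈ e ∧ x ∈ e) ∪ H.filter (fun e => q ∈ e ∧ r ∈ e)) ∪
      {{v, q, r}, {x, q, r}} := by
    intro e he
    simp only [Finset.mem_union, Finset.mem_filter, Finset.mem_insert, Finset.mem_singleton]
    by_cases hve : v ∈ e
    · rcases h4 e he hve with h | h
      · exact Or.inl (Or.inl ⟨he, hve, h⟩)
      · exact Or.inr (Or.inl h)
    by_cases hxe : x ∈ e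
    · rcases h5 e he hxe with h | h
      · exact absurd h hve
      · exact Or.inr (Or.inr h)
    exact Or.inl (Or.inr ⟨he, key e he hve hxe⟩)
  have c1 := Finset.card_le_card hsub
  have c2 := Finset.card_union_le
    (H.filter (fun e => v ∈ e ∧ x ∈ e) ∪ H.filter (fun e => q ∈ e ∧ r ∈ e))
    {({v, q, r} : Finset V), {x, q, r}}
  have c3 := Finset.card_union_le
    (H.filter (fun e => v ∈ e ∧ x ∈ e)) (H.filter (fun e => q ∈ e ∧ r ∈ e))
  have c4 := Finset.card_le_two (a := ({v, q, r} : Finset V)) (b := {x, q, r})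
  have c5 := cod_le hW h3 hvx hv hx
  have c6 := cod_le hW h3 k1.2.2 (hW _ h1 (by simp)) (hW _ h1 (by simp))
  unfold cod at c5 c6
  omega

lemma big8a {H : Finset (Finset V)} {W : Finset V} (hW : ∀ e ∈ H, e ⊆ W) (h8 : W.card = 8)
    (h3 : ∀ e ∈ H, e.card = 3) (hPC : PC H) {v x : V}
    (hvx : v ≠ x) (hc : 5 ≤ cod H v x) (hH : 21 ≤ H.card)
    (hall : ∀ e ∈ H, x ∈ e → v ∈ e) : ∀ e ∈ H, v ∈ e := by
  by_contra hcon
  push Not at hcon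
  obtain ⟨g, hg, hvg⟩ := hcon
  obtain ⟨hv, hx⟩ := cod_mem hW (show 0 < cod H v x by omega)
  have hav : ∀ e ∈ H, v ∉ e → ∀ i ∈ e, i ∈ W ∧ i ≠ v ∧ i ≠ x := by
    intro e he hve i hi
    refine ⟨hW e he hi, ?_, ?_⟩
    · rintro rfl; exact hve hi
    · rintro rfl; exact hve (hall e he hi)
  have hgW := hav g hg hvg
  have pick : ∀ s ∈ g, ∀ s' ∈ g, s ≠ s' → ∃ t, (t = s ∨ t = s') ∧ ({v, x, t} : Finset V) ∈ H := by
    intro s hs s' hs' hss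
    exact cod_two hW h3 hvx h8 hc (hgW s hs).1 (hgW s' hs').1 hss (hgW s hs).2.1 (hgW s hs).2.2
      (hgW s' hs').2.1 (hgW s' hs').2.2
  have hq : ∀ q r, ({v, q, r} : Finset V) ∈ H → q ≠ x → r ≠ x → q ∈ g := by
    intro q r hqr n1 n2
    by_contra hqg
    have k1 := card3_ne (h3 _ hqr)
    have hce : 1 < (g.erase r).card := by
      have := Finset.pred_card_le_card_erase (s := g) (a := r)
      rw [h3 g hg] at this
      omega
    obtain ⟨s, hs, s', hs', hss⟩ := Finset.one_lt_card.1 hce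
    simp at hs hs'
    obtain ⟨t, ht, hte⟩ := pick s hs.2 s' hs'.2 hss
    have htg : t ∈ g ∧ t ≠ q ∧ t ≠ r := by grind
    have k3 := card3_ne (h3 _ hte)
    have hxg : x ∉ g := fun h => (hgW x h).2.2 rfl
    obtain ⟨i, j, rfl⟩ := two_mem (h3 _ hg) htg.1
    simp at hvg hxg
    rcases hPC v t x q r i j (m2 hte) hqr (by grind) (by grind) (by grind) (by grind) (by grind)
        (by grind) (by grind) (by grind) (by grind) with ⟨rfl, rfl⟩ | ⟨rfl, rfl⟩ <;> simp at hqg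
  -- edges avoiding `v`
  have hone : ∀ e ∈ H, v ∉ e → (e ∩ g).card ≠ 1 := by
    intro e he hve h1
    obtain ⟨a, ha⟩ := Finset.card_eq_one.1 h1
    have hae : a ∈ e ∩ g := by rw [ha]; simp
    have hai : ∀ i, i ∈ e → i ∈ g → i = a := by
      intro i h h'
      have : i ∈ e ∩ g := by simp [h, h']
      rw [ha] at this; simpa using this
    rw [Finset.mem_inter] at hae
    obtain ⟨c, d, rfl⟩ := two_mem (h3 _ he) hae.1
    obtain ⟨t1, t2, rfl⟩ := two_mem (h3 _ hg) hae.2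
    have k1 := card3_ne (h3 _ he)
    have k2 := card3_ne (h3 _ hg)
    have c1 := hai c (by simp)
    have d1 := hai d (by simp)
    have hxe := hav _ he hve
    have hca := hxe c (by simp)
    have hda := hxe d (by simp)
    have haa := hgW a (by simp)
    have h1a := hgW t1 (by simp)
    have h2a := hgW t2 (by simp)
    simp at c1 d1
    obtain ⟨t, ht, hte⟩ := pick t1 (by simp) t2 (by simp) k2.2.2
    rcases ht with rfl | rfl
    · have := hPC t a t2 v x c d (m1 hg) (m5 hte) he (by grind) (by grind) (by grind)
        (by grind) (by grind) (by grind) (by grind) (by grind)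
      grind
    · have := hPC t a t1 v x c d (m5 hg) (m5 hte) he (by grind) (by grind) (by grind)
        (by grind) (by grind) (by grind) (by grind) (by grind)
      grind
  set R : Finset V := W \ {v, x} with hR
  have hRc : R.card = 6 := by
    rw [hR, Finset.card_sdiff_of_subset, h8, Finset.card_pair hvx]
    intro i; simp; grind
  have hgR : g ⊆ R := by
    intro i hi
    have := hgW i hi
    rw [hR]; simp; tauto
  have hRg : (R \ g).card = 3 := by
    rw [Finset.card_sdiff_of_subset hgR, hRc, h3 g hg]
  set P : Finset (Finset V) := (g.powersetCard 2 ×ˢ (R \ g).powersetCard 1).image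
    (fun p => p.1 ∪ p.2) with hPdef
  have hPc : P.card ≤ 9 := by
    have : P.card ≤ _ := Finset.card_image_le
    rw [Finset.card_product, Finset.card_powersetCard, Finset.card_powersetCard, hRg, h3 g hg] at this
    simpa using this
  set Q : Finset (Finset V) := (g.powersetCard 2).image (fun s => insert v s) with hQdef
  have hQc : Q.card ≤ 3 := by
    have : Q.card ≤ _ := Finset.card_image_le
    rw [Finset.card_powersetCard, h3 g hg] at this
    simpa using this
  have hsub : H ⊆ (H.filter (fun e => v ∈ e ∧ x ∈ e) ∪ Q) ∪ (P ∪ {g, R \ g}) := by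
    intro e he
    simp only [Finset.mem_union]
    by_cases hve : v ∈ e
    · left
      by_cases hxe : x ∈ e
      · left; rw [Finset.mem_filter]; exact ⟨he, hve, hxe⟩
      · right
        obtain ⟨q, r, rfl⟩ := two_mem (h3 _ he) hve
        simp at hxe
        have k := card3_ne (h3 _ he)
        have i1 := hq q r he (by grind) (by grind)
        have i2 := hq r q (m2 he) (by grind) (by grind)
        rw [hQdef, Finset.mem_image]
        refine ⟨{q, r}, ?_, rfl⟩
        rw [Finset.mem_powersetCard]
        refine ⟨?_, Finset.card_pair k.2.2⟩
        intro i; simp; grind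
    · right
      have heR : e ⊆ R := by
        intro i hi
        have := hav e he hve i hi
        rw [hR]; simp; tauto
      have hce : (e \ g).card + (e ∩ g).card = 3 := by
        rw [Finset.card_sdiff_add_card_inter, h3 e he]
      have hne := hone e he hve
      have : (e ∩ g).card = 0 ∨ (e ∩ g).card = 2 ∨ (e ∩ g).card = 3 := by omega
      rcases this with h | h | h
      · right
        have : e = R \ g := by
          apply Finset.eq_of_subset_of_card_le
          · intro i hi
            rw [Finset.mem_sdiff]
            refine ⟨heR hi, fun hi' => ?_⟩
            have : i ∈ e ∩ g := by simp [hi, hi']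
            rw [Finset.card_eq_zero.1 h] at this
            simp at this
          · rw [hRg, h3 e he]
        simp [← this]
      · left
        rw [hPdef, Finset.mem_image]
        refine ⟨(e ∩ g, e \ g), ?_, ?_⟩
        · rw [Finset.mem_product, Finset.mem_powersetCard, Finset.mem_powersetCard]
          refine ⟨⟨Finset.inter_subset_right, h⟩, Finset.sdiff_subset_sdiff heR subset_rfl, ?_⟩
          simp only; omega
        · ext i; simp; tauto
      · right
        have : e = g := by
          have h1 : e ∩ g = e := Finset.eq_of_subset_of_card_le Finset.inter_subset_left
            (by rw [h, h3 e he])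
          apply Finset.eq_of_subset_of_card_le
          · rw [← h1]; exact Finset.inter_subset_right
          · rw [h3 e he, h3 g hg]
        simp [this]
  have c1 := Finset.card_le_card hsub
  have c2 := Finset.card_union_le (H.filter (fun e => v ∈ e ∧ x ∈ e) ∪ Q) (P ∪ {g, R \ g})
  have c3 := Finset.card_union_le (H.filter (fun e => v ∈ e ∧ x ∈ e)) Q
  have c4 := Finset.card_union_le P {g, R \ g}
  have c5 := Finset.card_le_two (a := g) (b := R \ g)
  have c6 := cod_le hW h3 hvx hv hx
  unfold cod at c6
  omega

set_option linter.unusedSectionVars false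

/-- a loose triangle at given vertices -/
def TriAt (H : Finset (Finset V)) (x1 x2 x3 y1 y2 y3 : V) : Prop :=
  [x1, x2, x3, y1, y2, y3].Nodup ∧ ({x1, x2, y3} : Finset V) ∈ H ∧
  ({x2, x3, y1} : Finset V) ∈ H ∧ ({x3, x1, y2} : Finset V) ∈ H

lemma TriAt.rot {H : Finset (Finset V)} {x1 x2 x3 y1 y2 y3 : V} (h : TriAt H x1 x2 x3 y1 y2 y3) :
    TriAt H x2 x3 x1 y2 y3 y1 := by
  obtain ⟨h0, h1, h2, h4⟩ := h
  refine ⟨?_, h2, h4, h1⟩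
  simp at h0 ⊢; grind

lemma TriAt.swap {H : Finset (Finset V)} {x1 x2 x3 y1 y2 y3 : V} (h : TriAt H x1 x2 x3 y1 y2 y3) :
    TriAt H x2 x1 x3 y2 y1 y3 := by
  obtain ⟨h0, h1, h2, h4⟩ := h
  refine ⟨?_, m1 h1, m1 h4, m1 h2⟩
  simp at h0 ⊢; grind

/-- the vertex is outside the triangle -/
def Out (x1 x2 x3 y1 y2 y3 p : V) : Prop :=
  p ≠ x1 ∧ p ≠ x2 ∧ p ≠ x3 ∧ p ≠ y1 ∧ p ≠ y2 ∧ p ≠ y3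

lemma not_out {x1 x2 x3 y1 y2 y3 u : V} (hu : ¬ Out x1 x2 x3 y1 y2 y3 u) :
    u = x1 ∨ u = x2 ∨ u = x3 ∨ u = y1 ∨ u = y2 ∨ u = y3 := by
  unfold Out at hu; tauto
lemma Out.rot {x1 x2 x3 y1 y2 y3 p : V} (h : Out x1 x2 x3 y1 y2 y3 p) :
    Out x2 x3 x1 y2 y3 y1 p := by unfold Out at *; tauto
lemma Out.swap {x1 x2 x3 y1 y2 y3 p : V} (h : Out x1 x2 x3 y1 y2 y3 p) :
    Out x2 x1 x3 y2 y1 y3 p := by unfold Out at *; tauto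

lemma A1 {H : Finset (Finset V)} (hP : ¬ HasP33 H) {x1 x2 x3 y1 y2 y3 p q : V}
    (h : TriAt H x1 x2 x3 y1 y2 y3) (hp : Out x1 x2 x3 y1 y2 y3 p)
    (hq : Out x1 x2 x3 y1 y2 y3 q) (hpq : p ≠ q) : ({x1, p, q} : Finset V) ∉ H := by
  intro he
  obtain ⟨h0, h1, h2, h4⟩ := h
  refine noP hP p q x1 y3 x2 x3 y1 (m4 he) (m2 h1) h2 ?_
  unfold Out at hp hq; simp at h0 ⊢; grind

lemma A2 {H : Finset (Finset V)} (hP : ¬ HasP33 H) {x1 x2 x3 y1 y2 y3 p q : V}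
    (h : TriAt H x1 x2 x3 y1 y2 y3) (hp : Out x1 x2 x3 y1 y2 y3 p)
    (hq : Out x1 x2 x3 y1 y2 y3 q) (hpq : p ≠ q) : ({y3, p, q} : Finset V) ∉ H := by
  intro he
  obtain ⟨h0, h1, h2, h4⟩ := h
  refine noP hP p q y3 x1 x2 x3 y1 (m4 he) (m5 h1) h2 ?_
  unfold Out at hp hq; simp at h0 ⊢; grind

lemma A3 {H : Finset (Finset V)} (hP : ¬ HasP33 H) {x1 x2 x3 y1 y2 y3 p : V}
    (h : TriAt H x1 x2 x3 y1 y2 y3) (hp : Out x1 x2 x3 y1 y2 y3 p) :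
    ({p, x1, y3} : Finset V) ∉ H := by
  intro he
  obtain ⟨h0, h1, h2, h4⟩ := h
  refine noP hP p y3 x1 y2 x3 x2 y1 (m2 he) (m4 h4) (m1 h2) ?_
  unfold Out at hp; simp at h0 ⊢; grind

lemma A4 {H : Finset (Finset V)} (hP : ¬ HasP33 H) {x1 x2 x3 y1 y2 y3 p : V}
    (h : TriAt H x1 x2 x3 y1 y2 y3) (hp : Out x1 x2 x3 y1 y2 y3 p) :
    ({p, y1, y2} : Finset V) ∉ H := by
  intro he
  obtain ⟨h0, h1, h2, h4⟩ := h
  refine noP hP p y2 y1 x3 x2 x1 y3 (m2 he) (m3 h2) (m1 h1) ?_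
  unfold Out at hp; simp at h0 ⊢; grind

lemma A5x {H : Finset (Finset V)} (hP : ¬ HasP33 H) {x1 x2 x3 y1 y2 y3 p q r : V}
    (h : TriAt H x1 x2 x3 y1 y2 y3) (hp : Out x1 x2 x3 y1 y2 y3 p)
    (hq : Out x1 x2 x3 y1 y2 y3 q) (hr : Out x1 x2 x3 y1 y2 y3 r) (hpq : p ≠ q) (hpr : p ≠ r)
    (hqr : q ≠ r) (he : ({p, q, r} : Finset V) ∈ H) : ({p, x1, x2} : Finset V) ∉ H := by
  intro hf
  obtain ⟨h0, h1, h2, h4⟩ := h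
  refine noP hP q r p x1 x2 x3 y1 (m4 he) hf h2 ?_
  unfold Out at hp hq hr; simp at h0 ⊢; grind

lemma A5y {H : Finset (Finset V)} (hP : ¬ HasP33 H) {x1 x2 x3 y1 y2 y3 p q r : V}
    (h : TriAt H x1 x2 x3 y1 y2 y3) (hp : Out x1 x2 x3 y1 y2 y3 p)
    (hq : Out x1 x2 x3 y1 y2 y3 q) (hr : Out x1 x2 x3 y1 y2 y3 r) (hpq : p ≠ q) (hpr : p ≠ r)
    (hqr : q ≠ r) (he : ({p, q, r} : Finset V) ∈ H) : ({p, x1, y1} : Finset V) ∉ H := by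
  intro hf
  obtain ⟨h0, h1, h2, h4⟩ := h
  refine noP hP q r p y1 x1 x2 y3 (m4 he) (m2 hf) h1 ?_
  unfold Out at hp hq hr; simp at h0 ⊢; grind

lemma A6 {H : Finset (Finset V)} (hP : ¬ HasP33 H) {x1 x2 x3 y1 y2 y3 p q : V}
    (h : TriAt H x1 x2 x3 y1 y2 y3) (hp : Out x1 x2 x3 y1 y2 y3 p)
    (hq : Out x1 x2 x3 y1 y2 y3 q) (hpq : p ≠ q) (he : ({p, x1, y1} : Finset V) ∈ H)
    (hf : ({q, x2, x3} : Finset V) ∈ H) : False := by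
  obtain ⟨h0, h1, h2, h4⟩ := h
  refine noP hP p y1 x1 y3 x2 x3 q (m2 he) (m2 h1) (m4 hf) ?_
  unfold Out at hp hq; simp at h0 ⊢; grind

/-- the six possible edges joining `p` to the triangle -/
def six (x1 x2 x3 y1 y2 y3 p : V) : Finset (Finset V) :=
  {{p, x1, y1}, {p, x2, x3}, {p, x2, y2}, {p, x3, x1}, {p, x3, y3}, {p, x1, x2}}

lemma cross {H : Finset (Finset V)} (h3 : ∀ e ∈ H, e.card = 3) (hP : ¬ HasP33 H)
    {x1 x2 x3 y1 y2 y3 p u : V} {e : Finset V}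
    (h : TriAt H x1 x2 x3 y1 y2 y3) (hp : Out x1 x2 x3 y1 y2 y3 p)
    (hu : ¬ Out x1 x2 x3 y1 y2 y3 u) (he : e ∈ H) (hpe : p ∈ e) (hue : u ∈ e) :
    e ∈ six x1 x2 x3 y1 y2 y3 p := by
  have hpu : p ≠ u := by rintro rfl; exact hu hp
  obtain ⟨w, rfl⟩ := one_mem (h3 _ he) hpe hue hpu
  have k := card3_ne (h3 _ he)
  have a1 := A3 hP h hp
  have a2 := A3 hP h.rot hp.rot
  have a3 := A3 hP h.rot.rot hp.rot.rot
  have b1 := A3 hP h.swap hp.swap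
  have b2 := A3 hP h.rot.swap hp.rot.swap
  have b3 := A3 hP h.rot.rot.swap hp.rot.rot.swap
  have c1 := A4 hP h hp
  have c2 := A4 hP h.rot hp.rot
  have c3 := A4 hP h.rot.rot hp.rot.rot
  have he' := m2 he
  by_cases hw : Out x1 x2 x3 y1 y2 y3 w
  · exfalso
    have he2 := m1 he
    have : u = x1 ∨ u = x2 ∨ u = x3 ∨ u = y1 ∨ u = y2 ∨ u = y3 := by
      exact not_out hu
    rcases this with rfl | rfl | rfl | rfl | rfl | rfl
    · exact A1 hP h hp hw k.2.1 he2
    · exact A1 hP h.rot hp.rot hw.rot k.2.1 he2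
    · exact A1 hP h.rot.rot hp.rot.rot hw.rot.rot k.2.1 he2
    · exact A2 hP h.rot hp.rot hw.rot k.2.1 he2
    · exact A2 hP h.rot.rot hp.rot.rot hw.rot.rot k.2.1 he2
    · exact A2 hP h hp hw k.2.1 he2
  · have h1 : u = x1 ∨ u = x2 ∨ u = x3 ∨ u = y1 ∨ u = y2 ∨ u = y3 := by
      exact not_out hu
    have h2 : w = x1 ∨ w = x2 ∨ w = x3 ∨ w = y1 ∨ w = y2 ∨ w = y3 := by
      exact not_out hw
    clear hu hw hp h hpe hue
    rcases h1 with rfl | rfl | rfl | rfl | rfl | rfl <;>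
    rcases h2 with rfl | rfl | rfl | rfl | rfl | rfl <;>
    first
    | (with_reducible exact absurd rfl k.2.2)
    | (with_reducible exact absurd he a1)
    | (with_reducible exact absurd he' a1)
    | (with_reducible exact absurd he a2)
    | (with_reducible exact absurd he' a2)
    | (with_reducible exact absurd he a3)
    | (with_reducible exact absurd he' a3)
    | (with_reducible exact absurd he b1)
    | (with_reducible exact absurd he' b1)
    | (with_reducible exact absurd he b2)
    | (with_reducible exact absurd he' b2)
    | (with_reducible exact absurd he b3)
    | (with_reducible exact absurd he' b3)
    | (with_reducible exact absurd he c1)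
    | (with_reducible exact absurd he' c1)
    | (with_reducible exact absurd he c2)
    | (with_reducible exact absurd he' c2)
    | (with_reducible exact absurd he c3)
    | (with_reducible exact absurd he' c3)
    | (unfold six; simp; done)
    | (rw [perm2]; unfold six; simp; done)

lemma cross2 {H : Finset (Finset V)} (h3 : ∀ e ∈ H, e.card = 3) (hP : ¬ HasP33 H)
    {x1 x2 x3 y1 y2 y3 p u : V} {e f : Finset V}
    (h : TriAt H x1 x2 x3 y1 y2 y3) (hp : Out x1 x2 x3 y1 y2 y3 p)
    (hu : ¬ Out x1 x2 x3 y1 y2 y3 u) (he : e ∈ H) (hpe : p ∈ e) (hue : u ∈ e)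
    (hf : f ∈ H) (hpf : p ∈ f) : f ∈ six x1 x2 x3 y1 y2 y3 p := by
  by_cases hex : ∃ w ∈ f, ¬ Out x1 x2 x3 y1 y2 y3 w
  · obtain ⟨w, hw, hw'⟩ := hex
    exact cross h3 hP h hp hw' hf hpf hw
  push Not at hex
  exfalso
  have hs := cross h3 hP h hp hu he hpe hue
  obtain ⟨q, r, rfl⟩ := two_mem (h3 _ hf) hpf
  have k := card3_ne (h3 _ hf)
  have hq := hex q (by simp)
  have hr := hex r (by simp)
  unfold six at hs
  simp only [Finset.mem_insert, Finset.mem_singleton] at hs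
  rcases hs with rfl | rfl | rfl | rfl | rfl | rfl
  · exact A5y hP h hp hq hr k.1 k.2.1 k.2.2 hf he
  · exact A5x hP h.rot hp.rot hq.rot hr.rot k.1 k.2.1 k.2.2 hf he
  · exact A5y hP h.rot hp.rot hq.rot hr.rot k.1 k.2.1 k.2.2 hf he
  · exact A5x hP h.rot.rot hp.rot.rot hq.rot.rot hr.rot.rot k.1 k.2.1 k.2.2 hf he
  · exact A5y hP h.rot.rot hp.rot.rot hq.rot.rot hr.rot.rot k.1 k.2.1 k.2.2 hf he
  · exact A5x hP h hp hq hr k.1 k.2.1 k.2.2 hf he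

lemma dg_le_choose {H : Finset (Finset V)} (h3 : ∀ e ∈ H, e.card = 3) {a : V} (S : Finset V)
    (ha : a ∈ S) (hS : ∀ e ∈ H, a ∈ e → e ⊆ S) : dg H a ≤ (S.card - 1).choose 2 := by
  have : H.filter (fun e => a ∈ e) ⊆ ((S.erase a).powersetCard 2).image (fun s => insert a s) := by
    intro e he
    rw [Finset.mem_filter] at he
    rw [Finset.mem_image]
    refine ⟨e.erase a, ?_, Finset.insert_erase he.2⟩
    rw [Finset.mem_powersetCard, Finset.card_erase_of_mem he.2, h3 e he.1]
    exact ⟨Finset.erase_subset_erase _ (hS e he.1 he.2), rfl⟩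
  have h1 := Finset.card_le_card this
  have h2 : (((S.erase a).powersetCard 2).image (fun s => insert a s)).card ≤ _ :=
    Finset.card_image_le
  rw [Finset.card_powersetCard, Finset.card_erase_of_mem ha] at h2
  exact h1.trans h2

lemma six_card (x1 x2 x3 y1 y2 y3 p : V) : (six x1 x2 x3 y1 y2 y3 p).card ≤ 6 :=
  Finset.card_le_six

lemma U_card {x1 x2 x3 y1 y2 y3 : V} (h : [x1, x2, x3, y1, y2, y3].Nodup) :
    ({x1, x2, x3, y1, y2, y3} : Finset V).card = 6 := by
  have := List.toFinset_card_of_nodup h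
  simpa using this

lemma mem_U {x1 x2 x3 y1 y2 y3 p : V} :
    p ∈ ({x1, x2, x3, y1, y2, y3} : Finset V) ↔ ¬ Out x1 x2 x3 y1 y2 y3 p := by
  unfold Out; simp; tauto

lemma tri9 {H : Finset (Finset V)} {W : Finset V} (hW : ∀ e ∈ H, e ⊆ W)
    (h3 : ∀ e ∈ H, e.card = 3) (hP : ¬ HasP33 H) (h9 : 9 ≤ W.card)
    (hd : ∀ a ∈ W, W.card ≤ dg H a + 1) : ¬ Tri H := by
  rintro ⟨x1, x2, x3, y1, y2, y3, h⟩
  change TriAt H x1 x2 x3 y1 y2 y3 at h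
  have hU := U_card h.1
  have hUW : ({x1, x2, x3, y1, y2, y3} : Finset V) ⊆ W := by
    have i1 := hW _ h.2.1
    have i2 := hW _ h.2.2.1
    have i3 := hW _ h.2.2.2
    intro i hi
    simp only [Finset.mem_insert, Finset.mem_singleton] at hi
    rcases hi with rfl | rfl | rfl | rfl | rfl | rfl
    · exact i1 (by simp)
    · exact i1 (by simp)
    · exact i2 (by simp)
    · exact i2 (by simp)
    · exact i3 (by simp)
    · exact i1 (by simp)
  have hno : ∀ e ∈ H, ∀ p ∈ e, ∀ u ∈ e, Out x1 x2 x3 y1 y2 y3 p → Out x1 x2 x3 y1 y2 y3 u := by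
    intro e he p hp u hu hpo
    by_contra huo
    have : H.filter (fun e => p ∈ e) ⊆ six x1 x2 x3 y1 y2 y3 p := by
      intro f hf
      rw [Finset.mem_filter] at hf
      exact cross2 h3 hP h hpo huo he hp hu hf.1 hf.2
    have h1 := Finset.card_le_card this
    have h2 := six_card x1 x2 x3 y1 y2 y3 p
    have h4 := hd p (hW e he hp)
    unfold dg at h4
    omega
  set U : Finset V := {x1, x2, x3, y1, y2, y3} with hUdef
  have hc : (W \ U).card = W.card - 6 := by rw [Finset.card_sdiff_of_subset hUW, hU]
  obtain ⟨p, hp⟩ := Finset.card_pos.1 (show 0 < (W \ U).card by omega)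
  have hx1 : x1 ∈ U := by simp [hUdef]
  have d1 := dg_le_choose h3 (a := x1) U hx1 (by
    intro e he hxe i hi
    rw [mem_U]
    intro hi'
    have := hno e he i hi x1 hxe hi'
    exact this.1 rfl)
  have d2 := dg_le_choose h3 (a := p) (W \ U) hp (by
    intro e he hpe i hi
    rw [Finset.mem_sdiff] at hp ⊢
    refine ⟨hW e he hi, ?_⟩
    rw [mem_U] at hp ⊢
    push Not at hp ⊢
    exact hno e he p hpe i hi hp.2)
  have e1 := hd x1 (hUW hx1)
  have e2 := hd p (Finset.mem_sdiff.1 hp).1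
  rw [hU] at d1
  have : Nat.choose (6 - 1) 2 = 10 := by decide
  have h6 : (W \ U).card - 1 ≤ 4 := by omega
  have h7 := Nat.choose_le_choose 2 h6
  have : Nat.choose 4 2 = 6 := by decide
  omega

/-- indicator -/
def ind (H : Finset (Finset V)) (s : Finset V) : ℕ := if s ∈ H then 1 else 0

lemma sum_insert_le' {α : Type*} [DecidableEq α] (f : α → ℕ) (a : α) (s : Finset α) :
    ∑ i ∈ insert a s, f i ≤ f a + ∑ i ∈ s, f i := by
  by_cases h : a ∈ s
  · rw [Finset.insert_eq_of_mem h]; omega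
  · rw [Finset.sum_insert h]

lemma card_six {H S : Finset (Finset V)} {a b c d e f : Finset V} (hS : S ⊆ H)
    (h : S ⊆ {a, b, c, d, e, f}) :
    S.card ≤ ind H a + (ind H b + (ind H c + (ind H d + (ind H e + ind H f)))) := by
  have h1 : S.card = ∑ i ∈ S, ind H i := by
    rw [Finset.card_eq_sum_ones]
    apply Finset.sum_congr rfl
    intro i hi
    simp [ind, hS hi]
  have h2 : ∑ i ∈ S, ind H i ≤ ∑ i ∈ {a, b, c, d, e, f}, ind H i :=
    Finset.sum_le_sum_of_subset h
  have g1 := sum_insert_le' (ind H) a {b, c, d, e, f}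
  have g2 := sum_insert_le' (ind H) b {c, d, e, f}
  have g3 := sum_insert_le' (ind H) c {d, e, f}
  have g4 := sum_insert_le' (ind H) d {e, f}
  have g5 := sum_insert_le' (ind H) e {f}
  rw [Finset.sum_singleton] at g5
  omega

lemma ind_le (H : Finset (Finset V)) (a : Finset V) : ind H a ≤ 1 := by
  unfold ind; split_ifs <;> omega

lemma ind_add {H : Finset (Finset V)} {a b : Finset V} (h : a ∈ H → b ∈ H → False) :
    ind H a + ind H b ≤ 1 := by
  unfold ind; split_ifs <;> first | omega | tauto

lemma compl_count {H : Finset (Finset V)} (hP : ¬ HasP33 H) {U : Finset V} (hU : U.card = 6)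
    {p u w : V} (hp : p ∉ U) (hu : u ∈ U) (hw : w ∈ U) (huw : u ≠ w)
    (he : ({p, u, w} : Finset V) ∈ H) (h3 : ∀ e ∈ H, e.card = 3) :
    (H.filter (fun e => e ⊆ U)).card ≤ 14 := by
  set K : Finset (Finset V) := (((U.erase u).erase w).powersetCard 2).image (fun s => insert u s)
    with hK
  have hKc : K.card = 6 := by
    rw [hK, Finset.card_image_of_injOn]
    · rw [Finset.card_powersetCard, Finset.card_erase_of_mem (by simp [hw, huw.symm]),
        Finset.card_erase_of_mem hu, hU]
      decide
    · intro s hs t ht hst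
      rw [Finset.mem_coe, Finset.mem_powersetCard] at hs ht
      have h1 : u ∉ s := fun h => by have := hs.1 h; simp at this
      have h2 : u ∉ t := fun h => by have := ht.1 h; simp at this
      simp only at hst
      rw [← Finset.erase_insert h1, hst, Finset.erase_insert h2]
  have hKm : ∀ A ∈ K, A ⊆ U ∧ A.card = 3 ∧ u ∈ A ∧ w ∉ A := by
    intro A hA
    rw [hK, Finset.mem_image] at hA
    obtain ⟨s, hs, rfl⟩ := hA
    rw [Finset.mem_powersetCard] at hs
    have h1 : u ∉ s := fun h => by have := hs.1 h; simp at this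
    have h2 : w ∉ s := fun h => by have := hs.1 h; simp at this
    refine ⟨?_, ?_, by simp, ?_⟩
    · intro i hi
      rw [Finset.mem_insert] at hi
      rcases hi with rfl | hi
      · exact hu
      · exact Finset.mem_of_mem_erase (Finset.mem_of_mem_erase (hs.1 hi))
    · rw [Finset.card_insert_of_notMem h1, hs.2]
    · simp [huw.symm, h2]
  have hbad : ∀ A ∈ K, A ∈ H → U \ A ∈ H → False := by
    intro A hA h1 h2
    obtain ⟨g1, g2, g3, g4⟩ := hKm A hA
    apply hP
    refine ⟨A, {p, u, w}, U \ A, h1, he, h2, ?_, ?_, ?_⟩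
    · rw [Finset.card_eq_one]; refine ⟨u, ?_⟩
      ext i; simp only [Finset.mem_inter, Finset.mem_insert, Finset.mem_singleton]
      constructor
      · rintro ⟨hi, rfl | rfl | rfl⟩
        · exact absurd (g1 hi) hp
        · rfl
        · exact absurd hi g4
      · rintro rfl; exact ⟨g3, by tauto⟩
    · rw [Finset.card_eq_one]; refine ⟨w, ?_⟩
      ext i; simp only [Finset.mem_inter, Finset.mem_insert, Finset.mem_singleton, Finset.mem_sdiff]
      constructor
      · rintro ⟨rfl | rfl | rfl, hi⟩
        · exact absurd hi.1 hp
        · exact absurd g3 hi.2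
        · rfl
      · rintro rfl; exact ⟨by tauto, hw, g4⟩
    · ext i; simp
  set N : Finset (Finset V) := U.powersetCard 3 \ H.filter (fun e => e ⊆ U) with hN
  have hsubP : H.filter (fun e => e ⊆ U) ⊆ U.powersetCard 3 := by
    intro e hh
    rw [Finset.mem_filter] at hh
    rw [Finset.mem_powersetCard]
    exact ⟨hh.2, h3 e hh.1⟩
  have hNc : N.card + (H.filter (fun e => e ⊆ U)).card = 20 := by
    rw [hN, Finset.card_sdiff_add_card_eq_card hsubP, Finset.card_powersetCard, hU]
    decide
  have hinj : K.card ≤ N.card := by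
    apply Finset.card_le_card_of_injOn (fun A => if A ∈ H then U \ A else A)
    · intro A hA
      obtain ⟨g1, g2, g3, g4⟩ := hKm A hA
      simp only
      rw [Finset.mem_coe, hN, Finset.mem_sdiff, Finset.mem_powersetCard, Finset.mem_filter]
      split_ifs with hh
      · refine ⟨⟨Finset.sdiff_subset, ?_⟩, fun h => hbad A hA hh h.1⟩
        rw [Finset.card_sdiff_of_subset g1, hU, g2]
      · exact ⟨⟨g1, g2⟩, fun h => hh h.1⟩
    · intro A hA B hB hAB
      obtain ⟨g1, g2, g3, g4⟩ := hKm A hA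
      obtain ⟨f1, f2, f3, f4⟩ := hKm B hB
      simp only at hAB
      split_ifs at hAB with i1 i2 i2
      · rw [← Finset.sdiff_sdiff_eq_self g1, hAB, Finset.sdiff_sdiff_eq_self f1]
      · rw [← hAB] at f3; simp [g3] at f3
      · rw [hAB] at g3; simp [f3] at g3
      · exact hAB
  omega

lemma six_form {x1 x2 x3 y1 y2 y3 p : V} {e : Finset V} (h : e ∈ six x1 x2 x3 y1 y2 y3 p) :
    ∃ u w, e = {p, u, w} ∧ u ∈ ({x1, x2, x3, y1, y2, y3} : Finset V) ∧
      w ∈ ({x1, x2, x3, y1, y2, y3} : Finset V) := by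
  unfold six at h
  simp only [Finset.mem_insert, Finset.mem_singleton] at h
  rcases h with rfl | rfl | rfl | rfl | rfl | rfl <;> exact ⟨_, _, rfl, by simp, by simp⟩

lemma tri8 {H : Finset (Finset V)} {W : Finset V} (hW : ∀ e ∈ H, e ⊆ W)
    (h3 : ∀ e ∈ H, e.card = 3) (hP : ¬ HasP33 H) (h8 : W.card = 8) (hT : Tri H) :
    H.card ≤ 20 := by
  obtain ⟨x1, x2, x3, y1, y2, y3, h⟩ := hT
  change TriAt H x1 x2 x3 y1 y2 y3 at h
  have hU := U_card h.1
  have hUW : ({x1, x2, x3, y1, y2, y3} : Finset V) ⊆ W := by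
    have i1 := hW _ h.2.1
    have i2 := hW _ h.2.2.1
    have i3 := hW _ h.2.2.2
    intro i hi
    simp only [Finset.mem_insert, Finset.mem_singleton] at hi
    rcases hi with rfl | rfl | rfl | rfl | rfl | rfl
    · exact i1 (by simp)
    · exact i1 (by simp)
    · exact i2 (by simp)
    · exact i2 (by simp)
    · exact i3 (by simp)
    · exact i1 (by simp)
  set U : Finset V := {x1, x2, x3, y1, y2, y3} with hUdef
  have hc : (W \ U).card = 2 := by rw [Finset.card_sdiff_of_subset hUW, hU, h8]
  obtain ⟨p, q, hpq, hpqe⟩ := Finset.card_eq_two.1 hc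
  have hpm : p ∈ W \ U := by rw [hpqe]; simp
  have hqm : q ∈ W \ U := by rw [hpqe]; simp
  rw [Finset.mem_sdiff] at hpm hqm
  have hpo : Out x1 x2 x3 y1 y2 y3 p := by
    have := hpm.2; rw [mem_U] at this; push Not at this; exact this
  have hqo : Out x1 x2 x3 y1 y2 y3 q := by
    have := hqm.2; rw [mem_U] at this; push Not at this; exact this
  have hmeet : ∀ e ∈ H, ∃ u ∈ e, u ∈ U := by
    intro e he
    by_contra hcon
    push Not at hcon
    have : e ⊆ W \ U := fun i hi => Finset.mem_sdiff.2 ⟨hW e he hi, hcon i hi⟩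
    have := Finset.card_le_card this
    rw [h3 e he] at this
    omega
  have hsx : ∀ p, Out x1 x2 x3 y1 y2 y3 p →
      H.filter (fun e => p ∈ e) ⊆ six x1 x2 x3 y1 y2 y3 p := by
    intro p hp e he
    rw [Finset.mem_filter] at he
    obtain ⟨u, hue, huU⟩ := hmeet e he.1
    rw [hUdef, mem_U] at huU
    exact cross h3 hP h hp huU he.1 he.2 hue
  have hsub : H ⊆ H.filter (fun e => e ⊆ U) ∪ (H.filter (fun e => p ∈ e) ∪
      H.filter (fun e => q ∈ e)) := by
    intro e he
    simp only [Finset.mem_union, Finset.mem_filter]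
    by_cases heU : e ⊆ U
    · exact Or.inl ⟨he, heU⟩
    · right
      obtain ⟨i, hi, hiU⟩ := Finset.not_subset.1 heU
      have : i ∈ W \ U := Finset.mem_sdiff.2 ⟨hW e he hi, hiU⟩
      rw [hpqe] at this
      simp at this
      rcases this with rfl | rfl
      · exact Or.inl ⟨he, hi⟩
      · exact Or.inr ⟨he, hi⟩
  have c1 := Finset.card_le_card hsub
  have c2 := Finset.card_union_le (H.filter (fun e => e ⊆ U)) (H.filter (fun e => p ∈ e) ∪
      H.filter (fun e => q ∈ e))
  have c3 := Finset.card_union_le (H.filter (fun e => p ∈ e)) (H.filter (fun e => q ∈ e))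
  have c4 : (H.filter (fun e => e ⊆ U)).card ≤ 20 := by
    have : H.filter (fun e => e ⊆ U) ⊆ U.powersetCard 3 := by
      intro e hh
      rw [Finset.mem_filter] at hh
      rw [Finset.mem_powersetCard]
      exact ⟨hh.2, h3 e hh.1⟩
    have := Finset.card_le_card this
    rw [Finset.card_powersetCard, hU] at this
    exact this.trans (by decide)
  have s1 := card_six (Finset.filter_subset _ H) (hsx p hpo)
  have s2 := card_six (Finset.filter_subset _ H) (hsx q hqo)
  have t1 := ind_add (A6 hP h hpo hqo hpq)
  have t2 := ind_add (A6 hP h.rot hpo.rot hqo.rot hpq)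
  have t3 := ind_add (A6 hP h.rot.rot hpo.rot.rot hqo.rot.rot hpq)
  have r1 := ind_add (A6 hP h hqo hpo hpq.symm)
  have r2 := ind_add (A6 hP h.rot hqo.rot hpo.rot hpq.symm)
  have r3 := ind_add (A6 hP h.rot.rot hqo.rot.rot hpo.rot.rot hpq.symm)
  have hfour : ∀ p, Out x1 x2 x3 y1 y2 y3 p → 0 < (H.filter (fun e => p ∈ e)).card →
      (H.filter (fun e => e ⊆ U)).card ≤ 14 := by
    intro p hpo hpos
    obtain ⟨e, he⟩ := Finset.card_pos.1 hpos
    obtain ⟨u, w, rfl, hu, hw⟩ := six_form (hsx p hpo he)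
    have heH := (Finset.mem_filter.1 he).1
    exact compl_count hP hU (by rw [hUdef, mem_U]; push Not; exact hpo) hu hw
      (card3_ne (h3 _ heH)).2.2 heH h3
  have f1 := hfour p hpo
  have f2 := hfour q hqo
  omega

lemma dg14 {H : Finset (Finset V)} {W : Finset V} (hW : ∀ e ∈ H, e ⊆ W)
    (h3 : ∀ e ∈ H, e.card = 3) (h8 : W.card = 8)
    (hc : ∀ a b, a ≠ b → cod H a b ≤ 4) {a : V} (ha : a ∈ W) : dg H a ≤ 14 := by
  have h1 : ∑ u ∈ W.erase a, cod H a u = ∑ e ∈ H.filter (fun e => a ∈ e), 2 := by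
    have : ∀ u ∈ W.erase a, cod H a u =
        ∑ e ∈ H.filter (fun e => a ∈ e), if u ∈ e then 1 else 0 := by
      intro u _
      unfold cod
      rw [← Finset.card_filter, Finset.filter_filter]
    rw [Finset.sum_congr rfl this, Finset.sum_comm]
    apply Finset.sum_congr rfl
    intro e he
    rw [Finset.mem_filter] at he
    rw [← Finset.card_filter]
    have : (W.erase a).filter (fun u => u ∈ e) = e.erase a := by
      ext i
      simp only [Finset.mem_filter, Finset.mem_erase]
      constructor
      · rintro ⟨⟨h, _⟩, h'⟩; exact ⟨h, h'⟩
      · rintro ⟨h, h'⟩; exact ⟨⟨h, hW e he.1 h'⟩, h'⟩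
    rw [this, Finset.card_erase_of_mem he.2, h3 e he.1]
  have h2 : ∑ u ∈ W.erase a, cod H a u ≤ ∑ u ∈ W.erase a, 4 := by
    apply Finset.sum_le_sum
    intro u hu
    exact hc a u (Finset.ne_of_mem_erase hu).symm
  rw [h1] at h2
  simp only [Finset.sum_const, Finset.card_erase_of_mem ha, h8, smul_eq_mul] at h2
  unfold dg
  omega

lemma dg_pos {H : Finset (Finset V)} {a : V} {e : Finset V} (he : e ∈ H) (ha : a ∈ e) :
    0 < dg H a := Finset.card_pos.2 ⟨e, Finset.mem_filter.2 ⟨he, ha⟩⟩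

lemma inv_ge {d k : ℕ} (h : 0 < d) (hk : d ≤ k) : (1 : ℚ) / k ≤ 1 / d := by
  apply one_div_le_one_div_of_le
  · exact_mod_cast h
  · exact_mod_cast hk

lemma small8 {H : Finset (Finset V)} {W : Finset V} (hW : ∀ e ∈ H, e ⊆ W)
    (h3 : ∀ e ∈ H, e.card = 3) (h8 : W.card = 8) (hPC : PC H)
    (hc : ∀ a b, a ≠ b → cod H a b ≤ 4) : H.card < 21 := by
  have hw : ∀ e ∈ H, (27 / 70 : ℚ) ≤ ∑ v ∈ e, (1 : ℚ) / dg H v := by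
    intro e he
    obtain ⟨a, b, c, rfl, hcase⟩ := allCases h3 hPC hc he
    have k := card3_ne (h3 _ he)
    rw [Finset.sum_insert (by simp; tauto), Finset.sum_insert (by simp; tauto),
      Finset.sum_singleton]
    have pa := dg_pos he (a := a) (by simp)
    have pb := dg_pos he (a := b) (by simp)
    have pc := dg_pos he (a := c) (by simp)
    have qa := dg14 hW h3 h8 hc (hW _ he (show a ∈ _ by simp))
    rcases hcase with ⟨h1, h2, h4⟩ | ⟨h1, h2⟩
    · have := inv_ge pa h4
      have := inv_ge pb h1
      have := inv_ge pc h2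
      norm_num at *
      linarith
    · have := inv_ge pa qa
      have := inv_ge pb h1
      have := inv_ge pc h2
      norm_num at *
      linarith
  have h1 : (H.card : ℚ) * (27 / 70) ≤ ∑ e ∈ H, ∑ v ∈ e, (1 : ℚ) / dg H v := by
    rw [← nsmul_eq_mul]
    exact Finset.card_nsmul_le_sum _ _ _ hw
  have h2 : ∑ e ∈ H, ∑ v ∈ e, (1 : ℚ) / dg H v =
      ∑ v ∈ W, ∑ e ∈ H.filter (fun e => v ∈ e), (1 : ℚ) / dg H v := by
    apply Finset.sum_comm'
    intro e v
    rw [Finset.mem_filter]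
    constructor
    · rintro ⟨h, h'⟩; exact ⟨⟨h, h'⟩, hW e h h'⟩
    · rintro ⟨⟨h, h'⟩, _⟩; exact ⟨h, h'⟩
  have h4 : ∑ v ∈ W, ∑ e ∈ H.filter (fun e => v ∈ e), (1 : ℚ) / dg H v ≤ ∑ v ∈ W, 1 := by
    apply Finset.sum_le_sum
    intro v _
    rw [Finset.sum_const, nsmul_eq_mul]
    change (dg H v : ℚ) * (1 / dg H v) ≤ 1
    rcases Nat.eq_zero_or_pos (dg H v) with h | h
    · simp [h]
    · have : (0 : ℚ) < dg H v := by exact_mod_cast h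
      rw [mul_one_div_cancel this.ne']
  have h5 : ∑ v ∈ W, (1 : ℚ) = 8 := by simp [h8]
  by_contra hcon
  have : (21 : ℚ) ≤ H.card := by exact_mod_cast not_lt.1 hcon
  linarith

lemma base8 {H : Finset (Finset V)} {W : Finset V} (hW : ∀ e ∈ H, e ⊆ W)
    (h3 : ∀ e ∈ H, e.card = 3) (h8 : W.card = 8) (hP : ¬ HasP33 H) (hH : 21 ≤ H.card) :
    ∃ v, ∀ e ∈ H, v ∈ e := by
  by_cases hT : Tri H
  · have := tri8 hW h3 hP h8 hT
    omega
  have hPC := pc_of h3 hP hT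
  by_cases hc : ∀ a b, a ≠ b → cod H a b ≤ 4
  · have := small8 hW h3 h8 hPC hc
    omega
  push Not at hc
  obtain ⟨v, x, hvx, hc⟩ := hc
  rcases big_tri h3 hPC hvx hc with h | h | ⟨q, r, h1, h2, h4, h5⟩
  · exact ⟨v, big8a hW h8 h3 hPC hvx hc hH h⟩
  · rw [cod_comm] at hc
    exact ⟨x, big8a hW h8 h3 hPC hvx.symm hc hH h⟩
  · exact (big8b hW h8 h3 hPC hvx hc hH h1 h2 h4 h5).elim

lemma mindeg {H : Finset (Finset V)} {W : Finset V} (hW : ∀ e ∈ H, e ⊆ W)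
    (h3 : ∀ e ∈ H, e.card = 3) (hP : ¬ HasP33 H) (h9 : 9 ≤ W.card)
    (hd : ∀ a ∈ W, W.card ≤ dg H a + 1) : False := by
  have hPC := pc_of h3 hP (tri9 hW h3 hP h9 hd)
  by_cases hc : ∀ a b, a ≠ b → cod H a b ≤ 4
  · obtain ⟨a, ha⟩ := Finset.card_pos.1 (show 0 < W.card by omega)
    have := hd a ha
    obtain ⟨e, he⟩ := Finset.card_pos.1 (show 0 < dg H a by omega)
    have he := (Finset.mem_filter.1 he).1
    obtain ⟨a, b, c, rfl, hcase⟩ := allCases h3 hPC hc he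
    have := hd b (hW _ he (by simp))
    omega
  · push Not at hc
    obtain ⟨v, x, hvx, hc⟩ := hc
    exact big9 hW h3 hPC hvx hc hd

/-- the full star -/
def star (W : Finset V) (v : V) : Finset (Finset V) := (W.powersetCard 3).filter (fun e => v ∈ e)

lemma star_card {W : Finset V} {v : V} : (star W v).card ≤ (W.card - 1).choose 2 := by
  by_cases hv : v ∈ W
  · apply dg_le_choose (H := W.powersetCard 3) (fun e he => (Finset.mem_powersetCard.1 he).2) W hv
    intro e he _
    exact (Finset.mem_powersetCard.1 he).1
  · have : star W v = ∅ := by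
      unfold star
      rw [Finset.filter_eq_empty_iff]
      intro e he hve
      exact hv ((Finset.mem_powersetCard.1 he).1 hve)
    simp [this]

lemma eq_star {H : Finset (Finset V)} {W : Finset V} (hW : ∀ e ∈ H, e ⊆ W)
    (h3 : ∀ e ∈ H, e.card = 3) (hH : (W.card - 1).choose 2 ≤ H.card) {v : V}
    (hv : ∀ e ∈ H, v ∈ e) : H = star W v := by
  apply Finset.eq_of_subset_of_card_le
  · intro e he
    exact Finset.mem_filter.2 ⟨Finset.mem_powersetCard.2 ⟨hW e he, h3 e he⟩, hv e he⟩
  · exact star_card.trans hH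

lemma main_aux (n : ℕ) (hn : 8 ≤ n) : ∀ (W : Finset V) (H : Finset (Finset V)), W.card = n →
    (∀ e ∈ H, e ⊆ W) → (∀ e ∈ H, e.card = 3) → ¬ HasP33 H → (n - 1).choose 2 ≤ H.card →
    ∃ v, ∀ e ∈ H, v ∈ e := by
  induction n, hn using Nat.le_induction with
  | base =>
    intro W H hWc hW h3 hP hH
    exact base8 hW h3 hWc hP (by simpa [Nat.choose] using hH)
  | succ n hn ih =>
    intro W H hWc hW h3 hP hH
    by_cases hd : ∀ a ∈ W, W.card ≤ dg H a + 1
    · exact (mindeg hW h3 hP (by omega) hd).elim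
    push Not at hd
    obtain ⟨u, hu, hdu⟩ := hd
    set H' := H.filter (fun e => u ∉ e) with hH'
    have hs : dg H u + H'.card = H.card := Finset.card_filter_add_card_filter_not _
    have hch : (n + 1 - 1).choose 2 = (n - 1) + (n - 1).choose 2 := by
      obtain ⟨m, rfl⟩ : ∃ m, n = m + 1 := ⟨n - 1, by omega⟩
      simp [Nat.choose_succ_succ]
    have hsubH : ∀ e ∈ H', e ∈ H := fun e he => (Finset.mem_filter.1 he).1
    have hW' : ∀ e ∈ H', e ⊆ W.erase u := by
      intro e he
      rw [Finset.mem_filter] at he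
      exact Finset.subset_erase.2 ⟨hW e he.1, he.2⟩
    have hWc' : (W.erase u).card = n := by rw [Finset.card_erase_of_mem hu, hWc]; omega
    have h3' : ∀ e ∈ H', e.card = 3 := fun e he => h3 e (hsubH e he)
    have hP' : ¬ HasP33 H' := by
      rintro ⟨e1, e2, e3, g1, g2, g3, g⟩
      exact hP ⟨e1, e2, e3, hsubH _ g1, hsubH _ g2, hsubH _ g3, g⟩
    have hHc' : (n - 1).choose 2 ≤ H'.card := by omega
    obtain ⟨v, hv⟩ := ih (W.erase u) H' hWc' hW' h3' hP' hHc'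
    refine ⟨v, ?_⟩
    have hst := eq_star hW' h3' (by rw [hWc']; exact hHc') hv
    have hvW : v ∈ W.erase u := by
      have : 0 < H'.card := by
        have : 0 < (n - 1).choose 2 := Nat.choose_pos (by omega)
        omega
      obtain ⟨e, he⟩ := Finset.card_pos.1 this
      exact hW' e he (hv e he)
    intro e he
    by_contra hve
    have hue : u ∈ e := by
      by_contra hue
      exact hve (hv e (Finset.mem_filter.2 ⟨he, hue⟩))
    obtain ⟨a, b, rfl⟩ := two_mem (h3 _ he) hue
    have k := card3_ne (h3 _ he)
    have hin : ∀ i j, i ∈ W.erase u → j ∈ W.erase u → i ≠ j → i ≠ v → j ≠ v →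
        ({v, i, j} : Finset V) ∈ H := by
      intro i j hi hj hij hiv hjv
      apply hsubH
      rw [hst]
      refine Finset.mem_filter.2 ⟨Finset.mem_powersetCard.2 ⟨?_, ?_⟩, by simp⟩
      · intro l hl
        simp only [Finset.mem_insert, Finset.mem_singleton] at hl
        rcases hl with rfl | rfl | rfl <;> assumption
      · rw [Finset.card_eq_three]
        exact ⟨v, i, j, hiv.symm, hjv.symm, hij, rfl⟩
    have hbig : 2 < (W \ {u, a, b, v}).card := by
      have h1 := Finset.le_card_sdiff {u, a, b, v} W
      have h2 := Finset.card_le_four (a := u) (b := a) (c := b) (d := v)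
      omega
    obtain ⟨x, y, z, hx, hy, hz, hxy, hxz, hyz⟩ := Finset.two_lt_card_iff.1 hbig
    simp only [Finset.mem_sdiff, Finset.mem_insert, Finset.mem_singleton, not_or] at hx hy hz
    have haW : a ∈ W := hW _ he (by simp)
    simp only [Finset.mem_insert, Finset.mem_singleton, not_or] at hve
    refine noP hP u b a x v y z (m2 he) ?_ ?_ ?_
    · exact m4 (hin a x (Finset.mem_erase.2 ⟨k.1.symm, haW⟩) (Finset.mem_erase.2 ⟨hx.2.1, hx.1⟩)
        (Ne.symm hx.2.2.1) (Ne.symm hve.2.1) hx.2.2.2.2)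
    · exact hin y z (Finset.mem_erase.2 ⟨hy.2.1, hy.1⟩) (Finset.mem_erase.2 ⟨hz.2.1, hz.1⟩) hyz
        hy.2.2.2.2 hz.2.2.2.2
    · simp; grind

end TuranP33

theorem turan_P33_extremal_star (n : ℕ) (hn : 8 ≤ n) (H : Finset (Finset (Fin n)))
    (h3 : ∀ e ∈ H, e.card = 3) (hP : ¬ HasP33 H) (hcard : H.card = (n - 1).choose 2) :
    ∃ v : Fin n, H = (Finset.univ.powersetCard 3).filter (fun e => v ∈ e) := by
  obtain ⟨v, hv⟩ := TuranP33.main_aux n hn Finset.univ H (by simp) (fun e _ => Finset.subset_univ e)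
    h3 hP hcard.ge
  exact ⟨v, TuranP33.eq_star (fun e _ => Finset.subset_univ e) h3 (by simp [hcard]) hv⟩
end

section
/- Let H be a P³₃-free 3-graph containing a triangle C on U, W = V(H)\U with |W| = s ≥ 1. If H has at least one edge meeting both U and W, then |H[U]| + |H(U,W)| ≤ 13 + max{3s, 6}, where H[U] is the set of edges of H inside U and H(U,W) is the set of edges of H meeting both U and W. -/
/-- `H` contains a copy of the 3-uniform triangle `C³₃`. -/
def HasC33 {V : Type*} [DecidableEq V] (H : Finset (Finset V)) : Prop :=
  ∃ a b c d e f : V, ({a, b, c, d, e, f} : Finset V).card = 6 ∧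
    ({a, b, c} : Finset V) ∈ H ∧ ({c, d, e} : Finset V) ∈ H ∧ ({e, f, a} : Finset V) ∈ H

open Finset

/-- The edges of the triangle, on the labels `x₁ x₂ x₃ y₁ y₂ y₃ = 0 1 2 3 4 5`. -/
def triE : Finset (Finset (Fin 6)) := {{0, 4, 2}, {1, 5, 0}, {2, 3, 1}}

/-- The pairs which may extend to a crossing edge. -/
def netE : Finset (Finset (Fin 6)) := {{0, 1}, {0, 2}, {1, 2}, {0, 3}, {1, 4}, {2, 5}}

lemma net_of_no_path : ∀ A : Finset (Fin 6), A.Nonempty → A.card ≤ 2 → A ∉ netE →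
    ∃ g ∈ triE, ∃ g' ∈ triE, (A ∩ g).card = 1 ∧ (g ∩ g').card = 1 ∧ A ∩ g' = ∅ := by
  decide +kernel

lemma net_cross : ∀ p ∈ netE, ∀ q ∈ netE, p ∩ q = ∅ →
    ∃ g ∈ triE, (p ∩ g).card = 1 ∧ (q ∩ g).card = 1 := by
  decide +kernel

lemma net_forbidden : ∀ p ∈ netE, ∃ t : Finset (Fin 6), t.card = 3 ∧ p ∩ t = ∅ ∧
    ∃ g ∈ triE, (p ∩ g).card = 1 ∧ (g ∩ t).card = 1 := by
  decide +kernel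

lemma net_card : ∀ p ∈ netE, p.card = 2 := by decide +kernel

/-- A perfect matching of disjoint pairs in `netE`. -/
def opp (p : Finset (Fin 6)) : Finset (Fin 6) :=
  if p = {0, 1} then {2, 5} else if p = {2, 5} then {0, 1} else
  if p = {0, 2} then {1, 4} else if p = {1, 4} then {0, 2} else
  if p = {1, 2} then {0, 3} else {1, 2}

lemma opp_spec : ∀ p ∈ netE, opp p ∈ netE ∧ p ∩ opp p = ∅ ∧ opp (opp p) = p := by
  decide +kernel

lemma net_count (A : Finset (Finset (Fin 6))) (hA : A ⊆ netE) :
    A.card + (netE.filter fun q => ∀ p ∈ A, p ∩ q ≠ ∅).card ≤ 6 := by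
  have h1 : (A.image opp).card = A.card := by
    refine card_image_of_injOn fun p hp q hq h => ?_
    rw [← (opp_spec p (hA hp)).2.2, ← (opp_spec q (hA hq)).2.2, h]
  have hd : Disjoint (A.image opp) (netE.filter fun q => ∀ p ∈ A, p ∩ q ≠ ∅) := by
    rw [disjoint_left]
    intro q hq hq'
    obtain ⟨p, hp, rfl⟩ := mem_image.1 hq
    exact (mem_filter.1 hq').2 p hp (opp_spec p (hA hp)).2.1
  rw [← h1, ← card_union_of_disjoint hd]
  refine (card_le_card (t := netE) (union_subset ?_ (filter_subset _ _))).trans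
    (by decide +kernel)
  intro q hq
  obtain ⟨p, hp, rfl⟩ := mem_image.1 hq
  exact (opp_spec p (hA hp)).1

lemma sep_count : ∀ x y : Fin 6, x ≠ y →
    (((univ : Finset (Fin 6)).powersetCard 3).filter fun t => ¬ (y ∈ t ∧ x ∉ t)).card = 14 := by
  decide +kernel

lemma sep_bound (x y : Fin 6) (hxy : x ≠ y) (t₀ : Finset (Fin 6)) (ht : t₀.card = 3)
    (hx : x ∉ t₀) (hy : y ∉ t₀) (G : Finset (Finset (Fin 6))) (hG : ∀ t ∈ G, t.card = 3)
    (h0 : t₀ ∉ G) (hc : ∀ t ∈ G, x ∈ t → y ∉ t → tᶜ ∉ G) : G.card ≤ 13 := by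
  set T := ((univ : Finset (Fin 6)).powersetCard 3).filter fun t => ¬ (y ∈ t ∧ x ∉ t) with hT
  have h14 : T.card = 14 := sep_count x y hxy
  have ht0 : t₀ ∈ T := by simp [hT, mem_powersetCard, ht, hy]
  have h13 : (T.erase t₀).card = 13 := by rw [card_erase_of_mem ht0, h14]
  rw [← h13]
  refine card_le_card_of_injOn (fun t => if y ∈ t ∧ x ∉ t then tᶜ else t) ?_ ?_
  · intro t htG
    have h3 := hG t htG
    have hne : t ≠ t₀ := fun h => h0 (h ▸ htG)
    simp only [coe_erase, Set.mem_sdiff, mem_coe, Set.mem_singleton_iff, hT, mem_filter,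
      mem_powersetCard, subset_univ, true_and]
    split_ifs with h
    · refine ⟨⟨by simp [card_compl, h3], by simp [h.1]⟩, ?_⟩
      rintro rfl
      simp [h.2] at hx
    · exact ⟨⟨h3, h⟩, hne⟩
  · intro t htG t' htG' heq
    simp only at heq
    split_ifs at heq with h h' h'
    · exact compl_injective heq
    · subst heq
      exact absurd htG (by simpa using hc _ htG' (by simp [h.2]) (by simp [h.1]))
    · subst heq
      exact absurd htG' (by simpa using hc _ htG (by simp [h'.2]) (by simp [h'.1]))
    · exact heq

lemma sum_bound {V : Type*} [DecidableEq V] (W : Finset V) (f : V → ℕ) (h6 : ∀ w, f w ≤ 6)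
    (h : ∀ w ∈ W, ∀ w' ∈ W, w ≠ w' → 0 < f w → f w + f w' ≤ 6) :
    W.sum f ≤ max (3 * W.card) 6 := by
  by_cases hall : ∀ w ∈ W, f w ≤ 3
  · have := sum_le_card_nsmul W f 3 hall
    rw [smul_eq_mul] at this
    omega
  · push Not at hall
    obtain ⟨w, hw, hf⟩ := hall
    have h1 := sum_le_card_nsmul (W.erase w) f (6 - f w) (fun v hv => by
      have := h w hw v (mem_of_mem_erase hv) (ne_of_mem_erase hv).symm (by omega)
      omega)
    rw [smul_eq_mul] at h1
    have h2 : f w + (W.erase w).sum f = W.sum f := add_sum_erase W f hw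
    have h3 := card_erase_add_one hw
    have h4 := h6 w
    have : f w = 4 ∨ f w = 5 ∨ f w = 6 := by omega
    rcases this with h | h | h <;> rw [h] at h1 h2 <;> omega

/-- The trace of `e` on the labels. -/
def trc {V : Type*} [DecidableEq V] (φ : Fin 6 ↪ V) (e : Finset V) : Finset (Fin 6) :=
  univ.filter fun i => φ i ∈ e

section
variable {V : Type*} [DecidableEq V] (φ : Fin 6 ↪ V)

lemma inter_map_trc (e : Finset V) (g : Finset (Fin 6)) :
    e ∩ g.map φ = (trc φ e ∩ g).map φ := by
  ext v
  simp only [mem_inter, mem_map, trc, mem_filter, mem_univ, true_and]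
  constructor
  · rintro ⟨h, i, hi, rfl⟩
    exact ⟨i, ⟨h, hi⟩, rfl⟩
  · rintro ⟨i, ⟨h, hi⟩, rfl⟩
    exact ⟨h, i, hi, rfl⟩

lemma card_inter_map_trc (e : Finset V) (g : Finset (Fin 6)) :
    (e ∩ g.map φ).card = (trc φ e ∩ g).card := by
  rw [inter_map_trc, card_map]

lemma trc_map (g : Finset (Fin 6)) : trc φ (g.map φ) = g := by
  ext i; simp [trc]

lemma trc_insert (w : V) (hw : w ∉ univ.map φ) (g : Finset (Fin 6)) :
    trc φ (insert w (g.map φ)) = g := by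
  ext i
  have : φ i ≠ w := by rintro rfl; simp at hw
  simp [trc, this]

theorem main_aux [Fintype V] (H : Finset (Finset V)) (h3 : ∀ e ∈ H, e.card = 3)
    (hP : ¬ HasP33 H) (hC : ∀ g ∈ triE, g.map φ ∈ H) (U : Finset V) (hU : U = univ.map φ)
    (hne : (H.filter fun e => (e ∩ U).Nonempty ∧ (e \ U).Nonempty).Nonempty) :
    (H.filter fun e => e ⊆ U).card +
      (H.filter fun e => (e ∩ U).Nonempty ∧ (e \ U).Nonempty).card ≤
      13 + max (3 * (univ \ U).card) 6 := by
  -- structure of crossing edges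
  have hcross : ∀ e ∈ H, (e ∩ U).Nonempty → (e \ U).Nonempty →
      trc φ e ∈ netE ∧ ∃ w ∈ univ \ U, e = insert w ((trc φ e).map φ) := by
    intro e he h1 h2
    have hinter : e ∩ U = (trc φ e).map φ := by
      rw [hU, inter_map_trc, inter_univ]
    have hcard := card_sdiff_add_card_inter e U
    rw [hinter, card_map, h3 e he] at hcard
    have hpos := h2.card_pos
    have hnet : trc φ e ∈ netE := by
      by_contra hn
      obtain ⟨g, hg, g', hg', a, b, c⟩ := net_of_no_path (trc φ e)
        (by rw [hinter] at h1; simpa using h1) (by omega) hn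
      refine hP ⟨e, g.map φ, g'.map φ, he, hC g hg, hC g' hg', ?_, ?_, ?_⟩
      · rw [card_inter_map_trc, a]
      · rw [card_inter_map_trc, trc_map, b]
      · rw [inter_map_trc, c, map_empty]
    refine ⟨hnet, ?_⟩
    rw [net_card _ hnet] at hcard
    obtain ⟨w, hw⟩ := card_eq_one.1 (show (e \ U).card = 1 by omega)
    have hwm : w ∈ e \ U := by simp [hw]
    refine ⟨w, by simpa using (mem_sdiff.1 hwm).2, ?_⟩
    rw [← hinter, insert_eq, ← hw, sdiff_union_inter]
  have hA : (H.filter fun e => e ⊆ U).card ≤ 13 := by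
    obtain ⟨e, he⟩ := hne
    rw [mem_filter] at he
    obtain ⟨heH, h1, h2⟩ := he
    obtain ⟨hnet, -⟩ := hcross e heH h1 h2
    obtain ⟨x, y, hxy, hpe⟩ := card_eq_two.1 (net_card _ hnet)
    obtain ⟨t₀, ht0, hd, g, hg, hg1, hg2⟩ := net_forbidden _ hnet
    set G := (univ : Finset (Finset (Fin 6))).filter fun t => t.map φ ∈ H with hG
    have hle : (H.filter fun e => e ⊆ U).card ≤ G.card := by
      refine (card_le_card (t := G.image fun t => t.map φ) ?_).trans card_image_le
      intro f hf
      rw [mem_filter] at hf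
      have : (trc φ f).map φ = f := by
        rw [← inter_univ (trc φ f), ← inter_map_trc, ← hU, inter_eq_left.2 hf.2]
      rw [mem_image]
      exact ⟨trc φ f, by simp [hG, this, hf.1], this⟩
    refine hle.trans (sep_bound x y hxy t₀ ht0 ?_ ?_ G ?_ ?_ ?_)
    · intro hx
      have : x ∈ trc φ e ∩ t₀ := by simp [hpe, hx]
      simp [hd] at this
    · intro hx
      have : y ∈ trc φ e ∩ t₀ := by simp [hpe, hx]
      simp [hd] at this
    · intro t ht
      have := h3 _ (mem_filter.1 ht).2
      simpa using this
    · intro ht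
      refine hP ⟨e, g.map φ, t₀.map φ, heH, hC g hg, (mem_filter.1 ht).2, ?_, ?_, ?_⟩
      · rw [card_inter_map_trc, hg1]
      · rw [card_inter_map_trc, trc_map, hg2]
      · rw [inter_map_trc, hd, map_empty]
    · intro t ht hx hy htc
      refine hP ⟨t.map φ, e, tᶜ.map φ, (mem_filter.1 ht).2, heH, (mem_filter.1 htc).2, ?_, ?_, ?_⟩
      · rw [inter_comm, card_inter_map_trc, hpe]
        have : ({x, y} : Finset (Fin 6)) ∩ t = {x} := by
          ext i; simp only [mem_inter, mem_insert, mem_singleton]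
          grind
        simp [this]
      · rw [card_inter_map_trc, hpe]
        have : ({x, y} : Finset (Fin 6)) ∩ tᶜ = {y} := by
          ext i; simp only [mem_inter, mem_insert, mem_singleton, mem_compl]
          grind
        simp [this]
      · rw [inter_map_trc, trc_map, inter_compl, map_empty]
  have hB : (H.filter fun e => (e ∩ U).Nonempty ∧ (e \ U).Nonempty).card ≤
      max (3 * (univ \ U).card) 6 := by
    set L : V → Finset (Finset (Fin 6)) :=
      fun w => netE.filter fun p => insert w (p.map φ) ∈ H with hL
    refine le_trans ?_ (sum_bound (univ \ U) (fun w => (L w).card) ?_ ?_)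
    · refine (card_le_card (t := (univ \ U).biUnion fun w =>
        (L w).image fun p => insert w (p.map φ)) ?_).trans
        (card_biUnion_le.trans (sum_le_sum fun w _ => card_image_le))
      intro e he
      rw [mem_filter] at he
      obtain ⟨heH, h1, h2⟩ := he
      obtain ⟨hnet, w, hw, hew⟩ := hcross e heH h1 h2
      rw [mem_biUnion]
      refine ⟨w, hw, mem_image.2 ⟨trc φ e, ?_, hew.symm⟩⟩
      rw [hL, mem_filter]
      exact ⟨hnet, hew ▸ heH⟩
    · intro w
      exact (card_filter_le _ _).trans (by decide +kernel)
    · intro w hw w' hw' hww hpos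
      have hsub : L w' ⊆ netE.filter fun q => ∀ p ∈ L w, p ∩ q ≠ ∅ := by
        intro q hq
        have hq' := mem_filter.1 hq
        refine mem_filter.2 ⟨hq'.1, fun p hp hpq => ?_⟩
        have hp' := mem_filter.1 hp
        have hwU : w ∉ univ.map φ := by rw [← hU]; simpa using hw
        have hwU' : w' ∉ univ.map φ := by rw [← hU]; simpa using hw'
        obtain ⟨g, hg, a, b⟩ := net_cross p hp'.1 q hq'.1 hpq
        refine hP ⟨_, g.map φ, _, hp'.2, hC g hg, hq'.2, ?_, ?_, ?_⟩
        · rw [card_inter_map_trc, trc_insert φ w hwU, a]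
        · rw [inter_comm, card_inter_map_trc, trc_insert φ w' hwU', b]
        · have h1 : w' ∉ insert w (p.map φ) := by
            rw [mem_insert, not_or]
            exact ⟨hww.symm, fun h => hwU' (map_subset_map.2 (subset_univ _) h)⟩
          have h2 : w ∉ q.map φ := fun h => hwU (map_subset_map.2 (subset_univ _) h)
          rw [inter_insert_of_notMem h1, inter_map_trc, trc_insert φ w hwU, hpq, map_empty]
      have := net_count (L w) (filter_subset _ _)
      have := card_le_card hsub
      show (L w).card + (L w').card ≤ 6
      omega
  omega

end

theorem lemma_eueuw1 (V : Type*) [Fintype V] [DecidableEq V]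
    (H : Finset (Finset V)) (h3 : ∀ e ∈ H, e.card = 3) (hP : ¬ HasP33 H)
    (x₁ x₂ x₃ y₁ y₂ y₃ : V)
    (hdist : ({x₁, x₂, x₃, y₁, y₂, y₃} : Finset V).card = 6)
    (hc1 : ({x₁, y₂, x₃} : Finset V) ∈ H) (hc2 : ({x₂, y₃, x₁} : Finset V) ∈ H)
    (hc3 : ({x₃, y₁, x₂} : Finset V) ∈ H)
    (hs : 1 ≤ (Finset.univ \ ({x₁, x₂, x₃, y₁, y₂, y₃} : Finset V)).card)
    (hne : (H.filter fun e => (e ∩ ({x₁, x₂, x₃, y₁, y₂, y₃} : Finset V)).Nonempty ∧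
        (e \ ({x₁, x₂, x₃, y₁, y₂, y₃} : Finset V)).Nonempty).Nonempty) :
    (H.filter fun e => e ⊆ ({x₁, x₂, x₃, y₁, y₂, y₃} : Finset V)).card +
      (H.filter fun e => (e ∩ ({x₁, x₂, x₃, y₁, y₂, y₃} : Finset V)).Nonempty ∧
        (e \ ({x₁, x₂, x₃, y₁, y₂, y₃} : Finset V)).Nonempty).card ≤
      13 + max (3 * (Finset.univ \ ({x₁, x₂, x₃, y₁, y₂, y₃} : Finset V)).card) 6 := by
  have hinj : Function.Injective ![x₁, x₂, x₃, y₁, y₂, y₃] := by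
    have himg : (univ : Finset (Fin 6)).image ![x₁, x₂, x₃, y₁, y₂, y₃] =
        {x₁, x₂, x₃, y₁, y₂, y₃} := by
      ext v
      simp [Fin.exists_fin_succ, eq_comm]
    have hcard : ((univ : Finset (Fin 6)).image ![x₁, x₂, x₃, y₁, y₂, y₃]).card =
        (univ : Finset (Fin 6)).card := by
      rw [himg, hdist]; rfl
    have := card_image_iff.1 hcard
    simpa using this
  refine main_aux ⟨![x₁, x₂, x₃, y₁, y₂, y₃], hinj⟩ H h3 hP ?_ _ ?_ hne
  · intro g hg
    simp only [triE, mem_insert, mem_singleton] at hg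
    rcases hg with rfl | rfl | rfl
    · simpa [map_insert] using hc1
    · simpa [map_insert] using hc2
    · simpa [map_insert] using hc3
  · ext v
    simp [Fin.exists_fin_succ, eq_comm]
end

section
/- Let H be a P³₃-free 3-graph containing a triangle C on U, W = V(H)\U with |W| = s ≥ 3. If H has at least one edge meeting both U and W, then |H[U]| + |H(U,W)| ≤ 10 + 3s. -/
namespace L113

/-- the vertices of the triangle inside `Fin 8` -/
def U8 : Finset (Fin 8) := {0, 1, 2, 3, 4, 5}
/-- the three triangle edges -/
def C8 : Fin 3 → Finset (Fin 8) := ![{0, 4, 2}, {1, 5, 0}, {2, 3, 1}]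
/-- the six admissible pairs -/
def pr : Fin 6 → Finset (Fin 8) := ![{0, 3}, {1, 4}, {2, 5}, {0, 1}, {0, 2}, {1, 2}]
/-- triples containing `0` -/
def T : Fin 10 → Finset (Fin 8) := ![{0, 1, 2}, {0, 1, 3}, {0, 1, 4}, {0, 1, 5}, {0, 2, 3},
  {0, 2, 4}, {0, 2, 5}, {0, 3, 4}, {0, 3, 5}, {0, 4, 5}]
/-- their complements -/
def Tc : Fin 10 → Finset (Fin 8) := fun i => U8 \ T i

/-- the triple intersects as a path -/
def IsP (A B C : Finset (Fin 8)) : Prop := (A ∩ B).card = 1 ∧ (B ∩ C).card = 1 ∧ A ∩ C = ∅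

instance (A B C : Finset (Fin 8)) : Decidable (IsP A B C) := by unfold IsP; infer_instance

/-- the pair `k` conflicts with having both `T i` and its complement -/
def bad (i : Fin 10) (k : Fin 6) : Bool := decide (i = 0 ∨ (T i ∩ pr k).card = 1)

lemma powEq : Finset.powersetCard 3 U8 ⊆ Finset.univ.image T ∪ Finset.univ.image Tc := by
  decide +kernel

lemma cross : ∀ k l : Fin 6, pr k ∩ pr l = ∅ →
    ∃ c, IsP (insert 6 (pr k)) (C8 c) (insert 7 (pr l)) := by decide +kernel

lemma badP : ∀ t : Fin 8, 6 ≤ t → ∀ (i : Fin 10) (k : Fin 6), bad i k = true →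
    (IsP (T i) (insert t (pr k)) (Tc i) ∨ ∃ c, IsP (insert t (pr k)) (C8 c) (Tc i)) := by
  decide +kernel

lemma netP : ∀ t : Fin 8, 6 ≤ t → ∀ p ∈ Finset.powersetCard 2 U8,
    (∃ k, p = pr k) ∨ ∃ c d, IsP (insert t p) (C8 c) (C8 d) := by decide +kernel

lemma oneP : ∀ i ∈ U8, ∃ c d, IsP {i, 6, 7} (C8 c) (C8 d) := by decide +kernel

/-- number of indices of pairs -/
def cnt (a : Fin 6 → Bool) : ℕ := (a 0).toNat + (a 1).toNat + (a 2).toNat + (a 3).toNat +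
  (a 4).toNat + (a 5).toNat

lemma finite_bools : ∀ a0 a1 a2 a3 a4 a5 b0 b1 b2 b3 b4 b5 : Bool,
    (a0 && (b1 || b2 || b5) || a1 && (b0 || b2 || b4) || a2 && (b0 || b1 || b3) ||
      a3 && b2 || a4 && b1 || a5 && b0) = false →
    a0.toNat + a1.toNat + a2.toNat + a3.toNat + a4.toNat + a5.toNat +
    (b0.toNat + b1.toNat + b2.toNat + b3.toNat + b4.toNat + b5.toNat) ≤ 6 ∧
    ((a0 || a1 || a2 || a3 || a4 || a5) = true →
    ((bif (a0 || b0) || ((a1 || b1) || ((a2 || b2) || ((a3 || b3) || ((a4 || b4) || ((a5 || b5) || false))))) then 1 else 2) +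
      (bif (a1 || b1) || ((a4 || b4) || ((a5 || b5) || false)) then 1 else 2) +
      (bif (a0 || b0) || ((a4 || b4) || ((a5 || b5) || false)) then 1 else 2) +
      (bif (a0 || b0) || ((a1 || b1) || ((a2 || b2) || ((a4 || b4) || ((a5 || b5) || false)))) then 1 else 2) +
      (bif (a2 || b2) || ((a3 || b3) || ((a5 || b5) || false)) then 1 else 2) +
      (bif (a0 || b0) || ((a1 || b1) || ((a2 || b2) || ((a3 || b3) || ((a5 || b5) || false)))) then 1 else 2) +
      (bif (a0 || b0) || ((a3 || b3) || ((a5 || b5) || false)) then 1 else 2) +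
      (bif (a1 || b1) || ((a3 || b3) || ((a4 || b4) || false)) then 1 else 2) +
      (bif (a2 || b2) || ((a3 || b3) || ((a4 || b4) || false)) then 1 else 2) +
      (bif (a0 || b0) || ((a1 || b1) || ((a2 || b2) || ((a3 || b3) || ((a4 || b4) || false)))) then 1 else 2)) +
    (a0.toNat + a1.toNat + a2.toNat + a3.toNat + a4.toNat + a5.toNat) +
    (b0.toNat + b1.toNat + b2.toNat + b3.toNat + b4.toNat + b5.toNat) ≤ 16) := by
  decide +kernel

section
variable {V : Type*} [DecidableEq V] (H : Finset (Finset V)) (φ : Fin 8 → V)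

/-- the pulled back edge indicator -/
def E (A : Finset (Fin 8)) : Bool := decide (A.image φ ∈ H)

lemma noP (hP : ¬ HasP33 H) (hφ : Function.Injective φ) {A B C : Finset (Fin 8)}
    (h : IsP A B C) (hA : A.image φ ∈ H) (hB : B.image φ ∈ H) (hC : C.image φ ∈ H) : False := by
  apply hP
  refine ⟨_, _, _, hA, hB, hC, ?_, ?_, ?_⟩
  · rw [← Finset.image_inter _ _ hφ, Finset.card_image_of_injective _ hφ]; exact h.1
  · rw [← Finset.image_inter _ _ hφ, Finset.card_image_of_injective _ hφ]; exact h.2.1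
  · rw [← Finset.image_inter _ _ hφ, h.2.2, Finset.image_empty]

/-- number of edges inside `U` -/
def hh : ℕ := ((Finset.powersetCard 3 U8).filter fun A => E H φ A = true).card
/-- number of admissible edges at `t` -/
def gg (t : Fin 8) : ℕ := ((Finset.univ : Finset (Fin 6)).filter
  fun k => E H φ (insert t (pr k)) = true).card

lemma gg_eq (t : Fin 8) : gg H φ t = cnt fun k => E H φ (insert t (pr k)) := by
  unfold gg cnt
  rw [Finset.card_filter, Fin.sum_univ_six]
  simp only [Bool.toNat, Bool.cond_eq_ite]

lemma hh_le : hh H φ ≤ ∑ i : Fin 10, ((E H φ (T i)).toNat + (E H φ (Tc i)).toNat) := by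
  unfold hh
  have h1 : ((Finset.powersetCard 3 U8).filter fun A => E H φ A = true) ⊆
      ((Finset.univ.filter fun i => E H φ (T i) = true).image T) ∪
      ((Finset.univ.filter fun i => E H φ (Tc i) = true).image Tc) := by
    intro A hA
    rw [Finset.mem_filter] at hA
    have := powEq hA.1
    simp only [Finset.mem_union, Finset.mem_image, Finset.mem_univ, true_and,
      Finset.mem_filter] at this ⊢
    rcases this with ⟨i, rfl⟩ | ⟨i, rfl⟩
    · exact Or.inl ⟨i, hA.2, rfl⟩
    · exact Or.inr ⟨i, hA.2, rfl⟩
  refine (Finset.card_le_card h1).trans ((Finset.card_union_le _ _).trans ?_)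
  rw [Finset.sum_add_distrib]
  apply add_le_add
  · refine Finset.card_image_le.trans ?_
    rw [Finset.card_filter]
    simp only [Bool.toNat, Bool.cond_eq_ite, le_refl]
  · refine Finset.card_image_le.trans ?_
    rw [Finset.card_filter]
    simp only [Bool.toNat, Bool.cond_eq_ite, le_refl]

/-- upper bound for one complementary pair -/
def tb (a b : Fin 6 → Bool) (i : Fin 10) : ℕ :=
  bif (bad i 0 && (a 0 || b 0)) || ((bad i 1 && (a 1 || b 1)) || ((bad i 2 && (a 2 || b 2)) ||
    ((bad i 3 && (a 3 || b 3)) || ((bad i 4 && (a 4 || b 4)) || ((bad i 5 && (a 5 || b 5)) ||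
      false))))) then 1 else 2

lemma tb_cases (a b : Fin 6 → Bool) (i : Fin 10) :
    (tb a b i = 1 ∧ ∃ k, bad i k = true ∧ (a k || b k) = true) ∨ tb a b i = 2 := by
  unfold tb
  rw [Bool.cond_eq_ite]
  split_ifs with h
  · simp only [Bool.or_eq_true (_ && _), Bool.and_eq_true, Bool.false_eq_true, or_false] at h
    refine Or.inl ⟨rfl, ?_⟩
    rcases h with h | h | h | h | h | h <;> exact ⟨_, h⟩
  · exact Or.inr rfl

lemma fin_fun (a b : Fin 6 → Bool)
    (hab : ∀ k l, pr k ∩ pr l = ∅ → ¬ (a k = true ∧ b l = true)) :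
    cnt a + cnt b ≤ 6 ∧ (0 < cnt a → ∑ i, tb a b i + cnt a + cnt b ≤ 16) := by
  have key := finite_bools (a 0) (a 1) (a 2) (a 3) (a 4) (a 5) (b 0) (b 1) (b 2) (b 3) (b 4) (b 5)
    (by
      have h01 := hab 0 1 (by decide)
      have h02 := hab 0 2 (by decide)
      have h05 := hab 0 5 (by decide)
      have h10 := hab 1 0 (by decide)
      have h12 := hab 1 2 (by decide)
      have h14 := hab 1 4 (by decide)
      have h20 := hab 2 0 (by decide)
      have h21 := hab 2 1 (by decide)
      have h23 := hab 2 3 (by decide)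
      have h32 := hab 3 2 (by decide)
      have h41 := hab 4 1 (by decide)
      have h50 := hab 5 0 (by decide)
      clear hab
      grind)
  refine ⟨key.1, fun hpos => ?_⟩
  have := key.2 (by unfold cnt at hpos; clear key hab; grind)
  refine le_trans ?_ this
  have hs : ∑ i, tb a b i = tb a b 0 + tb a b 1 + tb a b 2 + tb a b 3 + tb a b 4 + tb a b 5 +
      tb a b 6 + tb a b 7 + tb a b 8 + tb a b 9 := by
    simp only [Fin.sum_univ_castSucc, Finset.univ_eq_empty, Finset.sum_empty, zero_add]
    rfl
  rw [hs]
  exact le_refl _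

lemma key (hP : ¬ HasP33 H) (hφ : Function.Injective φ) (hC : ∀ c, (C8 c).image φ ∈ H) :
    gg H φ 6 + gg H φ 7 ≤ 6 ∧ (0 < gg H φ 6 → hh H φ + gg H φ 6 + gg H φ 7 ≤ 16) := by
  rw [gg_eq, gg_eq]
  set a : Fin 6 → Bool := fun k => E H φ (insert 6 (pr k)) with ha
  set b : Fin 6 → Bool := fun k => E H φ (insert 7 (pr k)) with hb
  obtain ⟨h1, h2⟩ := fin_fun a b (by
    rintro k l hkl ⟨h1, h2⟩
    obtain ⟨c, hc⟩ := cross k l hkl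
    exact noP H φ hP hφ hc (of_decide_eq_true h1) (hC c) (of_decide_eq_true h2))
  refine ⟨h1, fun hpos => le_trans ?_ (h2 hpos)⟩
  gcongr
  refine (hh_le H φ).trans (Finset.sum_le_sum fun i _ => ?_)
  have t1 := Bool.toNat_le (E H φ (T i))
  have t2 := Bool.toNat_le (E H φ (Tc i))
  rcases tb_cases a b i with ⟨h, k, hk, hab⟩ | h
  · by_contra hcon
    have e1 : E H φ (T i) = true := by
      rw [← Bool.toNat_eq_one]; omega
    have e2 : E H φ (Tc i) = true := by
      rw [← Bool.toNat_eq_one]; omega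
    have fin : ∀ t : Fin 8, 6 ≤ t → E H φ (insert t (pr k)) = true → False := by
      intro t ht hE
      rcases badP t ht i k hk with h | ⟨c, h⟩
      · exact noP H φ hP hφ h (of_decide_eq_true e1) (of_decide_eq_true hE) (of_decide_eq_true e2)
      · exact noP H φ hP hφ h (of_decide_eq_true hE) (hC c) (of_decide_eq_true e2)
    rw [Bool.or_eq_true] at hab
    rcases hab with h | h
    · exact fin 6 (by decide) h
    · exact fin 7 (by decide) h
  · omega

lemma hU_le (h3 : ∀ e ∈ H, e.card = 3) (hφ : Function.Injective φ) :
    (H.filter fun e => e ⊆ U8.image φ).card ≤ hh H φ := by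
  unfold hh
  refine le_trans (Finset.card_le_card ?_) (Finset.card_image_le (f := fun A => A.image φ))
  intro e he
  rw [Finset.mem_filter] at he
  obtain ⟨A, hA, rfl⟩ := Finset.subset_image_iff.1 he.2
  have := h3 _ he.1
  rw [Finset.card_image_of_injective _ hφ] at this
  rw [Finset.mem_image]
  exact ⟨A, by simp [E, he.1, this, Finset.mem_powersetCard, Finset.coe_subset.1 hA], rfl⟩

/-- edges at `w` with exactly two vertices in `U` -/
def F (U : Finset V) (w : V) : Finset (Finset V) :=
  H.filter fun e => w ∈ e ∧ (e ∩ U).card = 2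

lemma F_le (h3 : ∀ e ∈ H, e.card = 3) (hP : ¬ HasP33 H) (hφ : Function.Injective φ)
    (hC : ∀ c, (C8 c).image φ ∈ H) (t : Fin 8) (ht : 6 ≤ t) :
    (F H (U8.image φ) (φ t)).card ≤ gg H φ t := by
  unfold gg
  refine le_trans (Finset.card_le_card ?_)
    (Finset.card_image_le (f := fun k => (insert t (pr k)).image φ))
  intro e he
  unfold F at he
  rw [Finset.mem_filter] at he
  obtain ⟨heH, hw, h2⟩ := he
  obtain ⟨p, hp, hpe⟩ := Finset.subset_image_iff.1 (Finset.inter_subset_right (s₁ := e) (s₂ := U8.image φ))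
  have hp' : p ⊆ U8 := Finset.coe_subset.1 hp
  have hcp : p.card = 2 := by rw [← h2, ← hpe, Finset.card_image_of_injective _ hφ]
  have htU : t ∉ U8 := by clear hw; revert t; decide
  have htp : t ∉ p := fun h => htU (hp' h)
  have hee : (insert t p).image φ = e := by
    apply Finset.eq_of_subset_of_card_le
    · rw [Finset.image_insert, hpe]
      exact Finset.insert_subset hw Finset.inter_subset_left
    · rw [Finset.card_image_of_injective _ hφ, Finset.card_insert_of_notMem htp, hcp, h3 e heH]
  rcases netP t ht p (Finset.mem_powersetCard.2 ⟨hp', hcp⟩) with ⟨k, rfl⟩ | ⟨c, d, h⟩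
  · rw [Finset.mem_image]
    exact ⟨k, by
      rw [Finset.mem_filter]
      exact ⟨Finset.mem_univ _, decide_eq_true (hee.symm ▸ heH)⟩,
      hee⟩
  · exact (noP H φ hP hφ h (hee ▸ heH) (hC c) (hC d)).elim

end

end L113

open L113 in
theorem lemma_113s (V : Type*) [Fintype V] [DecidableEq V]
    (H : Finset (Finset V)) (h3 : ∀ e ∈ H, e.card = 3) (hP : ¬ HasP33 H)
    (x₁ x₂ x₃ y₁ y₂ y₃ : V)
    (hdist : ({x₁, x₂, x₃, y₁, y₂, y₃} : Finset V).card = 6)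
    (hc1 : ({x₁, y₂, x₃} : Finset V) ∈ H) (hc2 : ({x₂, y₃, x₁} : Finset V) ∈ H)
    (hc3 : ({x₃, y₁, x₂} : Finset V) ∈ H)
    (hs : 3 ≤ (Finset.univ \ ({x₁, x₂, x₃, y₁, y₂, y₃} : Finset V)).card)
    (hne : (H.filter fun e => (e ∩ ({x₁, x₂, x₃, y₁, y₂, y₃} : Finset V)).Nonempty ∧
        (e \ ({x₁, x₂, x₃, y₁, y₂, y₃} : Finset V)).Nonempty).Nonempty) :
    (H.filter fun e => e ⊆ ({x₁, x₂, x₃, y₁, y₂, y₃} : Finset V)).card +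
      (H.filter fun e => (e ∩ ({x₁, x₂, x₃, y₁, y₂, y₃} : Finset V)).Nonempty ∧
        (e \ ({x₁, x₂, x₃, y₁, y₂, y₃} : Finset V)).Nonempty).card ≤
      10 + 3 * (Finset.univ \ ({x₁, x₂, x₃, y₁, y₂, y₃} : Finset V)).card := by
  have hU : ∀ w w', ({x₁, x₂, x₃, y₁, y₂, y₃} : Finset V) =
      U8.image ![x₁, x₂, x₃, y₁, y₂, y₃, w, w'] := by
    intro w w'
    simp [U8, Finset.image_insert]
  have hCs : ∀ w w' c, (C8 c).image ![x₁, x₂, x₃, y₁, y₂, y₃, w, w'] ∈ H := by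
    intro w w' c
    fin_cases c
    · simpa [C8, Finset.image_insert] using hc1
    · simpa [C8, Finset.image_insert] using hc2
    · simpa [C8, Finset.image_insert] using hc3
  have hinj : ∀ w w', w ∉ ({x₁, x₂, x₃, y₁, y₂, y₃} : Finset V) →
      w' ∉ ({x₁, x₂, x₃, y₁, y₂, y₃} : Finset V) → w ≠ w' →
      Function.Injective ![x₁, x₂, x₃, y₁, y₂, y₃, w, w'] := by
    intro w w' hw hw' hww
    have h8 : Finset.univ.image ![x₁, x₂, x₃, y₁, y₂, y₃, w, w'] =
        insert w (insert w' ({x₁, x₂, x₃, y₁, y₂, y₃} : Finset V)) := by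
      have hu : (Finset.univ : Finset (Fin 8)) = insert 6 (insert 7 U8) := by decide
      rw [hu, Finset.image_insert, Finset.image_insert, ← hU w w']
      rfl
    have hc : (Finset.univ.image ![x₁, x₂, x₃, y₁, y₂, y₃, w, w']).card =
        (Finset.univ : Finset (Fin 8)).card := by
      rw [h8, Finset.card_insert_of_notMem (by simp only [Finset.mem_insert (a := w) (b := w')]; tauto),
        Finset.card_insert_of_notMem hw', hdist]
      rfl
    have := Finset.card_image_iff.1 hc
    exact fun a b hab => this (by simp) (by simp) hab
  generalize hUU : ({x₁, x₂, x₃, y₁, y₂, y₃} : Finset V) = U at *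
  -- pair inequality
  have hpair : ∀ w w', w ∉ U → w' ∉ U → w ≠ w' →
      (F H U w).card + (F H U w').card ≤ 6 ∧
      (0 < (F H U w).card →
        (H.filter fun e => e ⊆ U).card + (F H U w).card + (F H U w').card ≤ 16) := by
    intro w w' hw hw' hww
    have i := hinj w w' hw hw' hww
    have c := hCs w w'
    have k := key H _ hP i c
    have u := hU_le H _ h3 i
    have f6 := F_le H _ h3 hP i c 6 (by decide)
    have f7 := F_le H _ h3 hP i c 7 (by decide)
    rw [← hU w w'] at u f6 f7
    change (F H U w).card ≤ _ at f6
    change (F H U w').card ≤ _ at f7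
    refine ⟨by omega, fun hp => ?_⟩
    have := k.2 (by omega)
    omega
  have htwo : ∀ e ∈ H, (e ∩ U).Nonempty → (e \ U).Nonempty → (e ∩ U).card = 2 := by
    intro e he h1 h2
    have h1' := h1.card_pos
    have h2' := h2.card_pos
    have hs3 := Finset.card_inter_add_card_sdiff e U
    rw [h3 e he] at hs3
    by_contra hcon
    have e1 : (e ∩ U).card = 1 := by omega
    have e2 : (e \ U).card = 2 := by omega
    obtain ⟨u, hu⟩ := Finset.card_eq_one.1 e1
    obtain ⟨w, w', hww, hw⟩ := Finset.card_eq_two.1 e2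
    have hwU : w ∉ U := (Finset.mem_sdiff.1 (hw ▸ Finset.mem_insert_self w {w'} : w ∈ e \ U)).2
    have hwU' : w' ∉ U := (Finset.mem_sdiff.1 (hw ▸ (by simp) : w' ∈ e \ U)).2
    have i := hinj w w' hwU hwU' hww
    have c := hCs w w'
    have huU : u ∈ U := (Finset.mem_inter.1 (hu ▸ Finset.mem_singleton_self u : u ∈ e ∩ U)).2
    rw [hU w w', Finset.mem_image] at huU
    obtain ⟨j, hj, hju⟩ := huU
    obtain ⟨c1, d1, hh⟩ := oneP j hj
    refine noP H _ hP i hh ?_ (c c1) (c d1)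
    have : e = {u, w, w'} := by
      have := Finset.sdiff_union_inter e U
      rw [hu, hw] at this
      rw [← this]
      ext; simp; tauto
    rw [Finset.image_insert, hju, Finset.image_insert, Finset.image_singleton]
    rw [this] at he
    exact he
  have hsub : (H.filter fun e => (e ∩ U).Nonempty ∧ (e \ U).Nonempty) ⊆
      (Finset.univ \ U).biUnion (F H U) := by
    intro e he
    rw [Finset.mem_filter] at he
    obtain ⟨heH, h1, w, hw⟩ := he
    rw [Finset.mem_biUnion]
    rw [Finset.mem_sdiff] at hw
    exact ⟨w, by simp [hw.2], Finset.mem_filter.2 ⟨heH, hw.1,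
      htwo e heH h1 ⟨w, Finset.mem_sdiff.2 hw⟩⟩⟩
  have hle := (Finset.card_le_card hsub).trans Finset.card_biUnion_le
  obtain ⟨w₁, hw₁, hmax⟩ := Finset.exists_max_image (Finset.univ \ U) (fun w => (F H U w).card)
    (Finset.card_pos.1 (by omega))
  have hpos : 0 < (F H U w₁).card := by
    obtain ⟨e, he⟩ := hne
    obtain ⟨w, hw, hew⟩ := Finset.mem_biUnion.1 (hsub he)
    exact lt_of_lt_of_le (Finset.card_pos.2 ⟨e, hew⟩) (hmax w hw)
  have hc1' := Finset.card_erase_of_mem hw₁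
  obtain ⟨w₂, hw₂⟩ := (Finset.card_pos (s := (Finset.univ \ U).erase w₁)).1 (by omega)
  have hc2' := Finset.card_erase_of_mem hw₂
  rw [← Finset.add_sum_erase _ _ hw₁, ← Finset.add_sum_erase _ _ hw₂] at hle
  have hrest : ∑ w ∈ ((Finset.univ \ U).erase w₁).erase w₂, (F H U w).card ≤
      (((Finset.univ \ U).erase w₁).erase w₂).card * 3 := by
    rw [← smul_eq_mul]
    apply Finset.sum_le_card_nsmul
    intro w hw
    have hw' := Finset.mem_of_mem_erase hw
    have hw'' := Finset.mem_of_mem_erase hw'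
    have p := (hpair w₁ w (Finset.mem_sdiff.1 hw₁).2 (Finset.mem_sdiff.1 hw'').2
      (Finset.ne_of_mem_erase hw').symm).1
    have m := hmax w hw''
    omega
  have p := (hpair w₁ w₂ (Finset.mem_sdiff.1 hw₁).2
    (Finset.mem_sdiff.1 (Finset.mem_of_mem_erase hw₂)).2 (Finset.ne_of_mem_erase hw₂).symm).2 hpos
  omega
end
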